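/- For every integer p ≥ 1, setting m = 2^{p+1} − 1, one has H(m−1, m) ≥ (m+1)·ln(m+1)/(2 ln 2) + 1. -/

import Mathlib

open Filter Polynomial

/-- `Γ` is a periodic orbit of the planar vector field `V`: the image of a
nonconstant periodic solution of `γ' = V ∘ γ`. -/
def IsPeriodicOrbit (V : ℝ × ℝ → ℝ × ℝ) (Γ : Set (ℝ × ℝ)) : Prop :=
  ∃ γ : ℝ → ℝ × ℝ,
    (∀ t : ℝ, HasDerivAt γ (V (γ t)) t) ∧
    (∃ T : ℝ, 0 < T ∧ Function.Periodic γ T) ∧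
    (∃ t₁ t₂ : ℝ, γ t₁ ≠ γ t₂) ∧
    Γ = Set.range γ

/-- `Γ` is a limit cycle of `V`: a periodic orbit which is isolated among
periodic orbits. -/
def IsLimitCycle (V : ℝ × ℝ → ℝ × ℝ) (Γ : Set (ℝ × ℝ)) : Prop :=
  IsPeriodicOrbit V Γ ∧
  ∃ U : Set (ℝ × ℝ), IsOpen U ∧ Γ ⊆ U ∧
    ∀ Γ' : Set (ℝ × ℝ), IsPeriodicOrbit V Γ' → Γ' ⊆ U → Γ' = Γ

/-- The Liénard vector field `ẋ = y, ẏ = -g(x) - ε f(x) y`. -/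
def lienard (f g : Polynomial ℝ) (ε : ℝ) : ℝ × ℝ → ℝ × ℝ :=
  fun p => (p.2, -(g.eval p.1) - ε * (f.eval p.1) * p.2)

/-- `HGe n m c` formalizes `H(n,m) ≥ c`: there are polynomials `f, g` with
`deg f ≤ n`, `deg g ≤ m` and `ε₀ > 0` such that for every `0 < ε ≤ ε₀` the
Liénard system has at least `c` pairwise distinct limit cycles. -/
def HGe (n m : ℕ) (c : ℝ) : Prop :=
  ∃ f g : Polynomial ℝ, f.natDegree ≤ n ∧ g.natDegree ≤ m ∧
    ∃ ε₀ : ℝ, 0 < ε₀ ∧ ∀ ε : ℝ, 0 < ε → ε ≤ ε₀ →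
      ∃ S : Finset (Set (ℝ × ℝ)),
        (∀ Γ ∈ S, IsLimitCycle (lienard f g ε) Γ) ∧ c ≤ (S.card : ℝ)

open scoped Topology ContDiff

/-- The Banach algebra of continuous functions on `[0, 1]`. -/
abbrev CI := C(Set.Icc (0 : ℝ) 1, ℝ)

namespace CI

/-- Extension of a continuous function on `[0, 1]` to `ℝ`, constant outside. -/
noncomputable def ext (v : CI) : ℝ → ℝ := Set.IccExtend zero_le_one v

theorem continuous_ext (v : CI) : Continuous (ext v) := v.continuous.Icc_extend'

theorem ext_coe (v : CI) (t : Set.Icc (0 : ℝ) 1) : ext v t = v t := by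
  simp [ext]

theorem ext_of_mem (v : CI) {t : ℝ} (ht : t ∈ Set.Icc (0 : ℝ) 1) : ext v t = v ⟨t, ht⟩ := by
  simp [ext, Set.IccExtend_of_mem _ _ ht]

theorem abs_ext_le (v : CI) (t : ℝ) : |ext v t| ≤ ‖v‖ :=
  v.norm_coe_le_norm (Set.projIcc 0 1 zero_le_one t)

/-- The primitive vanishing at `0`, as a linear map. -/
noncomputable def primitiveLM : CI →ₗ[ℝ] CI where
  toFun v := ⟨fun t => ∫ s in (0 : ℝ)..t, ext v s,
    (intervalIntegral.continuous_primitive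
      (fun a b => (continuous_ext v).intervalIntegrable a b) 0).comp continuous_subtype_val⟩
  map_add' u v := by
    ext t
    have : ∀ s, ext (u + v) s = ext u s + ext v s := fun s => by simp [ext, Set.IccExtend]
    simp only [ContinuousMap.coe_mk, ContinuousMap.add_apply, this]
    exact intervalIntegral.integral_add ((continuous_ext u).intervalIntegrable _ _)
      ((continuous_ext v).intervalIntegrable _ _)
  map_smul' c v := by
    ext t
    have : ∀ s, ext (c • v) s = c * ext v s := fun s => by simp [ext, Set.IccExtend]
    simp [this]

/-- The primitive vanishing at `0`, as a continuous linear map. -/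
noncomputable def primitive : CI →L[ℝ] CI :=
  primitiveLM.mkContinuous 1 fun v => by
    rw [one_mul, ContinuousMap.norm_le _ (norm_nonneg v)]
    intro t
    refine (intervalIntegral.norm_integral_le_of_norm_le_const
      (C := ‖v‖) (fun s _ => abs_ext_le v s)).trans ?_
    rw [sub_zero, abs_of_nonneg t.2.1]
    exact mul_le_of_le_one_right (norm_nonneg v) t.2.2

theorem primitive_apply (v : CI) (t : Set.Icc (0 : ℝ) 1) :
    primitive v t = ∫ s in (0 : ℝ)..t, ext v s := rfl

theorem norm_primitive_le (v : CI) : ‖primitive v‖ ≤ ‖v‖ := by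
  simpa using LinearMap.mkContinuous_norm_le primitiveLM zero_le_one _ |> fun h =>
    (primitive.le_opNorm v).trans (mul_le_mul_of_nonneg_right h (norm_nonneg v))

/-- A Volterra operator `v ↦ a · ∫₀ v` preceded by multiplication. -/
noncomputable def volterra (a : CI) : CI →L[ℝ] CI :=
  primitive ∘L (ContinuousLinearMap.mul ℝ CI a) ∘L primitive

theorem abs_volterra_le (a v : CI) (n : ℕ) (C : ℝ) (hC : 0 ≤ C)
    (h : ∀ t : Set.Icc (0 : ℝ) 1, |v t| ≤ C * (t : ℝ) ^ n / n.factorial)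
    (t : Set.Icc (0 : ℝ) 1) :
    |volterra a v t| ≤ ‖a‖ * C * (t : ℝ) ^ (n + 1) / (n + 1).factorial := by
  have key : ∀ (w : CI) (D : ℝ) (_ : 0 ≤ D) (k : ℕ)
      (_ : ∀ t : Set.Icc (0 : ℝ) 1, |w t| ≤ D * (t : ℝ) ^ k / k.factorial)
      (t : Set.Icc (0 : ℝ) 1), |primitive w t| ≤ D * (t : ℝ) ^ (k + 1) / (k + 1).factorial := by
    intro w D hD k hw t
    rw [primitive_apply]
    have h1 : ∀ s ∈ Set.Ioc (0 : ℝ) t, ‖ext w s‖ ≤ D * s ^ k / k.factorial := by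
      intro s hs
      have hs' : s ∈ Set.Icc (0 : ℝ) 1 := ⟨hs.1.le, hs.2.trans t.2.2⟩
      rw [ext_of_mem _ hs']
      exact hw ⟨s, hs'⟩
    have h2 := intervalIntegral.norm_integral_le_of_norm_le (f := ext w)
      (μ := MeasureTheory.volume) t.2.1
      (MeasureTheory.ae_of_all _ h1)
      (Continuous.intervalIntegrable (by fun_prop) _ _)
    refine h2.trans_eq ?_
    rw [intervalIntegral.integral_div, intervalIntegral.integral_const_mul, integral_pow]
    have : (k.factorial : ℝ) ≠ 0 := by positivity
    have : ((k : ℝ) + 1) ≠ 0 := by positivity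
    rw [Nat.factorial_succ]
    push_cast
    field_simp
    simp
  have h1 := key v C hC n h
  refine key _ (‖a‖ * C) (by positivity) n (fun t => ?_) t
  change |(a * primitive v) t| ≤ _
  rw [ContinuousMap.mul_apply, abs_mul]
  have h3 : |a t| ≤ ‖a‖ := a.norm_coe_le_norm t
  have h4 : |primitive v t| ≤ C * (t : ℝ) ^ n / n.factorial := by
    refine (key v C hC n h t).trans ?_
    have := t.2.1
    have := t.2.2
    gcongr ?_ / ?_
    · exact mul_le_mul_of_nonneg_left (pow_le_pow_of_le_one ‹_› ‹_› n.le_succ) hC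
    · exact_mod_cast Nat.factorial_le n.le_succ
  calc |a t| * |primitive v t| ≤ ‖a‖ * (C * (t : ℝ) ^ n / n.factorial) := by gcongr
    _ = _ := by ring

theorem norm_volterra_pow_le (a : CI) (n : ℕ) :
    ‖volterra a ^ n‖ ≤ ‖a‖ ^ n / n.factorial := by
  refine ContinuousLinearMap.opNorm_le_bound _ (by positivity) fun v => ?_
  have key : ∀ n, ∀ t : Set.Icc (0 : ℝ) 1,
      |(volterra a ^ n) v t| ≤ (‖a‖ ^ n * ‖v‖) * (t : ℝ) ^ n / n.factorial := by
    intro n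
    induction n with
    | zero => intro t; simpa using v.norm_coe_le_norm t
    | succ n ih =>
      intro t
      rw [pow_succ']
      refine (abs_volterra_le a _ n _ (by positivity) ih t).trans_eq ?_
      ring
  rw [ContinuousMap.norm_le _ (by positivity)]
  intro t
  refine (key n t).trans ?_
  rw [mul_div_right_comm]
  have h1 : (t : ℝ) ^ n ≤ 1 := pow_le_one₀ t.2.1 t.2.2
  calc (‖a‖ ^ n * ‖v‖) / n.factorial * (t : ℝ) ^ n ≤ (‖a‖ ^ n * ‖v‖) / n.factorial * 1 := by
        gcongr
    _ = _ := by ring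

theorem isUnit_one_sub_volterra (a : CI) : IsUnit (1 - volterra a) := by
  obtain ⟨n, hn⟩ := ((FloorSemiring.tendsto_pow_div_factorial_atTop ‖a‖).eventually
    (gt_mem_nhds (zero_lt_one' ℝ))).exists
  have h1 : IsUnit (1 - volterra a ^ n) :=
    isUnit_one_sub_of_norm_lt_one (R := CI →L[ℝ] CI) ((norm_volterra_pow_le a n).trans_lt hn)
  rw [← mul_neg_geom_sum] at h1
  refine ((Commute.isUnit_mul_iff ?_).1 h1).1
  exact (Commute.sub_left (Commute.one_left _)
    (Commute.sum_right _ _ _ fun i _ => Commute.self_pow _ _))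

section aeval

theorem contDiff_aeval_algebra {A : Type*} [NormedCommRing A] [NormedAlgebra ℝ A] (p : ℝ[X])
    {n : ℕ∞ω} : ContDiff ℝ n fun x : A => aeval x p := by
  induction p using Polynomial.induction_on' with
  | add p q hp hq => simpa using hp.add hq
  | monomial k c =>
    simp only [aeval_monomial]
    exact contDiff_const.mul (contDiff_id.pow k)

theorem hasFDerivAt_aeval_algebra {A : Type*} [NormedCommRing A] [NormedAlgebra ℝ A] (p : ℝ[X])
    (x : A) : HasFDerivAt (fun x : A => aeval x p)
      (ContinuousLinearMap.mul ℝ A (aeval x (derivative p))) x := by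
  induction p using Polynomial.induction_on' with
  | add p q hp hq => simpa using! hp.add hq
  | monomial k c =>
    have h := (hasFDerivAt_pow (𝕜 := ℝ) k (x := x)).const_mul (algebraMap ℝ A c)
    simp only [aeval_monomial]
    refine h.congr_fderiv ?_
    ext v
    simp [derivative_monomial, aeval_monomial, Algebra.smul_def]
    ring

end aeval

end CI

namespace CI

theorem aeval_apply' (p : ℝ[X]) (v : CI) (t : Set.Icc (0 : ℝ) 1) :
    (aeval v p : CI) t = p.eval (v t) := by
  rw [Polynomial.aeval_continuousMap_apply]

/-- Position component of a rescaled trajectory with starting abscissa `s`, duration `T` and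
velocity `v`. -/
noncomputable def position (s T : ℝ) (v : CI) : CI := algebraMap ℝ CI s + T • primitive v

/-- The integral equation for the velocity of a trajectory of the Liénard system leaving `(s, 0)`,
rescaled to the time interval `[0, 1]`. -/
noncomputable def defect (f g : ℝ[X]) (q : (ℝ × ℝ × ℝ) × CI) : CI :=
  q.2 + q.1.2.2 • primitive (aeval (position q.1.2.1 q.1.2.2 q.2) g +
    q.1.1 • (aeval (position q.1.2.1 q.1.2.2 q.2) f * q.2))

theorem position_apply (s T : ℝ) (v : CI) (t : Set.Icc (0 : ℝ) 1) :
    position s T v t = s + T * ∫ r in (0 : ℝ)..t, ext v r := by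
  simp [position, primitive_apply]

theorem contDiff_position {n : ℕ∞ω} :
    ContDiff ℝ n fun q : (ℝ × ℝ) × CI => position q.1.1 q.1.2 q.2 := by
  have h1 : ContDiff ℝ n fun q : (ℝ × ℝ) × CI => algebraMap ℝ CI q.1.1 :=
    (algebraMapCLM ℝ CI).contDiff.comp contDiff_fst.fst
  exact h1.add (contDiff_fst.snd.smul (primitive.contDiff.comp contDiff_snd))

theorem contDiff_defect (f g : ℝ[X]) {n : ℕ∞ω} : ContDiff ℝ n (defect f g) := by
  have hp : ContDiff ℝ n fun q : (ℝ × ℝ × ℝ) × CI => position q.1.2.1 q.1.2.2 q.2 :=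
    contDiff_position.comp (contDiff_fst.snd.prodMk contDiff_snd)
  have hg := (contDiff_aeval_algebra g).comp hp
  have hf := (contDiff_aeval_algebra f).comp hp
  exact contDiff_snd.add (contDiff_fst.snd.snd.smul (primitive.contDiff.comp
    (hg.add (contDiff_fst.fst.smul (hf.mul contDiff_snd)))))

theorem isInvertible_fderiv_defect (f g : ℝ[X]) (s T : ℝ) (v : CI) :
    (fderiv ℝ (defect f g) ((0, s, T), v) ∘L .inr ℝ (ℝ × ℝ × ℝ) CI).IsInvertible := by
  have h1 : HasFDerivAt (fun w : CI => defect f g ((0, s, T), w))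
      (fderiv ℝ (defect f g) ((0, s, T), v) ∘L .inr ℝ (ℝ × ℝ × ℝ) CI) v := by
    have h2 : HasFDerivAt (defect f g) (fderiv ℝ (defect f g) ((0, s, T), v)) ((0, s, T), v) :=
      (((contDiff_defect f g (n := 1)).differentiable one_ne_zero) _).hasFDerivAt
    exact h2.comp v (hasFDerivAt_prodMk_right _ _)
  have hpos : HasFDerivAt (fun w : CI => position s T w) (T • primitive) v :=
    (primitive.hasFDerivAt.const_smul T).const_add _
  have h3 := (hasFDerivAt_aeval_algebra g (position s T v)).comp v hpos
  have h4 : HasFDerivAt (fun w : CI => defect f g ((0, s, T), w))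
      (1 - volterra (-(T ^ 2) • aeval (position s T v) (derivative g))) v := by
    have h5 := (hasFDerivAt_id v).add (((primitive.hasFDerivAt).comp v h3).const_smul T)
    refine (h5.congr_fderiv ?_).congr_of_eventuallyEq (Eventually.of_forall fun w => ?_)
    · ext w t
      simp [volterra]
      ring
    · simp [defect]
  rw [h1.unique h4]
  obtain ⟨u, hu⟩ := isUnit_one_sub_volterra (-(T ^ 2) • aeval (position s T v) (derivative g))
  exact ⟨ContinuousLinearEquiv.unitsEquiv ℝ CI u, by rw [← hu]; rfl⟩

/-- The rescaling `t ↦ y (T t)` of a continuous function. -/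
noncomputable def rescale (y : C(ℝ, ℝ)) (T : ℝ) : CI :=
  ⟨fun t => y (T * t), by fun_prop⟩

theorem continuous_rescale (y : C(ℝ, ℝ)) : Continuous (rescale y) := by
  refine ContinuousMap.continuous_of_continuous_uncurry _ ?_
  change Continuous fun p : ℝ × Set.Icc (0 : ℝ) 1 => y (p.1 * p.2)
  fun_prop

theorem position_rescale {x : ℝ → ℝ} {y : C(ℝ, ℝ)} (hx : ∀ t, HasDerivAt x (y t) t) (T : ℝ)
    (t : Set.Icc (0 : ℝ) 1) : position (x 0) T (rescale y T) t = x (T * t) := by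
  rw [position_apply]
  have h1 : ∫ r in (0 : ℝ)..t, ext (rescale y T) r = ∫ r in (0 : ℝ)..t, y (T * r) := by
    refine intervalIntegral.integral_congr fun r hr => ?_
    rw [Set.uIcc_of_le t.2.1] at hr
    rw [ext_of_mem _ ⟨hr.1, hr.2.trans t.2.2⟩]
    rfl
  have h2 : T * ∫ r in (0 : ℝ)..t, y (T * r) = x (T * t) - x 0 := by
    rw [← smul_eq_mul, intervalIntegral.smul_integral_comp_mul_left, mul_zero]
    exact intervalIntegral.integral_eq_sub_of_hasDerivAt (fun r _ => hx r)
      (y.continuous.intervalIntegrable _ _)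
  rw [h1, h2]
  ring

theorem defect_rescale {f g : ℝ[X]} {x : ℝ → ℝ} {y : C(ℝ, ℝ)} (hx : ∀ t, HasDerivAt x (y t) t)
    (hy : ∀ t, HasDerivAt y (-g.eval (x t)) t) (hy0 : y 0 = 0) (T : ℝ) :
    defect f g ((0, x 0, T), rescale y T) = 0 := by
  ext t
  have hxc : Continuous x := continuous_iff_continuousAt.2 fun t => (hx t).continuousAt
  have h1 : ∫ r in (0 : ℝ)..t, ext (aeval (position (x 0) T (rescale y T)) g : CI) r =
      ∫ r in (0 : ℝ)..t, g.eval (x (T * r)) := by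
    refine intervalIntegral.integral_congr fun r hr => ?_
    rw [Set.uIcc_of_le t.2.1] at hr
    rw [ext_of_mem _ ⟨hr.1, hr.2.trans t.2.2⟩, aeval_apply', position_rescale hx]
  have h2 : T * ∫ r in (0 : ℝ)..t, g.eval (x (T * r)) = - y (T * t) := by
    rw [← smul_eq_mul, intervalIntegral.smul_integral_comp_mul_left (fun r => g.eval (x r)),
      mul_zero]
    have := intervalIntegral.integral_eq_sub_of_hasDerivAt (a := 0) (b := T * t)
      (fun r _ => (hy r).neg) (Continuous.intervalIntegrable (by fun_prop) _ _)
    simpa [hy0] using this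
  simp [defect, primitive_apply, h1, h2]
  simp [rescale]

/-- The family of trajectories of the Liénard system leaving `(s, 0)` until their first return to
the axis depends analytically on `(ε, s)`. -/
theorem exists_arc_family (f : ℝ[X]) {g : ℝ[X]} {x : ℝ → ℝ} {y : C(ℝ, ℝ)} {a T₀ : ℝ}
    (hx : ∀ t, HasDerivAt x (y t) t) (hy : ∀ t, HasDerivAt y (-g.eval (x t)) t)
    (hx0 : x 0 = a) (hy0 : y 0 = 0) (hT : y T₀ = 0) (hg : g.eval (x T₀) ≠ 0) :
    ∃ (T : ℝ × ℝ → ℝ) (Y : ℝ × ℝ → CI), ContDiffAt ℝ ω T (0, a) ∧ ContDiffAt ℝ ω Y (0, a) ∧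
      T (0, a) = T₀ ∧ Y (0, a) = rescale y T₀ ∧
      ∀ᶠ q in 𝓝 ((0 : ℝ), a), defect f g ((q.1, q.2, T q), Y q) = 0 ∧ Y q 1 = 0 := by
  subst hx0
  set u : (ℝ × ℝ × ℝ) × CI := ((0, x 0, T₀), rescale y T₀) with hu
  have cdf : ContDiffAt ℝ ω (defect f g) u := (contDiff_defect f g).contDiffAt
  have hω : (ω : ℕ∞ω) ≠ 0 := by simp
  have hinv : (fderiv ℝ (defect f g) u ∘L .inr ℝ (ℝ × ℝ × ℝ) CI).IsInvertible :=
    isInvertible_fderiv_defect f g _ _ _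
  have hu0 : defect f g u = 0 := defect_rescale hx hy hy0 T₀
  set Z := cdf.implicitFunction hω hinv with hZ
  have hZ0 : Z (0, x 0, T₀) = rescale y T₀ := cdf.implicitFunction_apply_self hω hinv
  have hZ1 : ∀ᶠ q in 𝓝 ((0 : ℝ), x 0, T₀), defect f g (q, Z q) = 0 := by
    simpa [hu0] using cdf.eventually_apply_implicitFunction hω hinv
  have hZ2 := cdf.eventually_apply_eq_iff_implicitFunction hω hinv
  have hZc : ContDiffAt ℝ ω Z (0, x 0, T₀) := cdf.contDiffAt_implicitFunction hω hinv
  have hZT : ∀ᶠ T in 𝓝 T₀, Z (0, x 0, T) = rescale y T := by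
    have hc : ContinuousAt (fun T => (((0 : ℝ), x 0, T), rescale y T)) T₀ :=
      ((Continuous.prodMk (by fun_prop) (continuous_rescale y))).continuousAt
    filter_upwards [hc.eventually hZ2] with T hT'
    rw [hu0] at hT'
    exact hT'.1 (defect_rescale hx hy hy0 T)
  let one : Set.Icc (0 : ℝ) 1 := 1
  set ψ : (ℝ × ℝ) × ℝ → ℝ := fun q => Z (q.1.1, q.1.2, q.2) 1 with hψ
  set w : (ℝ × ℝ) × ℝ := ((0, x 0), T₀) with hw
  have hassoc : ContDiff ℝ ω fun q : (ℝ × ℝ) × ℝ => (q.1.1, q.1.2, q.2) :=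
    contDiff_fst.fst.prodMk (contDiff_fst.snd.prodMk contDiff_snd)
  have hψc : ContDiffAt ℝ ω ψ w :=
    (ContinuousMap.evalCLM ℝ one : CI →L[ℝ] ℝ).contDiff.contDiffAt.comp w
      (ContDiffAt.comp w (f := fun q : (ℝ × ℝ) × ℝ => (q.1.1, q.1.2, q.2)) hZc
        hassoc.contDiffAt)
  have hψ0 : ψ w = 0 := by
    simp only [hψ, hw, hZ0]
    simpa [rescale] using hT
  have hd : HasDerivAt (fun T => ψ ((0, x 0), T)) (-g.eval (x T₀)) T₀ := by
    refine (hy T₀).congr_of_eventuallyEq ?_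
    filter_upwards [hZT] with T hT'
    simp [hψ, hT', rescale]
  have hd2 : HasFDerivAt (fun T => ψ ((0, x 0), T))
      (fderiv ℝ ψ w ∘L .inr ℝ (ℝ × ℝ) ℝ) T₀ :=
    ((hψc.differentiableAt hω).hasFDerivAt).comp T₀ (hasFDerivAt_prodMk_right _ _)
  have hinv2 : (fderiv ℝ ψ w ∘L .inr ℝ (ℝ × ℝ) ℝ).IsInvertible := by
    rw [hd2.unique hd.hasFDerivAt]
    refine ⟨ContinuousLinearEquiv.unitsEquivAut ℝ (Units.mk0 (-g.eval (x T₀)) (neg_ne_zero.2 hg)),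
      ?_⟩
    ext
    simp
  set T := hψc.implicitFunction hω hinv2 with hTdef
  have hT0 : T (0, x 0) = T₀ := hψc.implicitFunction_apply_self hω hinv2
  have hTc : ContDiffAt ℝ ω T (0, x 0) := hψc.contDiffAt_implicitFunction hω hinv2
  have hT1 : ∀ᶠ q in 𝓝 ((0 : ℝ), x 0), ψ (q, T q) = 0 := by
    simpa [hψ0] using hψc.eventually_apply_implicitFunction hω hinv2
  have hpair : ContDiffAt ℝ ω (fun q : ℝ × ℝ => (q.1, q.2, T q)) (0, x 0) :=
    contDiffAt_fst.prodMk (contDiffAt_snd.prodMk hTc)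
  refine ⟨T, fun q => Z (q.1, q.2, T q), hTc, ?_, hT0, by simp [hT0, hZ0], ?_⟩
  · refine ContDiffAt.comp (0, x 0) (f := fun q : ℝ × ℝ => (q.1, q.2, T q)) ?_ hpair
    rw [hT0]
    exact hZc
  · have h6 : ∀ᶠ q in 𝓝 ((0 : ℝ), x 0),
        defect f g ((q.1, q.2, T q), Z (q.1, q.2, T q)) = 0 := by
      have := hpair.continuousAt.tendsto
      simp only [hT0] at this
      exact this.eventually hZ1
    filter_upwards [h6, hT1] with q h7 h8
    exact ⟨h7, h8⟩

end CI

/-- `a` and `b` bound a well of the potential `G` at the common level `G a = G b`. -/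
structure IsOval (G : ℝ[X]) (a b : ℝ) : Prop where
  lt : a < b
  eq : G.eval a = G.eval b
  below : ∀ x ∈ Set.Ioo a b, G.eval x < G.eval a
  left : (derivative G).eval a < 0
  right : 0 < (derivative G).eval b

namespace IsOval

variable {G : ℝ[X]} {a b : ℝ}

theorem exists_factor (h : IsOval G a b) : ∃ Q : ℝ[X],
    (∀ x, G.eval a - G.eval x = (x - a) * (b - x) * Q.eval x) ∧
    ∀ x ∈ Set.Icc a b, 0 < Q.eval x := by
  have h1 : (X - C a) ∣ (C (G.eval a) - G) := dvd_iff_isRoot.2 (by simp)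
  obtain ⟨Q₁, hQ₁⟩ := h1
  have h2 : (X - C b) ∣ Q₁ := by
    refine dvd_iff_isRoot.2 ?_
    have : (C (G.eval a) - G).eval b = ((X - C a) * Q₁).eval b := by rw [hQ₁]
    simp [h.eq] at this
    rcases this with h3 | h3
    · exact absurd h3 (sub_ne_zero.2 h.lt.ne')
    · exact h3
  obtain ⟨Q₂, rfl⟩ := h2
  have hfac : ∀ x, G.eval a - G.eval x = (x - a) * (b - x) * (-Q₂).eval x := by
    intro x
    have : (C (G.eval a) - G).eval x = ((X - C a) * ((X - C b) * Q₂)).eval x := by rw [hQ₁]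
    simp only [eval_sub, eval_C, eval_mul, eval_X] at this
    rw [this, eval_neg]
    ring
  have hG : G = C (G.eval a) - (X - C a) * ((X - C b) * Q₂) := by rw [← hQ₁]; ring
  refine ⟨-Q₂, hfac, fun x hx => ?_⟩
  rcases eq_or_lt_of_le hx.1 with rfl | hax
  · have := h.left
    rw [hG] at this
    simp only [derivative_sub, derivative_C, derivative_mul, derivative_X, eval_sub, eval_mul,
      eval_add, eval_X, eval_C, eval_zero, eval_one] at this
    rw [eval_neg]
    have := h.lt
    nlinarith
  rcases eq_or_lt_of_le hx.2 with rfl | hxb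
  · have := h.right
    rw [hG] at this
    simp only [derivative_sub, derivative_C, derivative_mul, derivative_X, eval_sub, eval_mul,
      eval_add, eval_X, eval_C, eval_zero, eval_one] at this
    rw [eval_neg]
    have := h.lt
    nlinarith
  · have h3 := h.below x ⟨hax, hxb⟩
    have h4 := hfac x
    have h5 : 0 < (x - a) * (b - x) * (-Q₂).eval x := by linarith
    exact pos_of_mul_pos_right h5 (mul_nonneg (by linarith) (by linarith))

/-- A well of the potential carries a closed trajectory of the conservative system. -/
theorem exists_solution (h : IsOval G a b) : ∃ (x : ℝ → ℝ) (y : C(ℝ, ℝ)) (T : ℝ), 0 < T ∧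
    (∀ t, HasDerivAt x (y t) t) ∧ (∀ t, HasDerivAt y (-(derivative G).eval (x t)) t) ∧
    x 0 = a ∧ y 0 = 0 ∧ x T = b ∧ y T = 0 ∧ ∀ t ∈ Set.Ioo 0 T, 0 < y t := by
  obtain ⟨Q, hQ, hpos⟩ := h.exists_factor
  set A := (b - a) / 2 with hA
  have hA0 : 0 < A := by have := h.lt; simp only [hA]; linarith
  set X₀ : ℝ → ℝ := fun θ => (a + b) / 2 - A * Real.cos θ with hX₀
  have hX₀c : Continuous X₀ := by fun_prop
  have hmem : ∀ θ, X₀ θ ∈ Set.Icc a b := fun θ => by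
    have h1 := Real.cos_le_one θ
    have h2 := Real.neg_one_le_cos θ
    constructor <;> simp only [hX₀] <;> nlinarith
  have hq : ∀ θ, 0 < 2 * Q.eval (X₀ θ) := fun θ => mul_pos two_pos (hpos _ (hmem θ))
  set R : ℝ → ℝ := fun θ => √(2 * Q.eval (X₀ θ)) with hR
  have hR0 : ∀ θ, 0 < R θ := fun θ => Real.sqrt_pos.2 (hq θ)
  have hRc : Continuous R := by fun_prop
  have hκc : Continuous fun θ => (R θ)⁻¹ := hRc.inv₀ fun θ => (hR0 θ).ne'
  set Y₀ : ℝ → ℝ := fun θ => A * Real.sin θ * R θ with hY₀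
  have hX' : ∀ θ, HasDerivAt X₀ ((R θ)⁻¹ * Y₀ θ) θ := fun θ => by
    have h1 := ((Real.hasDerivAt_cos θ).const_mul A).const_sub ((a + b) / 2)
    refine h1.congr_deriv ?_
    simp only [hY₀]
    have := (hR0 θ).ne'
    field_simp
  have hG' : ∀ x, (derivative G).eval x =
      -((b - x) - (x - a)) * Q.eval x - (x - a) * (b - x) * (derivative Q).eval x := fun x => by
    have hG : G = C (G.eval a) - (X - C a) * (C b - X) * Q := by
      refine Polynomial.funext fun y => ?_
      have := hQ y
      simp only [eval_sub, eval_mul, eval_X, eval_C]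
      linarith
    rw [hG]
    simp only [derivative_sub, derivative_C, derivative_mul, derivative_X, eval_sub, eval_mul,
      eval_add, eval_X, eval_C, eval_zero, eval_one]
    ring
  have hY' : ∀ θ, HasDerivAt Y₀ ((R θ)⁻¹ * -(derivative G).eval (X₀ θ)) θ := fun θ => by
    have h1 : HasDerivAt R (((derivative Q).eval (X₀ θ) * (A * Real.sin θ)) * (R θ)⁻¹) θ := by
      have h2 : HasDerivAt X₀ (A * Real.sin θ) θ := by
        refine (hX' θ).congr_deriv ?_
        simp only [hY₀]
        have := (hR0 θ).ne'
        field_simp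
      have h3 := (((Q.hasDerivAt (X₀ θ)).comp θ h2).const_mul 2).sqrt (hq θ).ne'
      refine h3.congr_deriv ?_
      simp only [hR, Function.comp]
      have := (hR0 θ).ne'
      field_simp
    have h4 := ((Real.hasDerivAt_sin θ).const_mul A).mul h1
    refine h4.congr_deriv ?_
    rw [hG']
    have h5 : R θ ^ 2 = 2 * Q.eval (X₀ θ) := Real.sq_sqrt (hq θ).le
    have h6 : Q.eval (X₀ θ) = R θ ^ 2 / 2 := by linarith
    have h7 : (X₀ θ - a) * (b - X₀ θ) = (A * Real.sin θ) ^ 2 := by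
      simp only [hX₀, hA, mul_pow, Real.sin_sq]
      ring
    have h8 : (b - X₀ θ) - (X₀ θ - a) = 2 * (A * Real.cos θ) := by
      simp only [hX₀, hA]
      ring
    rw [h7, h8, h6]
    have := (hR0 θ).ne'
    field_simp
    ring
  set τ : ℝ → ℝ := fun θ => ∫ r in (0 : ℝ)..θ, (R r)⁻¹ with hτ
  have hτ' : ∀ θ, HasDerivAt τ (R θ)⁻¹ θ := fun θ =>
    hκc.integral_hasStrictDerivAt 0 θ |>.hasDerivAt
  have hmono : StrictMono τ := strictMono_of_hasDerivAt_pos hτ' fun θ => inv_pos.2 (hR0 θ)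
  have hτc : Continuous τ := continuous_iff_continuousAt.2 fun θ => (hτ' θ).continuousAt
  obtain ⟨M, hM⟩ : ∃ M, ∀ θ, R θ ≤ M := by
    obtain ⟨M, hM⟩ := (isCompact_Icc (a := a) (b := b)).bddAbove_image
      (f := fun x => √(2 * Q.eval x)) (by fun_prop)
    exact ⟨M, fun θ => hM ⟨_, hmem θ, rfl⟩⟩
  have hM0 : 0 < M := (hR0 0).trans_le (hM 0)
  have hlin : ∀ u v, u ≤ v → M⁻¹ * (v - u) ≤ τ v - τ u := by
    intro u v huv
    have h1 : MonotoneOn (fun θ => τ θ - M⁻¹ * θ) Set.univ := by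
      refine monotoneOn_of_deriv_nonneg convex_univ (by fun_prop) (fun θ _ => ?_) (fun θ _ => ?_)
      · exact ((hτ' θ).sub ((hasDerivAt_id θ).const_mul M⁻¹)).differentiableAt.differentiableWithinAt
      · have : HasDerivAt (fun θ => τ θ - M⁻¹ * θ) ((R θ)⁻¹ - M⁻¹ * 1) θ :=
          (hτ' θ).sub ((hasDerivAt_id θ).const_mul M⁻¹)
        rw [this.deriv, mul_one, sub_nonneg]
        exact inv_anti₀ (hR0 θ) (hM θ)
    have := h1 (Set.mem_univ u) (Set.mem_univ v) huv
    simp only at this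
    linarith
  have hτ0 : τ 0 = 0 := by simp [hτ]
  have hsurj : Function.Surjective τ := by
    refine hτc.surjective ?_ ?_
    · refine tendsto_atTop_mono' atTop (f₁ := fun v => M⁻¹ * v) ?_
        (tendsto_id.const_mul_atTop (inv_pos.2 hM0))
      filter_upwards [eventually_ge_atTop 0] with v hv
      have := hlin 0 v hv
      rw [hτ0] at this
      linarith
    · refine tendsto_atBot_mono' atBot (f₁ := fun v => M⁻¹ * v) ?_
        (tendsto_id.const_mul_atBot (inv_pos.2 hM0))
      filter_upwards [eventually_le_atBot 0] with v hv
      have := hlin v 0 hv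
      rw [hτ0] at this
      linarith
  set e := hmono.orderIsoOfSurjective τ hsurj with he
  have hinv : ∀ t, τ (e.symm t) = t := fun t => hmono.orderIsoOfSurjective_self_symm_apply τ hsurj t
  have he' : ∀ t, HasDerivAt e.symm (R (e.symm t)) t := fun t => by
    have := HasDerivAt.of_local_left_inverse (f := τ) (g := e.symm) (a := t)
      e.symm.continuous.continuousAt (hτ' _) (inv_ne_zero (hR0 _).ne')
      (Eventually.of_forall hinv)
    simpa using this
  have hx : ∀ t, HasDerivAt (X₀ ∘ e.symm) (Y₀ (e.symm t)) t := fun t => by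
    refine ((hX' _).comp t (he' t)).congr_deriv ?_
    have := (hR0 (e.symm t)).ne'
    field_simp
  have hy : ∀ t, HasDerivAt (Y₀ ∘ e.symm) (-(derivative G).eval (X₀ (e.symm t))) t := fun t => by
    refine ((hY' _).comp t (he' t)).congr_deriv ?_
    have := (hR0 (e.symm t)).ne'
    field_simp
  have hsymm : ∀ θ, e.symm (τ θ) = θ := fun θ =>
    hmono.orderIsoOfSurjective_symm_apply_self τ hsurj θ
  have he0 : e.symm 0 = 0 := by rw [← hτ0, hsymm, hτ0]
  refine ⟨X₀ ∘ e.symm, ⟨Y₀ ∘ e.symm, continuous_iff_continuousAt.2 fun t => (hy t).continuousAt⟩,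
    τ Real.pi, ?_, hx, hy, ?_, ?_, ?_, ?_, ?_⟩
  · rw [← hτ0]
    exact hmono Real.pi_pos
  · simp [he0, hX₀, hA]
    ring
  · simp [he0, hY₀]
  · simp [hsymm, hX₀, hA]
    ring
  · simp [hsymm, hY₀]
  · intro t ht
    have h1 : 0 < e.symm t := by
      rw [← he0]
      exact e.symm.strictMono ht.1
    have h2 : e.symm t < Real.pi := by
      rw [← hsymm Real.pi]
      exact e.symm.strictMono ht.2
    simp only [ContinuousMap.coe_mk, Function.comp, hY₀]
    exact mul_pos (mul_pos hA0 (Real.sin_pos_of_pos_of_lt_pi h1 h2)) (hR0 _)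

end IsOval

namespace CI

theorem eventually_primitive_pos {W₀ : CI} (h0 : 0 < W₀ 0) (h1 : W₀ 1 < 0)
    (hpos : ∀ t : Set.Icc (0 : ℝ) 1, (t : ℝ) ∈ Set.Ioo (0 : ℝ) 1 → 0 < primitive W₀ t) :
    ∀ᶠ W in 𝓝 W₀, primitive W 1 = 0 →
      ∀ t : Set.Icc (0 : ℝ) 1, (t : ℝ) ∈ Set.Ioo (0 : ℝ) 1 → 0 < primitive W t := by
  have e0 : ext W₀ 0 = W₀ 0 := ext_coe W₀ 0
  have e1 : ext W₀ 1 = W₀ 1 := ext_coe W₀ 1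
  obtain ⟨δ₀, hδ₀, hd0⟩ := Metric.eventually_nhds_iff.1
    ((continuous_ext W₀).continuousAt.eventually (lt_mem_nhds (b := ext W₀ 0) (a := W₀ 0 / 2)
      (by rw [e0]; linarith)))
  obtain ⟨δ₁, hδ₁, hd1⟩ := Metric.eventually_nhds_iff.1
    ((continuous_ext W₀).continuousAt.eventually (gt_mem_nhds
      (show ext W₀ 1 < W₀ 1 / 2 by rw [e1]; linarith)))
  set δ := min (min δ₀ δ₁) (1 / 2) / 2 with hδ
  have hδpos : 0 < δ := by positivity
  have hδ0 : δ < δ₀ := by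
    have : min (min δ₀ δ₁) (1 / 2) ≤ δ₀ := (min_le_left _ _).trans (min_le_left _ _)
    simp only [hδ]; linarith
  have hδ1 : δ < δ₁ := by
    have : min (min δ₀ δ₁) (1 / 2) ≤ δ₁ := (min_le_left _ _).trans (min_le_right _ _)
    simp only [hδ]; linarith
  have hδ2 : δ ≤ 1 / 4 := by
    have : min (min δ₀ δ₁) (1 / 2 : ℝ) ≤ 1 / 2 := min_le_right _ _
    simp only [hδ]; linarith
  obtain ⟨c, hc, hcm⟩ : ∃ c > 0, ∀ t : Set.Icc (0 : ℝ) 1, (t : ℝ) ∈ Set.Icc δ (1 - δ) →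
      c ≤ primitive W₀ t := by
    have hK : IsCompact {t : Set.Icc (0 : ℝ) 1 | (t : ℝ) ∈ Set.Icc δ (1 - δ)} :=
      (isClosed_Icc.preimage continuous_subtype_val).isCompact
    have hne : {t : Set.Icc (0 : ℝ) 1 | (t : ℝ) ∈ Set.Icc δ (1 - δ)}.Nonempty :=
      ⟨⟨1 / 2, by norm_num, by norm_num⟩, by constructor <;> simp <;> linarith⟩
    obtain ⟨t, ht, hmin⟩ := hK.exists_isMinOn hne (primitive W₀).continuous.continuousOn
    exact ⟨_, hpos t ⟨by linarith [ht.1], by linarith [ht.2]⟩, fun u hu => hmin hu⟩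
  set η := min c (min (W₀ 0 / 2) (-(W₀ 1 / 2))) with hη
  have hηpos : 0 < η := lt_min hc (lt_min (by linarith) (by linarith))
  have hηc : η ≤ c := min_le_left _ _
  have hη0 : η ≤ W₀ 0 / 2 := (min_le_right _ _).trans (min_le_left _ _)
  have hη1 : η ≤ -(W₀ 1 / 2) := (min_le_right _ _).trans (min_le_right _ _)
  filter_upwards [Metric.ball_mem_nhds W₀ hηpos] with W hW hW1 t ht
  rw [Metric.mem_ball, dist_eq_norm] at hW
  have hclose : ∀ r, |ext W r - ext W₀ r| < η := fun r =>
    (abs_ext_le (W - W₀) r).trans_lt hW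
  have hi : ∀ u v, IntervalIntegrable (ext W) MeasureTheory.volume u v := fun u v =>
    (continuous_ext W).intervalIntegrable _ _
  rcases le_or_gt (t : ℝ) δ with h | h
  · rw [primitive_apply]
    refine intervalIntegral.intervalIntegral_pos_of_pos_on (hi _ _) (fun r hr => ?_) ht.1
    have h3 : W₀ 0 / 2 < ext W₀ r := hd0 (by
      rw [Real.dist_eq, sub_zero, abs_of_pos hr.1]; linarith [hr.2])
    have := abs_lt.1 (hclose r)
    linarith
  rcases le_or_gt (1 - δ) (t : ℝ) with h' | h'
  · have h4 : 0 < ∫ r in (t : ℝ)..1, -ext W r := by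
      refine intervalIntegral.intervalIntegral_pos_of_pos_on (hi _ _).neg (fun r hr => ?_) ht.2
      have h3 : ext W₀ r < W₀ 1 / 2 := hd1 (by
        rw [Real.dist_eq, abs_of_neg (by linarith [hr.2])]; linarith [hr.1])
      have := abs_lt.1 (hclose r)
      linarith
    have h5 := intervalIntegral.integral_add_adjacent_intervals (hi 0 t) (hi t 1)
    have h6 : primitive W 1 = ∫ s in (0 : ℝ)..1, ext W s := primitive_apply W 1
    rw [intervalIntegral.integral_neg] at h4
    rw [primitive_apply]
    linarith
  · have h3 := hcm t ⟨h.le, h'.le⟩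
    have h4 : |primitive (W - W₀) t| < η :=
      ((primitive (W - W₀)).norm_coe_le_norm t).trans_lt ((norm_primitive_le _).trans_lt hW)
    rw [map_sub, ContinuousMap.sub_apply] at h4
    have := abs_lt.1 h4
    linarith

end CI

/-- `(x, y)` is an arc of trajectory of the Liénard system in the upper half plane, leading from
`(s, 0)` to `(r, 0)` in time `T`. -/
structure IsArc (f g : ℝ[X]) (ε s r T : ℝ) (x y : ℝ → ℝ) : Prop where
  pos : 0 < T
  x_zero : x 0 = s
  y_zero : y 0 = 0
  x_end : x T = r
  y_end : y T = 0
  hasDerivAt_x : ∀ t ∈ Set.Icc 0 T, HasDerivAt x (y t) t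
  hasDerivAt_y : ∀ t ∈ Set.Icc 0 T, HasDerivAt y (-g.eval (x t) - ε * f.eval (x t) * y t) t
  y_pos : ∀ t ∈ Set.Ioo 0 T, 0 < y t

namespace CI

theorem hasDerivAt_integral_ext (v : CI) (t : ℝ) :
    HasDerivAt (fun t => ∫ r in (0 : ℝ)..t, ext v r) (ext v t) t :=
  ((continuous_ext v).integral_hasStrictDerivAt 0 t).hasDerivAt

/-- Energy balance and, in the conservative case, the work integral along an arc. -/
theorem arc_of_defect {f G : ℝ[X]} {ε s T : ℝ} {Y : CI} (hT : 0 < T)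
    (h : defect f (derivative G) ((ε, s, T), Y) = 0) (hY1 : Y 1 = 0)
    (hpos : ∀ t : Set.Icc (0 : ℝ) 1, (t : ℝ) ∈ Set.Ioo (0 : ℝ) 1 → 0 < Y t) :
    (∃ x y, IsArc f (derivative G) ε s (position s T Y 1) T x y) ∧
    G.eval (position s T Y 1) =
      G.eval s - ε * (T * primitive (aeval (position s T Y) f * Y ^ 2) 1) ∧
    (ε = 0 → s < position s T Y 1 ∧
      (∀ x ∈ Set.Ioo s (position s T Y 1), G.eval x < G.eval s) ∧
      T * primitive (aeval (position s T Y) f * Y ^ 2) 1 =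
        ∫ x in s..position s T Y 1, f.eval x * √(2 * (G.eval s - G.eval x))) := by
  set P : CI := position s T Y with hP
  set W : CI := -(T • (aeval P (derivative G) + ε • (aeval P f * Y))) with hW
  have hYW : Y = primitive W := by
    have : Y + T • primitive (aeval P (derivative G) + ε • (aeval P f * Y)) = 0 := h
    rw [hW, map_neg, map_smul]
    exact eq_neg_of_add_eq_zero_left this
  set x : ℝ → ℝ := fun t => s + T * ∫ r in (0 : ℝ)..t, ext Y r with hx
  set y : ℝ → ℝ := fun t => ∫ r in (0 : ℝ)..t, ext W r with hy
  have hyY : ∀ t (ht : t ∈ Set.Icc (0 : ℝ) 1), y t = Y ⟨t, ht⟩ := fun t ht => by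
    rw [hYW, primitive_apply]
  have hxP : ∀ t (ht : t ∈ Set.Icc (0 : ℝ) 1), x t = P ⟨t, ht⟩ := fun t ht => by
    rw [hP, position_apply]
  have hx' : ∀ t ∈ Set.Icc (0 : ℝ) 1, HasDerivAt x (T * y t) t := fun t ht => by
    have := ((hasDerivAt_integral_ext Y t).const_mul T).const_add s
    rwa [ext_of_mem Y ht, ← hyY] at this
  have hy' : ∀ t ∈ Set.Icc (0 : ℝ) 1,
      HasDerivAt y (T * (-(derivative G).eval (x t) - ε * f.eval (x t) * y t)) t := fun t ht => by
    have := hasDerivAt_integral_ext W t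
    rw [ext_of_mem W ht] at this
    refine this.congr_deriv ?_
    rw [hyY t ht, hxP t ht]
    simp only [hW, ContinuousMap.neg_apply, ContinuousMap.smul_apply, ContinuousMap.add_apply,
      ContinuousMap.mul_apply, aeval_apply', smul_eq_mul]
    ring
  have hxc : Continuous x := by
    refine continuous_const.add (continuous_const.mul (continuous_iff_continuousAt.2 fun t => ?_))
    exact (hasDerivAt_integral_ext Y t).continuousAt
  have hyc : Continuous y := continuous_iff_continuousAt.2 fun t =>
    (hasDerivAt_integral_ext W t).continuousAt
  have h01 : (0 : ℝ) ∈ Set.Icc (0 : ℝ) 1 := by simp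
  have h11 : (1 : ℝ) ∈ Set.Icc (0 : ℝ) 1 := by simp
  have hx0 : x 0 = s := by simp [hx]
  have hy0 : y 0 = 0 := by simp [hy]
  have hx1 : x 1 = P 1 := hxP 1 h11
  have hy1 : y 1 = 0 := (hyY 1 h11).trans hY1
  have hypos : ∀ t ∈ Set.Ioo (0 : ℝ) 1, 0 < y t := fun t ht => by
    rw [hyY t ⟨ht.1.le, ht.2.le⟩]
    exact hpos _ ht
  have hE : primitive (aeval P f * Y ^ 2) 1 = ∫ r in (0 : ℝ)..1, f.eval (x r) * y r ^ 2 := by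
    rw [primitive_apply]
    refine intervalIntegral.integral_congr fun r hr => ?_
    replace hr : r ∈ Set.Icc (0 : ℝ) 1 := by simpa using hr
    rw [ext_of_mem _ hr, hxP r hr, hyY r hr]
    simp
  have henergy : ∀ t ∈ Set.Icc (0 : ℝ) 1, y t ^ 2 / 2 + G.eval (x t) =
      G.eval s - ε * (T * ∫ r in (0 : ℝ)..t, f.eval (x r) * y r ^ 2) := by
    intro t ht
    have h1 : ∫ r in (0 : ℝ)..t, -(ε * T) * (f.eval (x r) * y r ^ 2) =
        (y t ^ 2 / 2 + G.eval (x t)) - (y 0 ^ 2 / 2 + G.eval (x 0)) := by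
      refine intervalIntegral.integral_eq_sub_of_hasDerivAt
        (f := fun r => y r ^ 2 / 2 + G.eval (x r)) (fun r hr => ?_)
        (Continuous.intervalIntegrable (by fun_prop) _ _)
      rw [Set.uIcc_of_le ht.1] at hr
      have hr' : r ∈ Set.Icc (0 : ℝ) 1 := ⟨hr.1, hr.2.trans ht.2⟩
      refine ((((hy' r hr').pow 2).div_const 2).add
        ((G.hasDerivAt (x r)).comp r (hx' r hr'))).congr_deriv ?_
      simp
      ring
    rw [intervalIntegral.integral_const_mul, hx0, hy0] at h1
    linarith
  refine ⟨⟨fun t => x (t / T), fun t => y (t / T), ?_⟩, ?_, ?_⟩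
  · have hdiv : ∀ t ∈ Set.Icc 0 T, t / T ∈ Set.Icc (0 : ℝ) 1 := fun t ht =>
      ⟨div_nonneg ht.1 hT.le, (div_le_one hT).2 ht.2⟩
    refine ⟨hT, by simp [hx0], by simp [hy0], by simp [hT.ne', hx1], by simp [hT.ne', hy1],
      fun t ht => ?_, fun t ht => ?_, fun t ht => ?_⟩
    · refine ((hx' _ (hdiv t ht)).comp t ((hasDerivAt_id t).div_const T)).congr_deriv ?_
      field_simp
    · refine ((hy' _ (hdiv t ht)).comp t ((hasDerivAt_id t).div_const T)).congr_deriv ?_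
      field_simp
    · exact hypos _ ⟨div_pos ht.1 hT, (div_lt_one hT).2 ht.2⟩
  · have := henergy 1 h11
    rw [hy1, hx1] at this
    rw [hE]
    linarith
  · intro hε
    have hen : ∀ t ∈ Set.Icc (0 : ℝ) 1, y t ^ 2 = 2 * (G.eval s - G.eval (x t)) := fun t ht => by
      have := henergy t ht
      rw [hε] at this
      linarith
    refine ⟨?_, fun z hz => ?_, ?_⟩
    · have : 0 < ∫ r in (0 : ℝ)..1, ext Y r := by
        refine intervalIntegral.intervalIntegral_pos_of_pos_on
          ((continuous_ext Y).intervalIntegrable _ _) (fun r hr => ?_) one_pos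
        rw [ext_of_mem Y ⟨hr.1.le, hr.2.le⟩]
        exact hpos _ hr
      rw [← hx1]
      simp only [hx]
      have := mul_pos hT this
      linarith
    · rw [← hx1] at hz
      rw [← hx0] at hz
      obtain ⟨t, ht, rfl⟩ := intermediate_value_Ioo zero_le_one hxc.continuousOn hz
      have h1 := hypos t ht
      have h2 := hen t ⟨ht.1.le, ht.2.le⟩
      have : 0 < y t ^ 2 := by positivity
      linarith
    · have h1 := intervalIntegral.integral_comp_mul_deriv (a := 0) (b := 1) (f := x)
        (f' := fun t => T * y t) (g := fun z => f.eval z * √(2 * (G.eval s - G.eval z)))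
        (fun t ht => hx' t (by simpa using ht)) (by fun_prop) (by fun_prop)
      rw [hx0, hx1] at h1
      rw [← h1, hE, ← intervalIntegral.integral_const_mul]
      refine intervalIntegral.integral_congr fun t ht => ?_
      replace ht : t ∈ Set.Icc (0 : ℝ) 1 := by simpa using ht
      have hy0 : 0 ≤ y t := by
        rcases eq_or_lt_of_le ht.1 with rfl | h0
        · exact hy0.ge
        rcases eq_or_lt_of_le ht.2 with rfl | h1
        · exact hy1.ge
        exact (hypos t ⟨h0, h1⟩).le
      simp only [Function.comp]
      rw [← hen t ht, Real.sqrt_sq hy0]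
      ring

end CI

/-- The first return map `ρ` of the Liénard system to the axis near a well of the potential and
the dissipated energy `E` are analytic in `(ε, s)`. -/
theorem IsOval.exists_return_map {G : ℝ[X]} {a b : ℝ} (h : IsOval G a b) (f : ℝ[X]) :
    ∃ ρ E : ℝ × ℝ → ℝ, ContDiffAt ℝ ω ρ (0, a) ∧ ContDiffAt ℝ ω E (0, a) ∧ ρ (0, a) = b ∧
      ∀ᶠ q in 𝓝 ((0 : ℝ), a), (∃ T x y, IsArc f (derivative G) q.1 q.2 (ρ q) T x y) ∧
        G.eval (ρ q) = G.eval q.2 - q.1 * E q ∧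
        (q.1 = 0 → IsOval G q.2 (ρ q) ∧
          E q = ∫ x in q.2..ρ q, f.eval x * √(2 * (G.eval q.2 - G.eval x))) := by
  obtain ⟨x, y, T₀, hT₀, hx, hy, hx0, hy0, hxT, hyT, hypos⟩ := h.exists_solution
  obtain ⟨T, Y, hTc, hYc, hTa, hYa, hev⟩ := CI.exists_arc_family f hx hy hx0 hy0 hyT
    (by rw [hxT]; exact h.right.ne')
  set P : ℝ × ℝ → CI := fun q => CI.position q.2 (T q) (Y q) with hP
  have hPc : ContDiffAt ℝ ω P (0, a) := ContDiffAt.comp (0, a)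
    (f := fun q : ℝ × ℝ => ((q.2, T q), Y q)) CI.contDiff_position.contDiffAt
    ((contDiffAt_snd.prodMk hTc).prodMk hYc)
  have heval : ∀ Z : ℝ × ℝ → CI, ContDiffAt ℝ ω Z (0, a) →
      ContDiffAt ℝ ω (fun q => Z q 1) (0, a) := fun Z hZ =>
    (ContinuousMap.evalCLM ℝ (1 : Set.Icc (0 : ℝ) 1) : CI →L[ℝ] ℝ).contDiff.contDiffAt.comp _ hZ
  have hfc : ContDiffAt ℝ ω (fun q => aeval (P q) f) (0, a) :=
    (CI.contDiff_aeval_algebra f).contDiffAt.comp _ hPc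
  have hgc : ContDiffAt ℝ ω (fun q => aeval (P q) (derivative G)) (0, a) :=
    (CI.contDiff_aeval_algebra (derivative G)).contDiffAt.comp _ hPc
  set W : ℝ × ℝ → CI := fun q =>
    -(T q • (aeval (P q) (derivative G) + q.1 • (aeval (P q) f * Y q))) with hW
  have hWc : ContDiffAt ℝ ω W (0, a) :=
    (hTc.smul (hgc.add (contDiffAt_fst.smul (hfc.mul hYc)))).neg
  have hρc := heval P hPc
  have hPt : ∀ t : Set.Icc (0 : ℝ) 1, P (0, a) t = x (T₀ * t) := fun t => by
    simp only [hP, hTa, hYa]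
    rw [← hx0]
    exact CI.position_rescale hx T₀ t
  have hρ0 : P (0, a) 1 = b := by
    rw [hPt, ← hxT]
    simp
  have hYW : ∀ q, CI.defect f (derivative G) ((q.1, q.2, T q), Y q) = 0 →
      Y q = CI.primitive (W q) := fun q hq => by
    have : Y q + T q • CI.primitive (aeval (P q) (derivative G) + q.1 • (aeval (P q) f * Y q)) = 0 :=
      hq
    rw [hW, map_neg, map_smul]
    exact eq_neg_of_add_eq_zero_left this
  have hW0 : ∀ t : Set.Icc (0 : ℝ) 1, W (0, a) t = -(T₀ * (derivative G).eval (x (T₀ * t))) :=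
    fun t => by simp [hW, hTa, hPt]
  have hposev : ∀ᶠ q in 𝓝 ((0 : ℝ), a), CI.primitive (W q) 1 = 0 →
      ∀ t : Set.Icc (0 : ℝ) 1, (t : ℝ) ∈ Set.Ioo (0 : ℝ) 1 → 0 < CI.primitive (W q) t := by
    refine hWc.continuousAt.eventually (CI.eventually_primitive_pos ?_ ?_ ?_)
    · rw [hW0]
      have := mul_neg_of_pos_of_neg hT₀ h.left
      simpa [hx0] using this
    · rw [hW0]
      have := mul_pos hT₀ h.right
      simpa [hxT] using this
    · intro t ht
      rw [← hYW _ hev.self_of_nhds.1, hYa]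
      exact hypos _ ⟨mul_pos hT₀ ht.1, mul_lt_of_lt_one_right hT₀ ht.2⟩
  have hleft : ∀ᶠ q in 𝓝 ((0 : ℝ), a), (derivative G).eval q.2 < 0 :=
    ((derivative G).continuous.comp continuous_snd).continuousAt.eventually (gt_mem_nhds h.left)
  have hright : ∀ᶠ q in 𝓝 ((0 : ℝ), a), 0 < (derivative G).eval (P q 1) := by
    have h1 : ContinuousAt (fun q => (derivative G).eval (P q 1)) (0, a) :=
      (derivative G).continuous.continuousAt.comp hρc.continuousAt
    refine h1.eventually (lt_mem_nhds ?_)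
    simp only [hρ0]
    exact h.right
  have hTpos : ∀ᶠ q in 𝓝 ((0 : ℝ), a), 0 < T q :=
    hTc.continuousAt.eventually (lt_mem_nhds (by rw [hTa]; exact hT₀))
  refine ⟨fun q => P q 1, fun q => T q * CI.primitive (aeval (P q) f * Y q ^ 2) 1, hρc, ?_, hρ0, ?_⟩
  · refine hTc.mul (heval _ ?_)
    exact CI.primitive.contDiff.contDiffAt.comp _ (hfc.mul (hYc.pow 2))
  · filter_upwards [hev, hposev, hleft, hright, hTpos] with q h1 h2 h3 h4 h5
    have h6 := hYW q h1.1
    rw [← h6] at h2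
    obtain ⟨⟨x, y, h7⟩, h8, h9⟩ := CI.arc_of_defect h5 h1.1 h1.2 (h2 h1.2)
    refine ⟨⟨_, x, y, h7⟩, h8, fun h10 => ?_⟩
    obtain ⟨h11, h12, h13⟩ := h9 h10
    refine ⟨⟨h11, ?_, h12, h3, h4⟩, h13⟩
    rw [h8, h10]
    ring

section ODE

variable {E : Type*} [NormedAddCommGroup E] [NormedSpace ℝ E]

theorem ODE_eqOn_Icc {V : E → E} (hV : ContDiff ℝ 1 V) {α β : ℝ → E} {a b t₀ : ℝ}
    (hα : ∀ t ∈ Set.Icc a b, HasDerivWithinAt α (V (α t)) (Set.Icc a b) t)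
    (hβ : ∀ t ∈ Set.Icc a b, HasDerivWithinAt β (V (β t)) (Set.Icc a b) t)
    (ht₀ : t₀ ∈ Set.Icc a b) (h : α t₀ = β t₀) : Set.EqOn α β (Set.Icc a b) := by
  have hαc : ContinuousOn α (Set.Icc a b) := fun t ht => (hα t ht).continuousWithinAt
  have hβc : ContinuousOn β (Set.Icc a b) := fun t ht => (hβ t ht).continuousWithinAt
  obtain ⟨K, hK⟩ := (hV.locallyLipschitz.locallyLipschitzOn
    (s := α '' Set.Icc a b ∪ β '' Set.Icc a b)).exists_lipschitzOnWith_of_compact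
    ((isCompact_Icc.image_of_continuousOn hαc).union (isCompact_Icc.image_of_continuousOn hβc))
  have hL : Set.Icc a t₀ ⊆ Set.Icc a b := Set.Icc_subset_Icc_right ht₀.2
  have hR : Set.Icc t₀ b ⊆ Set.Icc a b := Set.Icc_subset_Icc_left ht₀.1
  have hmem : ∀ γ : ℝ → E, (∀ t ∈ Set.Icc a b, HasDerivWithinAt γ (V (γ t)) (Set.Icc a b) t) →
      (∀ t ∈ Set.Ioc a t₀, HasDerivWithinAt γ (V (γ t)) (Set.Iic t) t) ∧
      ∀ t ∈ Set.Ico t₀ b, HasDerivWithinAt γ (V (γ t)) (Set.Ici t) t := by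
    refine fun γ hγ => ⟨fun t ht => ?_, fun t ht => ?_⟩
    · refine (hγ t (hL ⟨ht.1.le, ht.2⟩)).mono_of_mem_nhdsWithin (Icc_mem_nhdsLE_of_mem ?_)
      exact ⟨ht.1, ht.2.trans ht₀.2⟩
    · refine (hγ t (hR ⟨ht.1, ht.2.le⟩)).mono_of_mem_nhdsWithin (Icc_mem_nhdsGE_of_mem ?_)
      exact ⟨ht₀.1.trans ht.1, ht.2⟩
  rw [← Set.Icc_union_Icc_eq_Icc ht₀.1 ht₀.2]
  refine Set.EqOn.union ?_ ?_
  · exact ODE_solution_unique_of_mem_Icc_left (v := fun _ => V)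
      (s := fun _ => α '' Set.Icc a b ∪ β '' Set.Icc a b) (fun _ _ => hK) (hαc.mono hL)
      (hmem α hα).1 (fun t ht => Or.inl ⟨t, hL ⟨ht.1.le, ht.2⟩, rfl⟩) (hβc.mono hL)
      (hmem β hβ).1 (fun t ht => Or.inr ⟨t, hL ⟨ht.1.le, ht.2⟩, rfl⟩) h
  · exact ODE_solution_unique_of_mem_Icc_right (v := fun _ => V)
      (s := fun _ => α '' Set.Icc a b ∪ β '' Set.Icc a b) (fun _ _ => hK) (hαc.mono hR)
      (hmem α hα).2 (fun t ht => Or.inl ⟨t, hR ⟨ht.1, ht.2.le⟩, rfl⟩) (hβc.mono hR)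
      (hmem β hβ).2 (fun t ht => Or.inr ⟨t, hR ⟨ht.1, ht.2.le⟩, rfl⟩) h

/-- A solution on `[0, τ]` that closes up extends to a periodic solution. -/
theorem exists_periodic_extension {V : E → E} {α : ℝ → E} {τ : ℝ} (hτ : 0 < τ)
    (hα : ∀ t ∈ Set.Icc 0 τ, HasDerivWithinAt α (V (α t)) (Set.Icc 0 τ) t) (h : α 0 = α τ) :
    ∃ γ : ℝ → E, (∀ t, HasDerivAt γ (V (γ t)) t) ∧ Function.Periodic γ τ ∧
      Set.EqOn γ α (Set.Icc 0 τ) ∧ Set.range γ = α '' Set.Icc 0 τ := by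
  set γ : ℝ → E := fun t => α (toIcoMod hτ 0 t) with hγ
  have hper : Function.Periodic γ τ := fun t => by simp [hγ]
  have heq : Set.EqOn γ α (Set.Icc 0 τ) := by
    intro t ht
    rcases eq_or_lt_of_le ht.2 with rfl | h'
    · have := toIcoMod_apply_right hτ 0
      rw [zero_add] at this
      simp only [hγ, this, h]
    · simp only [hγ]
      rw [(toIcoMod_eq_self hτ).2 (by simpa using ⟨ht.1, h'⟩)]
  have hmain : ∀ t ∈ Set.Ico 0 τ, HasDerivAt γ (V (γ t)) t := by
    intro t ht
    have h1 : HasDerivWithinAt γ (V (γ t)) (Set.Icc 0 τ) t := by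
      rw [heq ⟨ht.1, ht.2.le⟩]
      exact (hα t ⟨ht.1, ht.2.le⟩).congr heq (heq ⟨ht.1, ht.2.le⟩)
    rcases eq_or_lt_of_le ht.1 with rfl | h0
    · have h2 : HasDerivWithinAt γ (V (γ 0)) (Set.Ici 0) 0 :=
        h1.mono_of_mem_nhdsWithin (Icc_mem_nhdsGE_of_mem ⟨le_rfl, hτ⟩)
      have h3 : HasDerivWithinAt γ (V (γ τ)) (Set.Iic τ) τ := by
        have h4 := hα τ ⟨hτ.le, le_rfl⟩
        rw [heq ⟨hτ.le, le_rfl⟩]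
        exact (h4.congr heq (heq ⟨hτ.le, le_rfl⟩)).mono_of_mem_nhdsWithin
          (Icc_mem_nhdsLE_of_mem ⟨hτ, le_rfl⟩)
      have h5 : HasDerivWithinAt γ (V (γ 0)) (Set.Iic 0) 0 := by
        have h6 : HasDerivWithinAt (fun t => γ (t + τ)) ((1 : ℝ) • V (γ τ)) (Set.Iic 0) 0 := by
          refine HasDerivWithinAt.scomp (g₁ := γ) (h := fun t => t + τ) (t' := Set.Iic τ) 0
              (by rw [zero_add]; exact h3)
            ((hasDerivAt_id _).add_const τ).hasDerivWithinAt (fun r hr => ?_)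
          simpa using hr
        have h7 : γ τ = γ 0 := by simpa using hper 0
        rw [one_smul, h7] at h6
        exact h6.congr (fun r _ => (hper r).symm) (hper 0).symm
      rw [← hasDerivWithinAt_univ, ← Set.Iic_union_Ici (a := (0 : ℝ))]
      exact h5.union h2
    · exact h1.hasDerivAt (Icc_mem_nhds h0 ht.2)
  refine ⟨γ, fun t => ?_, hper, heq, ?_⟩
  · have h1 := hmain _ (toIcoMod_mem_Ico' hτ t)
    have h2 : toIcoMod hτ 0 t = t - toIcoDiv hτ 0 t • τ := rfl
    have h3 : ∀ r, γ (r - toIcoDiv hτ 0 t • τ) = γ r := fun r => hper.sub_zsmul_eq _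
    rw [h2, h3] at h1
    have h4 := HasDerivAt.scomp (g₁ := γ) (h := fun r => r - toIcoDiv hτ 0 t • τ) t h1
      ((hasDerivAt_id t).sub_const _)
    rw [one_smul] at h4
    exact h4.congr_of_eventuallyEq (Eventually.of_forall fun r => (h3 r).symm)
  · ext p
    constructor
    · rintro ⟨t, rfl⟩
      exact ⟨_, Set.Ico_subset_Icc_self (toIcoMod_mem_Ico' hτ t), rfl⟩
    · rintro ⟨t, ht, rfl⟩
      exact ⟨t, heq ht⟩

end ODE

theorem contDiff_lienard (f g : ℝ[X]) (ε : ℝ) : ContDiff ℝ 1 (lienard f g ε) := by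
  unfold lienard
  have hp : ∀ p : ℝ[X], ContDiff ℝ 1 fun q : ℝ × ℝ => p.eval q.1 := fun p => by
    have : ContDiff ℝ 1 fun x : ℝ => p.eval x := by
      simpa using p.contDiff_aeval (𝕜 := ℝ) 1
    exact this.comp contDiff_fst
  exact contDiff_snd.prodMk ((hp g).neg.sub ((contDiff_const.mul (hp f)).mul contDiff_snd))

namespace IsPeriodicOrbit

variable {V : ℝ × ℝ → ℝ × ℝ} {Γ Γ' : Set (ℝ × ℝ)}

theorem mem_of_trajectory (hV : ContDiff ℝ 1 V) (h : IsPeriodicOrbit V Γ) {α : ℝ → ℝ × ℝ}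
    {a b t₀ : ℝ} (hα : ∀ t ∈ Set.Icc a b, HasDerivWithinAt α (V (α t)) (Set.Icc a b) t)
    (ht₀ : t₀ ∈ Set.Icc a b) (hmem : α t₀ ∈ Γ) {t : ℝ} (ht : t ∈ Set.Icc a b) : α t ∈ Γ := by
  obtain ⟨γ, hγ, -, -, rfl⟩ := h
  obtain ⟨r, hr⟩ := hmem
  have h1 : ∀ t, HasDerivAt (fun t => γ (t + (r - t₀))) (V (γ (t + (r - t₀)))) t := fun t =>
    HasDerivAt.comp_add_const t (r - t₀) (hγ _)
  have h2 := ODE_eqOn_Icc hV hα (fun t _ => (h1 t).hasDerivWithinAt) ht₀ (by simp [hr])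
  exact ⟨_, (h2 ht).symm⟩

theorem eq_of_mem (hV : ContDiff ℝ 1 V) (h : IsPeriodicOrbit V Γ) (h' : IsPeriodicOrbit V Γ')
    {p : ℝ × ℝ} (hp : p ∈ Γ) (hp' : p ∈ Γ') : Γ = Γ' := by
  have key : ∀ Δ Δ', IsPeriodicOrbit V Δ → IsPeriodicOrbit V Δ' → p ∈ Δ → p ∈ Δ' → Δ ⊆ Δ' := by
    intro Δ Δ' hΔ hΔ' hpΔ hpΔ' q hq
    obtain ⟨γ, hγ, -, -, rfl⟩ := hΔ
    obtain ⟨t, rfl⟩ := hq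
    obtain ⟨r, rfl⟩ := hpΔ
    exact mem_of_trajectory hV hΔ' (a := min t r) (b := max t r)
      (fun t _ => (hγ t).hasDerivWithinAt) ⟨min_le_right _ _, le_max_right _ _⟩ hpΔ'
      ⟨min_le_left _ _, le_max_left _ _⟩
  exact (key _ _ h h' hp hp').antisymm (key _ _ h' h hp' hp)

theorem isCompact (h : IsPeriodicOrbit V Γ) : IsCompact Γ := by
  obtain ⟨γ, hγ, ⟨T, hT, hper⟩, -, rfl⟩ := h
  have hc : Continuous γ := continuous_iff_continuousAt.2 fun t => (hγ t).continuousAt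
  have := hper.image_Icc hT 0
  rw [← this]
  exact isCompact_Icc.image hc

theorem nonempty (h : IsPeriodicOrbit V Γ) : Γ.Nonempty := by
  obtain ⟨γ, -, -, -, rfl⟩ := h
  exact Set.range_nonempty γ

theorem exists_min {f g : ℝ[X]} {ε : ℝ} (h : IsPeriodicOrbit (lienard f g ε) Γ) :
    ∃ s, (s, (0 : ℝ)) ∈ Γ ∧ ∀ p ∈ Γ, s ≤ p.1 := by
  obtain ⟨p, hp, hmin⟩ := h.isCompact.exists_isMinOn h.nonempty continuous_fst.continuousOn
  obtain ⟨γ, hγ, -, -, rfl⟩ := h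
  obtain ⟨t, rfl⟩ := hp
  have h1 : HasDerivAt (fun t => (γ t).1) (γ t).2 t := (hγ t).fst
  have h2 : IsLocalMin (fun t => (γ t).1) t := Eventually.of_forall fun r => hmin ⟨r, rfl⟩
  have h3 := h2.hasDerivAt_eq_zero h1
  exact ⟨(γ t).1, ⟨t, by ext <;> simp [h3]⟩, fun q hq => hmin hq⟩

theorem exists_max {f g : ℝ[X]} {ε : ℝ} (h : IsPeriodicOrbit (lienard f g ε) Γ) :
    ∃ s, (s, (0 : ℝ)) ∈ Γ ∧ ∀ p ∈ Γ, p.1 ≤ s := by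
  obtain ⟨p, hp, hmax⟩ := h.isCompact.exists_isMaxOn h.nonempty continuous_fst.continuousOn
  obtain ⟨γ, hγ, -, -, rfl⟩ := h
  obtain ⟨t, rfl⟩ := hp
  have h1 : HasDerivAt (fun t => (γ t).1) (γ t).2 t := (hγ t).fst
  have h2 : IsLocalMax (fun t => (γ t).1) t := Eventually.of_forall fun r => hmax ⟨r, rfl⟩
  have h3 := h2.hasDerivAt_eq_zero h1
  exact ⟨(γ t).1, ⟨t, by ext <;> simp [h3]⟩, fun q hq => hmax hq⟩

end IsPeriodicOrbit

namespace IsArc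

variable {f g : ℝ[X]} {ε s r T T' : ℝ} {x y x' y' : ℝ → ℝ} {Γ : Set (ℝ × ℝ)}

theorem hasDerivAt (h : IsArc f g ε s r T x y) {t : ℝ} (ht : t ∈ Set.Icc 0 T) :
    HasDerivAt (fun t => (x t, y t)) (lienard f g ε (x t, y t)) t :=
  (h.hasDerivAt_x t ht).prodMk (h.hasDerivAt_y t ht)

theorem hasDerivAt_reflect (h : IsArc f g (-ε) s r T x y) {c t : ℝ} (ht : c - t ∈ Set.Icc 0 T) :
    HasDerivAt (fun t => (x (c - t), -y (c - t))) (lienard f g ε (x (c - t), -y (c - t))) t := by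
  have hc : HasDerivAt (fun t : ℝ => c - t) (-1) t := by
    simpa using (hasDerivAt_id t).const_sub c
  have h1 := (h.hasDerivAt_x _ ht).comp t hc
  have h2 := ((h.hasDerivAt_y _ ht).comp t hc).neg
  refine (h1.prodMk h2).congr_deriv ?_
  simp only [lienard, Prod.mk.injEq]
  constructor <;> ring

theorem mem_upper (h : IsArc f g ε s r T x y) (hΓ : IsPeriodicOrbit (lienard f g ε) Γ) {t₀ t : ℝ}
    (ht₀ : t₀ ∈ Set.Icc 0 T) (ht : t ∈ Set.Icc 0 T) (hmem : (x t₀, y t₀) ∈ Γ) : (x t, y t) ∈ Γ :=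
  hΓ.mem_of_trajectory (contDiff_lienard f g ε) (α := fun t => (x t, y t))
    (fun _ hu => (h.hasDerivAt hu).hasDerivWithinAt) ht₀ hmem ht

theorem mem_lower (h : IsArc f g (-ε) s r T x y) (hΓ : IsPeriodicOrbit (lienard f g ε) Γ)
    {t₀ t : ℝ} (ht₀ : t₀ ∈ Set.Icc 0 T) (ht : t ∈ Set.Icc 0 T) (hmem : (x t₀, -y t₀) ∈ Γ) :
    (x t, -y t) ∈ Γ := by
  have hT : ∀ u ∈ Set.Icc 0 T, T - u ∈ Set.Icc 0 T := fun u hu =>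
    ⟨by linarith [hu.2], by linarith [hu.1]⟩
  have := hΓ.mem_of_trajectory (contDiff_lienard f g ε) (α := fun t => (x (T - t), -y (T - t)))
    (fun _ hu => (h.hasDerivAt_reflect (hT _ hu)).hasDerivWithinAt) (hT _ ht₀) (by simpa using hmem)
    (hT _ ht)
  simpa using this

theorem end_mem_upper (h : IsArc f g ε s r T x y) (hΓ : IsPeriodicOrbit (lienard f g ε) Γ) :
    (s, (0 : ℝ)) ∈ Γ ↔ (r, (0 : ℝ)) ∈ Γ := by
  have h0 : (0 : ℝ) ∈ Set.Icc 0 T := ⟨le_rfl, h.pos.le⟩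
  have hT : T ∈ Set.Icc 0 T := ⟨h.pos.le, le_rfl⟩
  constructor <;> intro hm
  · have := h.mem_upper hΓ h0 hT (by rwa [h.x_zero, h.y_zero])
    rwa [h.x_end, h.y_end] at this
  · have := h.mem_upper hΓ hT h0 (by rwa [h.x_end, h.y_end])
    rwa [h.x_zero, h.y_zero] at this

theorem end_mem_lower (h : IsArc f g (-ε) s r T x y) (hΓ : IsPeriodicOrbit (lienard f g ε) Γ) :
    (s, (0 : ℝ)) ∈ Γ ↔ (r, (0 : ℝ)) ∈ Γ := by
  have h0 : (0 : ℝ) ∈ Set.Icc 0 T := ⟨le_rfl, h.pos.le⟩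
  have hT : T ∈ Set.Icc 0 T := ⟨h.pos.le, le_rfl⟩
  constructor <;> intro hm
  · have := h.mem_lower hΓ h0 hT (by rwa [h.x_zero, h.y_zero, neg_zero])
    rwa [h.x_end, h.y_end, neg_zero] at this
  · have := h.mem_lower hΓ hT h0 (by rwa [h.x_end, h.y_end, neg_zero])
    rwa [h.x_zero, h.y_zero, neg_zero] at this

theorem y_nonneg (h : IsArc f g ε s r T x y) {t : ℝ} (ht : t ∈ Set.Icc 0 T) : 0 ≤ y t := by
  rcases eq_or_lt_of_le ht.1 with rfl | h0
  · exact h.y_zero.ge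
  rcases eq_or_lt_of_le ht.2 with rfl | h1
  · exact h.y_end.ge
  exact (h.y_pos t ⟨h0, h1⟩).le

theorem le_x (h : IsArc f g ε s r T x y) {t : ℝ} (ht : t ∈ Set.Icc 0 T) : s ≤ x t := by
  have h1 : MonotoneOn x (Set.Icc 0 T) := by
    refine monotoneOn_of_deriv_nonneg (convex_Icc 0 T)
      (fun u hu => (h.hasDerivAt_x u hu).continuousAt.continuousWithinAt)
      (fun u hu => (h.hasDerivAt_x u (interior_subset hu)).differentiableAt.differentiableWithinAt)
      (fun u hu => ?_)
    rw [(h.hasDerivAt_x u (interior_subset hu)).deriv]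
    exact h.y_nonneg (interior_subset hu)
  rw [← h.x_zero]
  exact h1 ⟨le_rfl, h.pos.le⟩ ht ht.1

theorem eq_end_of_y_eq_zero (h : IsArc f g ε s r T x y) {t : ℝ} (ht : t ∈ Set.Icc 0 T)
    (hy : y t = 0) : x t = s ∨ x t = r := by
  rcases eq_or_lt_of_le ht.1 with rfl | h0
  · exact Or.inl h.x_zero
  rcases eq_or_lt_of_le ht.2 with rfl | h1
  · exact Or.inr h.x_end
  exact absurd hy (h.y_pos t ⟨h0, h1⟩).ne'

/-- An upper arc for `ε` and one for `-ε` with the same end points form a periodic orbit. -/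
theorem exists_periodicOrbit (h : IsArc f g ε s r T x y) (h' : IsArc f g (-ε) s r T' x' y') :
    ∃ Γ, IsPeriodicOrbit (lienard f g ε) Γ ∧ (s, (0 : ℝ)) ∈ Γ ∧ (∀ p ∈ Γ, s ≤ p.1) ∧
      ∀ p ∈ Γ, p.2 = 0 → p.1 = s ∨ p.1 = r := by
  have hT := h.pos
  have hT' := h'.pos
  set c := T + T' with hc
  set u : ℝ → ℝ × ℝ := fun t => (x t, y t) with hu
  set l : ℝ → ℝ × ℝ := fun t => (x' (c - t), -y' (c - t)) with hl
  set α : ℝ → ℝ × ℝ := fun t => if t ≤ T then u t else l t with hα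
  have hmemL : ∀ t ∈ Set.Icc T c, c - t ∈ Set.Icc 0 T' := fun t ht =>
    ⟨by linarith [ht.2], by linarith [ht.1]⟩
  have hTl : u T = l T := by
    simp [hu, hl, hc, h.x_end, h.y_end, h'.x_end, h'.y_end]
  have hαu : Set.EqOn α u (Set.Icc 0 T) := fun t ht => by simp [hα, ht.2]
  have hαl : Set.EqOn α l (Set.Icc T c) := fun t ht => by
    rcases eq_or_lt_of_le ht.1 with rfl | h1
    · simp [hα, hTl]
    · simp [hα, not_le.2 h1]
  have hdl : ∀ t ∈ Set.Icc T c, HasDerivAt l (lienard f g ε (l t)) t := fun t ht =>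
    h'.hasDerivAt_reflect (hmemL t ht)
  have hunion : Set.Icc 0 T ∪ Set.Icc T c = Set.Icc 0 c :=
    Set.Icc_union_Icc_eq_Icc hT.le (by linarith)
  have hderiv : ∀ t ∈ Set.Icc 0 c,
      HasDerivWithinAt α (lienard f g ε (α t)) (Set.Icc 0 c) t := by
    intro t ht
    have hA : t ≤ T → HasDerivWithinAt α (lienard f g ε (α t)) (Set.Icc 0 T) t := fun h1 => by
      have h2 : t ∈ Set.Icc 0 T := ⟨ht.1, h1⟩
      rw [hαu h2]
      exact (h.hasDerivAt h2).hasDerivWithinAt.congr hαu (hαu h2)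
    have hB : T ≤ t → HasDerivWithinAt α (lienard f g ε (α t)) (Set.Icc T c) t := fun h1 => by
      have h2 : t ∈ Set.Icc T c := ⟨h1, ht.2⟩
      rw [hαl h2]
      exact (hdl t h2).hasDerivWithinAt.congr hαl (hαl h2)
    rw [← hunion]
    refine HasDerivWithinAt.union ?_ ?_
    · rcases le_or_gt t T with h1 | h1
      · exact hA h1
      · refine HasFDerivWithinAt.of_notMem_closure ?_
        rw [isClosed_Icc.closure_eq]
        exact fun h2 => absurd h2.2 (not_le.2 h1)
    · rcases le_or_gt T t with h1 | h1
      · exact hB h1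
      · refine HasFDerivWithinAt.of_notMem_closure ?_
        rw [isClosed_Icc.closure_eq]
        exact fun h2 => absurd h2.1 (not_le.2 h1)
  have hu0 : u 0 = (s, 0) := by simp [hu, h.x_zero, h.y_zero]
  have hclosed : α 0 = α c := by
    rw [hαu ⟨le_rfl, hT.le⟩, hαl ⟨by linarith, le_rfl⟩, hu0]
    simp [hl, h'.x_zero, h'.y_zero]
  obtain ⟨γ, h1, h2, h3, h4⟩ := exists_periodic_extension (by linarith : 0 < c) hderiv hclosed
  have himage : ∀ p ∈ Set.range γ, (∃ t ∈ Set.Icc 0 T, p = u t) ∨ ∃ t ∈ Set.Icc T c, p = l t := by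
    intro p hp
    rw [h4, ← hunion] at hp
    obtain ⟨t, ht | ht, rfl⟩ := hp
    · exact Or.inl ⟨t, ht, hαu ht⟩
    · exact Or.inr ⟨t, ht, hαl ht⟩
  have h0c : (0 : ℝ) ∈ Set.Icc 0 c := ⟨le_rfl, by linarith⟩
  have hγ0 : γ 0 = (s, 0) := by rw [h3 h0c, hαu ⟨le_rfl, hT.le⟩, hu0]
  refine ⟨Set.range γ, ⟨γ, h1, ⟨c, by linarith, h2⟩, ⟨0, T / 2, fun h5 => ?_⟩, rfl⟩,
    ⟨0, hγ0⟩, fun p hp => ?_, fun p hp hp2 => ?_⟩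
  · have h6 : T / 2 ∈ Set.Icc 0 T := ⟨by linarith, by linarith⟩
    rw [hγ0, h3 ⟨by linarith, by linarith⟩, hαu h6] at h5
    have := h.y_pos (T / 2) ⟨by linarith, by linarith⟩
    exact this.ne (congrArg Prod.snd h5)
  · rcases himage p hp with ⟨t, ht, rfl⟩ | ⟨t, ht, rfl⟩
    · exact h.le_x ht
    · exact h'.le_x (hmemL t ht)
  · rcases himage p hp with ⟨t, ht, rfl⟩ | ⟨t, ht, rfl⟩
    · exact h.eq_end_of_y_eq_zero ht hp2
    · exact h'.eq_end_of_y_eq_zero (hmemL t ht) (neg_eq_zero.1 hp2)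

end IsArc

/-- A box around `(0, a)` on which the return map `ρ` of the upper half plane and the dissipated
work `E` are well behaved. -/
structure IsReturnBox (G f : ℝ[X]) (a δ : ℝ) (ρ E : ℝ × ℝ → ℝ) : Prop where
  arc : ∀ ε ∈ Set.Ioo (-δ) δ, ∀ s ∈ Set.Ioo (a - δ) (a + δ),
    ∃ T x y, IsArc f (derivative G) ε s (ρ (ε, s)) T x y
  energy : ∀ ε ∈ Set.Ioo (-δ) δ, ∀ s ∈ Set.Ioo (a - δ) (a + δ),
    G.eval (ρ (ε, s)) = G.eval s - ε * E (ε, s)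
  conservative : ∀ s ∈ Set.Ioo (a - δ) (a + δ), IsOval G s (ρ (0, s)) ∧
    E (0, s) = ∫ x in s..ρ (0, s), f.eval x * √(2 * (G.eval s - G.eval x))
  lt : ∀ ε ∈ Set.Ioo (-δ) δ, ∀ s ∈ Set.Ioo (a - δ) (a + δ), s < ρ (ε, s)
  inj : ∀ ε ∈ Set.Ioo (-δ) δ, ∀ ε' ∈ Set.Ioo (-δ) δ, ∀ s ∈ Set.Ioo (a - δ) (a + δ),
    G.eval (ρ (ε, s)) = G.eval (ρ (ε', s)) → ρ (ε, s) = ρ (ε', s)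
  anti : ∀ ε ∈ Set.Ioo (-δ) δ, StrictAntiOn (fun s => ρ (ε, s)) (Set.Ioo (a - δ) (a + δ))
  continuousAt : ∀ ε ∈ Set.Ioo (-δ) δ, ∀ s ∈ Set.Ioo (a - δ) (a + δ), ContinuousAt ρ (ε, s)
  analyticAt : ∀ ε ∈ Set.Ioo (-δ) δ, ∀ s ∈ Set.Ioo (a - δ) (a + δ), AnalyticAt ℝ E (ε, s)

theorem IsOval.exists_returnBox {G : ℝ[X]} {a b : ℝ} (h : IsOval G a b) (f : ℝ[X]) {W : Set ℝ}
    (hW : W ∈ 𝓝 a) : ∃ ρ E : ℝ × ℝ → ℝ, ∃ δ : ℝ, 0 < δ ∧ Set.Ioo (a - δ) (a + δ) ⊆ W ∧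
      IsReturnBox G f a δ ρ E := by
  obtain ⟨ρ, E, hρ, hE, hρa, hev⟩ := h.exists_return_map f
  refine ⟨ρ, E, ?_⟩
  have hρω : ∀ᶠ q in 𝓝 ((0 : ℝ), a), AnalyticAt ℝ ρ q :=
    (isOpen_analyticAt ℝ ρ).mem_nhds hρ.analyticAt
  have hEω : ∀ᶠ q in 𝓝 ((0 : ℝ), a), AnalyticAt ℝ E q :=
    (isOpen_analyticAt ℝ E).mem_nhds hE.analyticAt
  have hlt : ∀ᶠ q in 𝓝 ((0 : ℝ), a), q.2 < ρ q := by
    have : ContinuousAt (fun q : ℝ × ℝ => ρ q - q.2) (0, a) :=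
      hρ.continuousAt.sub continuous_snd.continuousAt
    have h1 := this.eventually (lt_mem_nhds (a := 0) (by simp [hρa, h.lt]))
    filter_upwards [h1] with q hq using by linarith
  -- the potential is increasing near `b`
  obtain ⟨κ, hκ, hmono⟩ : ∃ κ > 0, StrictMonoOn (fun x => G.eval x) (Metric.ball b κ) := by
    have h1 : ∀ᶠ x in 𝓝 b, 0 < (derivative G).eval x :=
      (derivative G).continuous.continuousAt.eventually (lt_mem_nhds h.right)
    obtain ⟨κ, hκ, h2⟩ := Metric.eventually_nhds_iff_ball.1 h1
    refine ⟨κ, hκ, strictMonoOn_of_deriv_pos (convex_ball b κ) G.continuous.continuousOn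
      fun x hx => ?_⟩
    rw [Polynomial.deriv]
    exact h2 x (interior_subset hx)
  have hball : ∀ᶠ q in 𝓝 ((0 : ℝ), a), ρ q ∈ Metric.ball b κ := by
    have := hρ.continuousAt
    rw [ContinuousAt, hρa] at this
    exact this (Metric.ball_mem_nhds b hκ)
  have hder : ∀ᶠ q in 𝓝 ((0 : ℝ), a), fderiv ℝ ρ q (0, 1) < 0 := by
    have hc : ContinuousAt (fun q => fderiv ℝ ρ q (0, 1)) (0, a) :=
      (hρ.analyticAt.fderiv.continuousAt).clm_apply continuousAt_const
    refine hc.eventually (gt_mem_nhds ?_)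
    have h1 : HasDerivAt (fun s => ρ (0, s)) (fderiv ℝ ρ (0, a) (0, 1)) a := by
      have h2 : HasFDerivAt ρ (fderiv ℝ ρ (0, a)) (0, a) :=
        hρ.analyticAt.differentiableAt.hasFDerivAt
      exact h2.comp_hasDerivAt (f := fun s : ℝ => ((0 : ℝ), s)) a
        ((hasDerivAt_const a (0 : ℝ)).prodMk (hasDerivAt_id a))
    have h3 : HasDerivAt (fun s => G.eval (ρ (0, s)))
        ((derivative G).eval b * fderiv ℝ ρ (0, a) (0, 1)) a := by
      have := (G.hasDerivAt (ρ (0, a))).comp a h1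
      rwa [hρa] at this
    have h4 : (fun s => G.eval (ρ (0, s))) =ᶠ[𝓝 a] fun s => G.eval s := by
      have : Tendsto (fun s : ℝ => ((0 : ℝ), s)) (𝓝 a) (𝓝 (0, a)) :=
        (Continuous.prodMk_right (0 : ℝ)).tendsto a
      filter_upwards [this.eventually hev] with s hs
      simpa using hs.2.1
    have h5 := (h3.congr_of_eventuallyEq h4.symm).unique (G.hasDerivAt a)
    have h6 := h.left
    rw [← h5] at h6
    by_contra hcon
    exact absurd h6 (not_lt.2 (mul_nonneg h.right.le (not_lt.1 hcon)))
  have hWev : ∀ᶠ q in 𝓝 ((0 : ℝ), a), q.2 ∈ W :=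
    continuous_snd.continuousAt.eventually hW
  obtain ⟨δ, hδ, hbox⟩ := Metric.eventually_nhds_iff_ball.1
    (hρω.and (hEω.and (hlt.and (hball.and (hder.and (hWev.and hev))))))
  have hmem : ∀ ε ∈ Set.Ioo (-δ) δ, ∀ s ∈ Set.Ioo (a - δ) (a + δ),
      (ε, s) ∈ Metric.ball ((0 : ℝ), a) δ := by
    intro ε hε s hs
    rw [← ball_prod_same, Real.ball_eq_Ioo, Real.ball_eq_Ioo]
    exact ⟨by simpa using hε, hs⟩
  have h0 : (0 : ℝ) ∈ Set.Ioo (-δ) δ := ⟨by linarith, hδ⟩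
  refine ⟨δ, hδ, fun s hs => (hbox _ (hmem 0 h0 s hs)).2.2.2.2.2.1,
    fun ε hε s hs => (hbox _ (hmem ε hε s hs)).2.2.2.2.2.2.1,
    fun ε hε s hs => (hbox _ (hmem ε hε s hs)).2.2.2.2.2.2.2.1,
    fun s hs => (hbox _ (hmem 0 h0 s hs)).2.2.2.2.2.2.2.2 rfl,
    fun ε hε s hs => (hbox _ (hmem ε hε s hs)).2.2.1,
    fun ε hε ε' hε' s hs heq => hmono.injOn (hbox _ (hmem ε hε s hs)).2.2.2.1
      (hbox _ (hmem ε' hε' s hs)).2.2.2.1 heq, fun ε hε => ?_,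
    fun ε hε s hs => (hbox _ (hmem ε hε s hs)).1.continuousAt,
    fun ε hε s hs => (hbox _ (hmem ε hε s hs)).2.1⟩
  have hd : ∀ s ∈ Set.Ioo (a - δ) (a + δ),
      HasDerivAt (fun s => ρ (ε, s)) (fderiv ℝ ρ (ε, s) (0, 1)) s := fun s hs => by
    have h2 : HasFDerivAt ρ (fderiv ℝ ρ (ε, s)) (ε, s) :=
      (hbox _ (hmem ε hε s hs)).1.differentiableAt.hasFDerivAt
    exact h2.comp_hasDerivAt (f := fun s : ℝ => (ε, s)) s
      ((hasDerivAt_const s ε).prodMk (hasDerivAt_id s))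
  refine strictAntiOn_of_deriv_neg (convex_Ioo _ _)
    (fun s hs => (hd s hs).continuousAt.continuousWithinAt) fun s hs => ?_
  rw [interior_Ioo] at hs
  rw [(hd s hs).deriv]
  exact (hbox _ (hmem ε hε s hs)).2.2.2.2.1

namespace IsReturnBox

variable {G f : ℝ[X]} {a δ : ℝ} {ρ E : ℝ × ℝ → ℝ}

theorem exists_preimage (h : IsReturnBox G f a δ ρ E) {ε u v r : ℝ} (hε : ε ∈ Set.Ioo (-δ) δ)
    (hu : u ∈ Set.Ioo (a - δ) (a + δ)) (hv : v ∈ Set.Ioo (a - δ) (a + δ)) (huv : u ≤ v)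
    (hr : r ∈ Set.Ioo (ρ (ε, v)) (ρ (ε, u))) : ∃ s ∈ Set.Ioo u v, ρ (ε, s) = r := by
  have hsub : Set.Icc u v ⊆ Set.Ioo (a - δ) (a + δ) := fun s hs =>
    ⟨hu.1.trans_le hs.1, hs.2.trans_lt hv.2⟩
  have hc : ContinuousOn (fun s => ρ (ε, s)) (Set.Icc u v) := fun s hs =>
    ((h.continuousAt ε hε s (hsub hs)).comp (f := fun s : ℝ => (ε, s))
      (Continuous.prodMk_right ε).continuousAt).continuousWithinAt
  exact intermediate_value_Ioo' huv hc hr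

/-- A sign change of the total dissipated work produces a limit cycle. -/
theorem exists_isLimitCycle (h : IsReturnBox G f a δ ρ E) {ε u v : ℝ} (hε : 0 < ε) (hεδ : ε < δ)
    (hu : u ∈ Set.Ioo (a - δ) (a + δ)) (hv : v ∈ Set.Ioo (a - δ) (a + δ)) (huv : u < v)
    (hsign : (E (ε, u) + E (-ε, u)) * (E (ε, v) + E (-ε, v)) < 0) :
    ∃ Γ, IsLimitCycle (lienard f (derivative G) ε) Γ ∧
      ∃ s ∈ Set.Ioo u v, (s, (0 : ℝ)) ∈ Γ ∧ ∀ p ∈ Γ, s ≤ p.1 := by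
  set I := Set.Ioo (a - δ) (a + δ) with hI
  have hp : ε ∈ Set.Ioo (-δ) δ := ⟨by linarith, hεδ⟩
  have hm : -ε ∈ Set.Ioo (-δ) δ := ⟨by linarith, by linarith⟩
  set D : ℝ → ℝ := fun s => E (ε, s) + E (-ε, s) with hD
  have hDan : AnalyticOnNhd ℝ D I := fun s hs => by
    have : ∀ ε ∈ Set.Ioo (-δ) δ, AnalyticAt ℝ (fun s => E (ε, s)) s := fun ε hε =>
      (h.analyticAt ε hε s hs).comp (f := fun s : ℝ => (ε, s))
        (analyticAt_const.prod analyticAt_id)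
    exact (this ε hp).add (this (-ε) hm)
  have hzero : ∀ s ∈ I, D s = 0 ↔ ρ (ε, s) = ρ (-ε, s) := fun s hs => by
    have h1 := h.energy ε hp s hs
    have h2 := h.energy (-ε) hm s hs
    constructor
    · intro h3
      refine h.inj ε hp (-ε) hm s hs ?_
      simp only [hD] at h3
      rw [h1, h2, eq_neg_iff_add_eq_zero.2 h3]
      ring
    · intro h3
      rw [h3, h2] at h1
      have h4 : ε * D s = 0 := by simp only [hD]; linarith
      exact (mul_eq_zero.1 h4).resolve_left hε.ne'
  have hsub : Set.Icc u v ⊆ I := fun s hs => ⟨hu.1.trans_le hs.1, hs.2.trans_lt hv.2⟩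
  obtain ⟨s₁, hs₁, hDs₁⟩ : ∃ s ∈ Set.Ioo u v, D s = 0 := by
    have hc : ContinuousOn D (Set.Icc u v) := fun s hs =>
      (hDan s (hsub hs)).continuousAt.continuousWithinAt
    rcases mul_neg_iff.1 hsign with ⟨h1, h2⟩ | ⟨h1, h2⟩
    · exact intermediate_value_Ioo' huv.le hc ⟨h2, h1⟩
    · exact intermediate_value_Ioo huv.le hc ⟨h1, h2⟩
  have hs₁I : s₁ ∈ I := hsub (Set.Ioo_subset_Icc_self hs₁)
  obtain ⟨η, hη, hηuv, hiso⟩ : ∃ η > 0, Set.Icc (s₁ - η) (s₁ + η) ⊆ Set.Ioo u v ∧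
      ∀ s ∈ Set.Icc (s₁ - η) (s₁ + η), D s = 0 → s = s₁ := by
    have h1 : ∀ᶠ s in 𝓝[≠] s₁, D s ≠ 0 := by
      by_contra hcon
      have h2 : ∃ᶠ s in 𝓝[≠] s₁, D s = 0 := by
        intro h3
        exact hcon h3
      have h4 := hDan.eqOn_zero_of_preconnected_of_frequently_eq_zero isPreconnected_Ioo hs₁I h2
      have : D u = 0 := h4 hu
      simp only [hD] at this
      rw [this, zero_mul] at hsign
      exact lt_irrefl _ hsign
    rw [eventually_nhdsWithin_iff] at h1
    obtain ⟨η, hη, h2⟩ := Metric.eventually_nhds_iff_ball.1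
      (h1.and (isOpen_Ioo.mem_nhds hs₁))
    have h3 : Set.Icc (s₁ - η / 2) (s₁ + η / 2) ⊆ Metric.ball s₁ η := by
      rw [Real.ball_eq_Ioo]
      exact fun s hs => ⟨by linarith [hs.1], by linarith [hs.2]⟩
    refine ⟨η / 2, by linarith, fun s hs => (h2 s (h3 hs)).2, fun s hs hs0 => ?_⟩
    by_contra hne
    exact (h2 s (h3 hs)).1 hne hs0
  set s₀ := s₁ - η with hs₀
  set s₂ := s₁ + η with hs₂
  have hI₀ : s₀ ∈ I := hsub (Set.Ioo_subset_Icc_self (hηuv ⟨le_rfl, by linarith⟩))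
  have hI₂ : s₂ ∈ I := hsub (Set.Ioo_subset_Icc_self (hηuv ⟨by linarith, le_rfl⟩))
  have h01 : s₀ < s₁ := by linarith
  have h12 : s₁ < s₂ := by linarith
  have hρ₁ := (hzero s₁ hs₁I).1 hDs₁
  set N := Set.Ioo s₀ s₂ with hN
  set N' := Set.Ioo (max (ρ (ε, s₂)) (ρ (-ε, s₂))) (min (ρ (ε, s₀)) (ρ (-ε, s₀))) with hN'
  have hNI : N ⊆ I := fun s hs => ⟨hI₀.1.trans hs.1, hs.2.trans hI₂.2⟩
  have hpre : ∀ r ∈ N', (∃ s ∈ N, ρ (ε, s) = r) ∧ ∃ s ∈ N, ρ (-ε, s) = r := fun r hr =>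
    ⟨h.exists_preimage hp hI₀ hI₂ (h01.trans h12).le ⟨(le_max_left _ _).trans_lt hr.1,
      hr.2.trans_le (min_le_left _ _)⟩, h.exists_preimage hm hI₀ hI₂ (h01.trans h12).le
      ⟨(le_max_right _ _).trans_lt hr.1, hr.2.trans_le (min_le_right _ _)⟩⟩
  obtain ⟨T, x, y, harc⟩ := h.arc ε hp s₁ hs₁I
  obtain ⟨T', x', y', harc'⟩ := h.arc (-ε) hm s₁ hs₁I
  rw [← hρ₁] at harc'
  obtain ⟨Γ, hΓ, hsΓ, hmin, haxis⟩ := harc.exists_periodicOrbit harc'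
  have hup : ∀ Γ', IsPeriodicOrbit (lienard f (derivative G) ε) Γ' → ∀ s ∈ I,
      ((s, (0 : ℝ)) ∈ Γ' ↔ (ρ (ε, s), (0 : ℝ)) ∈ Γ') ∧
      ((s, (0 : ℝ)) ∈ Γ' ↔ (ρ (-ε, s), (0 : ℝ)) ∈ Γ') := by
    intro Γ' hΓ' s hs
    obtain ⟨T, x, y, h1⟩ := h.arc ε hp s hs
    obtain ⟨T', x', y', h2⟩ := h.arc (-ε) hm s hs
    exact ⟨h1.end_mem_upper hΓ', h2.end_mem_lower hΓ'⟩
  refine ⟨Γ, ⟨hΓ, {p | p.2 ≠ 0} ∪ Prod.fst ⁻¹' (N ∪ N'), ?_, ?_, ?_⟩, s₁, hs₁, hsΓ, hmin⟩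
  · exact (isOpen_ne.preimage continuous_snd).union
      ((isOpen_Ioo.union isOpen_Ioo).preimage continuous_fst)
  · intro p hp'
    by_cases h2 : p.2 = 0
    · refine Or.inr ?_
      rcases haxis p hp' h2 with h3 | h3
      · exact Or.inl (by rw [h3]; exact ⟨h01, h12⟩)
      · refine Or.inr ?_
        rw [h3, hN']
        have hA := fun ε hε => h.anti ε hε hI₀ hs₁I h01
        have hB := fun ε hε => h.anti ε hε hs₁I hI₂ h12
        refine ⟨max_lt (hB ε hp) ?_, lt_min (hA ε hp) ?_⟩
        · rw [hρ₁]; exact hB (-ε) hm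
        · rw [hρ₁]; exact hA (-ε) hm
    · exact Or.inl h2
  · intro Γ' hΓ' hU
    have hcross : ∀ x, (x, (0 : ℝ)) ∈ Γ' → x ∈ N ∨ x ∈ N' := fun x hx => by
      rcases hU hx with h1 | h1
      · exact absurd rfl h1
      · exact h1
    obtain ⟨s', hs', hs'min⟩ := hΓ'.exists_min
    obtain ⟨r', hr', hr'max⟩ := hΓ'.exists_max
    have hs'N : s' ∈ N := by
      refine (hcross s' hs').resolve_right fun h1 => ?_
      obtain ⟨⟨s, hs, h2⟩, -⟩ := hpre s' h1
      have h3 := h.lt ε hp s (hNI hs)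
      rw [← h2] at hs'
      have h4 := hs'min _ (((hup Γ' hΓ' s (hNI hs)).1).2 hs')
      simp only at h4
      linarith
    have hr'N : r' ∈ N' := by
      refine (hcross r' hr').resolve_left fun h1 => ?_
      have h3 := h.lt ε hp r' (hNI h1)
      have h4 := hr'max _ (((hup Γ' hΓ' r' (hNI h1)).1).1 hr')
      simp only at h4
      linarith
    have hR : ρ (ε, s') = r' := by
      obtain ⟨⟨s, hs, h2⟩, -⟩ := hpre r' hr'N
      refine le_antisymm (hr'max _ (((hup Γ' hΓ' s' (hNI hs'N)).1).1 hs')) ?_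
      rw [← h2] at hr' ⊢
      exact (h.anti ε hp).antitoneOn (hNI hs'N) (hNI hs)
        (hs'min _ (((hup Γ' hΓ' s (hNI hs)).1).2 hr'))
    have hR' : ρ (-ε, s') = r' := by
      obtain ⟨-, ⟨s, hs, h2⟩⟩ := hpre r' hr'N
      refine le_antisymm (hr'max _ (((hup Γ' hΓ' s' (hNI hs'N)).2).1 hs')) ?_
      rw [← h2] at hr' ⊢
      exact (h.anti (-ε) hm).antitoneOn (hNI hs'N) (hNI hs)
        (hs'min _ (((hup Γ' hΓ' s (hNI hs)).2).2 hr'))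
    have := hiso s' (Set.Ioo_subset_Icc_self hs'N) ((hzero s' (hNI hs'N)).2 (hR.trans hR'.symm))
    rw [this] at hs'
    exact hΓ'.eq_of_mem (contDiff_lienard f (derivative G) ε) hΓ hs' hsΓ

/-- A sign change of the Melnikov integral persists for small `ε`. -/
theorem exists_isLimitCycle_of_melnikov (h : IsReturnBox G f a δ ρ E) {u v : ℝ} (hδ : 0 < δ)
    (hu : u ∈ Set.Ioo (a - δ) (a + δ)) (hv : v ∈ Set.Ioo (a - δ) (a + δ))
    (hsign : E (0, u) * E (0, v) < 0) :
    ∃ ε₀ : ℝ, 0 < ε₀ ∧ ∀ ε, 0 < ε → ε ≤ ε₀ →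
      ∃ Γ, IsLimitCycle (lienard f (derivative G) ε) Γ ∧
        ∃ s ∈ Set.Ioo (a - δ) (a + δ), (s, (0 : ℝ)) ∈ Γ ∧ ∀ p ∈ Γ, s ≤ p.1 := by
  wlog huv : u < v generalizing u v
  · rcases eq_or_lt_of_le (not_lt.1 huv) with rfl | h1
    · exact absurd hsign (not_lt.2 (mul_self_nonneg _))
    · exact this hv hu (by rwa [mul_comm]) h1
  have h0 : (0 : ℝ) ∈ Set.Ioo (-δ) δ := ⟨by linarith, hδ⟩
  have hc : ∀ s ∈ Set.Ioo (a - δ) (a + δ), ContinuousAt (fun ε => E (ε, s) + E (-ε, s)) 0 := by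
    intro s hs
    have h1 := (h.analyticAt 0 h0 s hs).continuousAt
    refine ContinuousAt.add ?_ ?_
    · exact h1.comp (f := fun ε : ℝ => (ε, s)) (Continuous.prodMk_left s).continuousAt
    · refine ContinuousAt.comp (g := E) (f := fun ε : ℝ => (-ε, s)) ?_
        (continuous_neg.prodMk continuous_const).continuousAt
      simpa using h1
  have hneg : (E (0, u) + E (-0, u)) * (E (0, v) + E (-0, v)) < 0 := by
    rw [neg_zero]
    nlinarith
  have hev := ((hc u hu).mul (hc v hv)).eventually (gt_mem_nhds hneg)
  obtain ⟨κ, hκ, hev⟩ := Metric.eventually_nhds_iff_ball.1 hev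
  refine ⟨min (κ / 2) (δ / 2), by positivity, fun ε hε hε' => ?_⟩
  have h1 : ε ≤ κ / 2 := hε'.trans (min_le_left _ _)
  have h2 : ε ≤ δ / 2 := hε'.trans (min_le_right _ _)
  obtain ⟨Γ, hΓ, s, hs, hs'⟩ := h.exists_isLimitCycle hε (by linarith) hu hv huv
    (hev ε (by rw [Real.ball_eq_Ioo]; constructor <;> linarith))
  exact ⟨Γ, hΓ, s, ⟨hu.1.trans hs.1, hs.2.trans hv.2⟩, hs'⟩

end IsReturnBox

/-- The work of the damping `f` along the upper half of an oval with end points `s` and `r`, up to a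
positive constant. -/
noncomputable def work (G f : ℝ[X]) (s r : ℝ) : ℝ :=
  ∫ x in s..r, f.eval x * √(G.eval s - G.eval x)

/-- Two nested ovals, bounding an annulus of ovals, on which the work of `f` has opposite signs. -/
structure SignPair (G f : ℝ[X]) (a₂ a₁ b₁ b₂ : ℝ) : Prop where
  lt_left : a₂ < a₁
  lt : a₁ < b₁
  lt_right : b₁ < b₂
  eq₁ : G.eval a₁ = G.eval b₁
  eq₂ : G.eval a₂ = G.eval b₂
  below : ∀ x ∈ Set.Ioo a₁ b₁, G.eval x < G.eval a₁
  left : ∀ x ∈ Set.Icc a₂ a₁, (derivative G).eval x < 0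
  right : ∀ x ∈ Set.Icc b₁ b₂, 0 < (derivative G).eval x
  sign : work G f a₁ b₁ * work G f a₂ b₂ < 0

theorem IsOval.unique {G : ℝ[X]} {s r r' : ℝ} (h : IsOval G s r) (h' : IsOval G s r') : r = r' := by
  rcases lt_trichotomy r r' with h1 | h1 | h1
  · exact absurd (h'.below r ⟨h.lt, h1⟩) (not_lt.2 h.eq.le)
  · exact h1
  · exact absurd (h.below r' ⟨h'.lt, h1⟩) (not_lt.2 h'.eq.le)

namespace SignPair

variable {G f : ℝ[X]} {a₂ a₁ b₁ b₂ : ℝ}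

theorem strictAntiOn (h : SignPair G f a₂ a₁ b₁ b₂) :
    StrictAntiOn (fun x => G.eval x) (Set.Icc a₂ a₁) := by
  refine strictAntiOn_of_deriv_neg (convex_Icc _ _) G.continuous.continuousOn fun x hx => ?_
  rw [Polynomial.deriv]
  exact h.left x (interior_subset hx)

theorem strictMonoOn (h : SignPair G f a₂ a₁ b₁ b₂) :
    StrictMonoOn (fun x => G.eval x) (Set.Icc b₁ b₂) := by
  refine strictMonoOn_of_deriv_pos (convex_Icc _ _) G.continuous.continuousOn fun x hx => ?_
  rw [Polynomial.deriv]
  exact h.right x (interior_subset hx)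

theorem isOval_of_mem (h : SignPair G f a₂ a₁ b₁ b₂) {s r : ℝ} (hs : s ∈ Set.Icc a₂ a₁)
    (hr : r ∈ Set.Icc b₁ b₂) (hsr : G.eval s = G.eval r) : IsOval G s r := by
  refine ⟨(hs.2.trans_lt h.lt).trans_le hr.1, hsr, fun x hx => ?_, h.left s hs, h.right r hr⟩
  rcases le_or_gt x a₁ with hx1 | hx1
  · exact h.strictAntiOn hs ⟨hs.1.trans hx.1.le, hx1⟩ hx.1
  rcases lt_or_ge x b₁ with hx2 | hx2
  · exact (h.below x ⟨hx1, hx2⟩).trans_le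
      (h.strictAntiOn.antitoneOn hs ⟨h.lt_left.le, le_rfl⟩ hs.2)
  · rw [hsr]
    exact h.strictMonoOn ⟨hx2, hx.2.le.trans hr.2⟩ hr hx.2

theorem exists_isOval (h : SignPair G f a₂ a₁ b₁ b₂) {s : ℝ} (hs : s ∈ Set.Icc a₂ a₁) :
    ∃ r, IsOval G s r := by
  have h1 : G.eval a₁ ≤ G.eval s := h.strictAntiOn.antitoneOn hs ⟨h.lt_left.le, le_rfl⟩ hs.2
  have h2 : G.eval s ≤ G.eval a₂ := h.strictAntiOn.antitoneOn ⟨le_rfl, h.lt_left.le⟩ hs hs.1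
  obtain ⟨r, hr, hrs⟩ : ∃ r ∈ Set.Icc b₁ b₂, G.eval r = G.eval s :=
    intermediate_value_Icc h.lt_right.le G.continuous.continuousOn
      ⟨by rw [← h.eq₁]; exact h1, by rw [← h.eq₂]; exact h2⟩
  exact ⟨r, h.isOval_of_mem hs hr hrs.symm⟩

theorem exists_signChange (h : SignPair G f a₂ a₁ b₁ b₂) :
    ∃ s₀ ∈ Set.Ioo a₂ a₁, ∃ r₀, IsOval G s₀ r₀ ∧ ∀ ρ E δ, 0 < δ →
      Set.Ioo (s₀ - δ) (s₀ + δ) ⊆ Set.Ioo a₂ a₁ → IsReturnBox G f s₀ δ ρ E →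
      ∃ u ∈ Set.Ioo (s₀ - δ) (s₀ + δ), ∃ v ∈ Set.Ioo (s₀ - δ) (s₀ + δ),
        E (0, u) * E (0, v) < 0 := by
  choose! β hβ using fun s (hs : s ∈ Set.Icc a₂ a₁) => h.exists_isOval hs
  have hL : a₂ ∈ Set.Icc a₂ a₁ := ⟨le_rfl, h.lt_left.le⟩
  have hR : a₁ ∈ Set.Icc a₂ a₁ := ⟨h.lt_left.le, le_rfl⟩
  set M : ℝ → ℝ := fun s => work G f s (β s) with hM
  have hbox : ∀ s₀ δ ρ E, IsReturnBox G f s₀ δ ρ E → ∀ s ∈ Set.Icc a₂ a₁,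
      s ∈ Set.Ioo (s₀ - δ) (s₀ + δ) → E (0, s) = √2 * M s := by
    intro s₀ δ ρ E hB s hs hsδ
    obtain ⟨h1, h2⟩ := hB.conservative s hsδ
    rw [h2, h1.unique (hβ s hs), hM]
    simp only [work]
    rw [← intervalIntegral.integral_const_mul]
    refine intervalIntegral.integral_congr fun x _ => ?_
    simp only [Real.sqrt_mul zero_le_two]
    ring
  have hMc : ContinuousOn M (Set.Icc a₂ a₁) := by
    intro s hs
    obtain ⟨ρ, E, δ, hδ, -, hB⟩ := (hβ s hs).exists_returnBox f (univ_mem : Set.univ ∈ 𝓝 s)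
    have hsδ : s ∈ Set.Ioo (s - δ) (s + δ) := ⟨by linarith, by linarith⟩
    have h1 : ContinuousAt (fun s => E (0, s)) s :=
      (hB.analyticAt 0 ⟨by linarith, hδ⟩ s hsδ).continuousAt.comp (f := fun s : ℝ => ((0 : ℝ), s))
        (Continuous.prodMk_right 0).continuousAt
    have h2 : ContinuousWithinAt (fun s => (√2)⁻¹ * E (0, s)) (Set.Icc a₂ a₁) s :=
      (h1.const_mul _).continuousWithinAt
    have h3 : ∀ r ∈ Set.Icc a₂ a₁, r ∈ Set.Ioo (s - δ) (s + δ) → M r = (√2)⁻¹ * E (0, r) := by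
      intro r hr hrδ
      rw [hbox s δ ρ E hB r hr hrδ, inv_mul_cancel_left₀ (by positivity)]
    refine h2.congr_of_eventuallyEq ?_ (h3 s hs hsδ)
    filter_upwards [self_mem_nhdsWithin, nhdsWithin_le_nhds (isOpen_Ioo.mem_nhds hsδ)] with r hr hrδ
    exact h3 r hr hrδ
  set N : ℝ → ℝ := fun s => M a₂ * M s with hN
  have hNc : ContinuousOn N (Set.Icc a₂ a₁) := hMc.const_smul (M a₂)
  have hsign : M a₁ * M a₂ < 0 := by
    have h1 : β a₁ = b₁ := (hβ a₁ hR).unique (h.isOval_of_mem hR ⟨le_rfl, h.lt_right.le⟩ h.eq₁)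
    have h2 : β a₂ = b₂ := (hβ a₂ hL).unique (h.isOval_of_mem hL ⟨h.lt_right.le, le_rfl⟩ h.eq₂)
    simp only [hM, h1, h2]
    exact h.sign
  have hN₂ : 0 < N a₂ := by
    have : M a₂ ≠ 0 := fun h1 => by simp [h1] at hsign
    exact mul_self_pos.2 this
  have hN₁ : N a₁ < 0 := by simp only [hN]; linarith
  set S : Set ℝ := {s ∈ Set.Icc a₂ a₁ | 0 < N s} with hS
  have hSne : S.Nonempty := ⟨a₂, hL, hN₂⟩
  have hSb : BddAbove S := ⟨a₁, fun s hs => hs.1.2⟩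
  set s₀ := sSup S with hs₀
  have hs₀I : s₀ ∈ Set.Icc a₂ a₁ :=
    ⟨le_csSup hSb ⟨hL, hN₂⟩, csSup_le hSne fun s hs => hs.1.2⟩
  have hafter : ∀ s ∈ Set.Icc a₂ a₁, s₀ < s → N s ≤ 0 := fun s hs hlt => by
    by_contra hcon
    exact absurd (le_csSup hSb ⟨hs, not_le.1 hcon⟩) (not_le.2 hlt)
  have hge : 0 ≤ N s₀ := by
    have h2 : ContinuousWithinAt N S s₀ := (hNc s₀ hs₀I).mono fun s hs => hs.1
    have h3 := h2.mem_closure_image (csSup_mem_closure hSne hSb)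
    exact closure_minimal (by rintro _ ⟨s, hs, rfl⟩; exact hs.2.le) isClosed_Ici h3
  have hlt₁ : s₀ < a₁ := lt_of_le_of_ne hs₀I.2 fun h1 => by
    rw [h1] at hge
    linarith
  have hle : N s₀ ≤ 0 := by
    have h2 : ContinuousWithinAt N (Set.Ioo s₀ a₁) s₀ := (hNc s₀ hs₀I).mono fun s hs =>
      ⟨hs₀I.1.trans hs.1.le, hs.2.le⟩
    have h3 : s₀ ∈ closure (Set.Ioo s₀ a₁) := by
      rw [closure_Ioo hlt₁.ne]
      exact ⟨le_rfl, hlt₁.le⟩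
    refine closure_minimal ?_ isClosed_Iic (h2.mem_closure_image h3)
    rintro _ ⟨s, hs, rfl⟩
    exact hafter s ⟨hs₀I.1.trans hs.1.le, hs.2.le⟩ hs.1
  have hlt₂ : a₂ < s₀ := lt_of_le_of_ne hs₀I.1 fun h1 => by
    rw [← h1] at hle
    linarith
  refine ⟨s₀, ⟨hlt₂, hlt₁⟩, β s₀, hβ s₀ hs₀I, fun ρ E δ hδ hsub hB => ?_⟩
  have hIcc : ∀ s ∈ Set.Ioo (s₀ - δ) (s₀ + δ), s ∈ Set.Icc a₂ a₁ := fun s hs =>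
    Set.Ioo_subset_Icc_self (hsub hs)
  have hE : ∀ s ∈ Set.Ioo (s₀ - δ) (s₀ + δ), E (0, s) = √2 * M s := fun s hs =>
    hbox s₀ δ ρ E hB s (hIcc s hs) hs
  obtain ⟨u, hu, huδ⟩ := exists_lt_of_lt_csSup hSne (show s₀ - δ < s₀ by linarith)
  have huI : u ∈ Set.Ioo (s₀ - δ) (s₀ + δ) := ⟨huδ, by linarith [le_csSup hSb hu]⟩
  have h2 : (0 : ℝ) < √2 := by positivity
  obtain ⟨v, hv, hNv⟩ : ∃ v ∈ Set.Ioo s₀ (s₀ + δ), N v < 0 := by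
    by_contra! hcon
    have han : AnalyticOnNhd ℝ (fun s => E (0, s)) (Set.Ioo (s₀ - δ) (s₀ + δ)) := fun s hs =>
      (hB.analyticAt 0 ⟨by linarith, hδ⟩ s hs).comp (f := fun s : ℝ => ((0 : ℝ), s))
        (analyticAt_const.prod analyticAt_id)
    have hz : ∀ v ∈ Set.Ioo s₀ (s₀ + δ), E (0, v) = 0 := fun v hv => by
      have hvI : v ∈ Set.Ioo (s₀ - δ) (s₀ + δ) := ⟨by linarith [hv.1], hv.2⟩
      have h3 : N v = 0 := (hafter v (hIcc v hvI) hv.1).antisymm (hcon v hv)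
      have h4 : M a₂ ≠ 0 := fun h1 => by simp [h1] at hsign
      rw [hE v hvI, (mul_eq_zero.1 h3).resolve_left h4, mul_zero]
    have hzero := han.eqOn_zero_of_preconnected_of_eventuallyEq_zero isPreconnected_Ioo
      (z₀ := s₀ + δ / 2) ⟨by linarith, by linarith⟩ (by
        filter_upwards [isOpen_Ioo.mem_nhds (show s₀ + δ / 2 ∈ Set.Ioo s₀ (s₀ + δ) from
          ⟨by linarith, by linarith⟩)] with v hv using hz v hv)
    have h3 : E (0, u) = 0 := hzero huI
    rw [hE u huI] at h3
    have h4 : N u = 0 := by rw [hN]; simp only [(mul_eq_zero.1 h3).resolve_left h2.ne', mul_zero]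
    exact absurd hu.2 (by rw [h4]; exact lt_irrefl 0)
  have hvI : v ∈ Set.Ioo (s₀ - δ) (s₀ + δ) := ⟨by linarith [hv.1], hv.2⟩
  refine ⟨u, huI, v, hvI, ?_⟩
  rw [hE u huI, hE v hvI]
  have h3 : N u * N v < 0 := mul_neg_of_pos_of_neg hu.2 hNv
  by_contra hcon
  have h4 : 0 ≤ M u * M v := by
    have : √2 * M u * (√2 * M v) = √2 * √2 * (M u * M v) := by ring
    rw [this] at hcon
    by_contra h5
    exact hcon (mul_neg_of_pos_of_neg (by positivity) (not_le.1 h5))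
  have h5 : N u * N v = M a₂ * M a₂ * (M u * M v) := by simp only [hN]; ring
  rw [h5] at h3
  exact absurd h3 (not_lt.2 (mul_nonneg (mul_self_nonneg _) h4))

/-- A sign pair yields, for all small `ε`, a limit cycle in the annulus it bounds. -/
theorem exists_isLimitCycle (h : SignPair G f a₂ a₁ b₁ b₂) :
    ∃ ε₀ : ℝ, 0 < ε₀ ∧ ∀ ε, 0 < ε → ε ≤ ε₀ →
      ∃ Γ, IsLimitCycle (lienard f (derivative G) ε) Γ ∧
        ∃ s ∈ Set.Ioo a₂ a₁, (s, (0 : ℝ)) ∈ Γ ∧ ∀ p ∈ Γ, s ≤ p.1 := by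
  obtain ⟨s₀, hs₀, r₀, hO, hchange⟩ := h.exists_signChange
  obtain ⟨ρ, E, δ, hδ, hsub, hB⟩ := hO.exists_returnBox f (isOpen_Ioo.mem_nhds hs₀)
  obtain ⟨u, hu, v, hv, huv⟩ := hchange ρ E δ hδ hsub hB
  obtain ⟨ε₀, hε₀, hcyc⟩ := hB.exists_isLimitCycle_of_melnikov hδ hu hv huv
  refine ⟨ε₀, hε₀, fun ε hε hε' => ?_⟩
  obtain ⟨Γ, hΓ, s, hs, hs'⟩ := hcyc ε hε hε'
  exact ⟨Γ, hΓ, s, hsub hs, hs'⟩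

end SignPair

/-- A family of sign pairs with disjoint annuli. -/
structure SignSystem {ι : Type} (G f : ℝ[X]) (q : ι → Fin 4 → ℝ) : Prop where
  pair : ∀ i, SignPair G f (q i 0) (q i 1) (q i 2) (q i 3)
  disjoint_left : ∀ i j, i ≠ j → Disjoint (Set.Ioo (q i 0) (q i 1)) (Set.Ioo (q j 0) (q j 1))
  disjoint_right : ∀ i j, i ≠ j → Disjoint (Set.Ioo (q i 2) (q i 3)) (Set.Ioo (q j 2) (q j 3))

theorem SignSystem.hGe {ι : Type} [Fintype ι] {G f : ℝ[X]} {n m : ℕ} {q : ι → Fin 4 → ℝ}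
    (h : SignSystem G f q)
    (hf : f.natDegree ≤ n) (hG : (derivative G).natDegree ≤ m) : HGe n m (Fintype.card ι) := by
  choose e he hcyc using fun i => (h.pair i).exists_isLimitCycle
  obtain ⟨ε₀, hε₀, hmin⟩ : ∃ ε₀ : ℝ, 0 < ε₀ ∧ ∀ i, ε₀ ≤ e i := by
    rcases isEmpty_or_nonempty ι with hN | hN
    · exact ⟨1, one_pos, fun i => hN.elim i⟩
    · obtain ⟨i, hi⟩ := Finite.exists_min e
      exact ⟨e i, he i, hi⟩
  refine ⟨f, derivative G, hf, hG, ε₀, hε₀, fun ε hε hε' => ?_⟩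
  choose Γ hΓ s hs hsΓ hsmin using fun i => hcyc i ε hε (hε'.trans (hmin i))
  have hinj : Function.Injective Γ := by
    intro i j hij
    by_contra hne
    have h1 : s i ≤ s j := hsmin i (s j, 0) (by rw [hij]; exact hsΓ j)
    have h2 : s j ≤ s i := hsmin j (s i, 0) (by rw [← hij]; exact hsΓ i)
    have h3 := hs j
    rw [← h1.antisymm h2] at h3
    exact Set.disjoint_left.1 (h.disjoint_left i j hne) (hs i) h3
  classical
  refine ⟨Finset.univ.image Γ, fun Δ hΔ => ?_, ?_⟩
  · obtain ⟨i, -, rfl⟩ := Finset.mem_image.1 hΔ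
    exact hΓ i
  · rw [Finset.card_image_of_injective _ hinj, Finset.card_univ]

theorem continuous_work_integrand (G f : ℝ[X]) (c : ℝ) :
    Continuous fun x => f.eval x * √(c - G.eval x) :=
  f.continuous.mul (continuous_const.sub G.continuous).sqrt

theorem work_add (G f₁ f₂ : ℝ[X]) (s r : ℝ) :
    work G (f₁ + f₂) s r = work G f₁ s r + work G f₂ s r := by
  simp only [work, eval_add, add_mul]
  exact intervalIntegral.integral_add ((continuous_work_integrand G f₁ _).intervalIntegrable _ _)
    ((continuous_work_integrand G f₂ _).intervalIntegrable _ _)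

theorem work_C_mul (G f : ℝ[X]) (c s r : ℝ) : work G (C c * f) s r = c * work G f s r := by
  simp only [work, eval_mul, eval_C, mul_assoc]
  exact intervalIntegral.integral_const_mul _ _

theorem work_neg (G f : ℝ[X]) (s r : ℝ) : work G (-f) s r = -work G f s r := by
  have := work_C_mul G f (-1) s r
  simpa using this

theorem work_comp_neg (G f : ℝ[X]) {s r : ℝ} (h : G.eval s = G.eval r) :
    work (G.comp (-X)) (f.comp (-X)) (-r) (-s) = work G f s r := by
  simp only [work, eval_comp, eval_neg, eval_X, neg_neg, h]
  have := intervalIntegral.integral_comp_neg (a := -r) (b := -s)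
    (fun x => f.eval x * √(G.eval r - G.eval x))
  simpa using this

theorem work_eq_zero_of_odd {G f : ℝ[X]} (hG : G.comp (-X) = G) (hf : f.comp (-X) = -f) (b : ℝ) :
    work G f (-b) b = 0 := by
  have h1 : G.eval (-b) = G.eval b := by
    conv_rhs => rw [← hG]
    simp
  have := work_comp_neg G f h1
  rw [hG, hf, work_neg, neg_neg] at this
  linarith

theorem work_comp_sq (G f : ℝ[X]) (A : ℝ) {s r : ℝ} (hs : -A < s) (hr : -A < r) :
    work (G.comp (X ^ 2 - C A)) (2 * X * f.comp (X ^ 2 - C A)) √(s + A) √(r + A) =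
      work G f s r := by
  have h1 : √(s + A) ^ 2 - A = s := by rw [Real.sq_sqrt (by linarith)]; ring
  have h2 : √(r + A) ^ 2 - A = r := by rw [Real.sq_sqrt (by linarith)]; ring
  have := intervalIntegral.integral_comp_mul_deriv (a := √(s + A)) (b := √(r + A))
    (f := fun x => x ^ 2 - A) (f' := fun x => 2 * x)
    (g := fun x => f.eval x * √(G.eval s - G.eval x))
    (fun x _ => by simpa using ((hasDerivAt_id x).pow 2).sub_const A)
    (by fun_prop) (continuous_work_integrand G f _)
  simp only [h1, h2, Function.comp_apply] at this
  simp only [work, eval_comp, eval_mul, eval_sub, eval_pow, eval_X, eval_C, eval_ofNat, h1]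
  rw [← this]
  refine intervalIntegral.integral_congr fun x _ => ?_
  ring

theorem eval_derivative_comp_sq (G : ℝ[X]) (A x : ℝ) :
    (derivative (G.comp (X ^ 2 - C A))).eval x = 2 * x * (derivative G).eval (x ^ 2 - A) := by
  simp [derivative_comp, one_add_one_eq_two]

namespace SignPair

variable {G f : ℝ[X]} {a₂ a₁ b₁ b₂ : ℝ}

theorem neg (h : SignPair G f a₂ a₁ b₁ b₂) : SignPair G (-f) a₂ a₁ b₁ b₂ :=
  ⟨h.lt_left, h.lt, h.lt_right, h.eq₁, h.eq₂, h.below, h.left, h.right, by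
    rw [work_neg, work_neg, neg_mul_neg]; exact h.sign⟩

theorem eventually_add (h : SignPair G f a₂ a₁ b₁ b₂) (k : ℝ[X]) :
    ∀ᶠ δ in 𝓝 (0 : ℝ), SignPair G (f + C δ * k) a₂ a₁ b₁ b₂ := by
  have hc : Continuous fun δ : ℝ => (work G f a₁ b₁ + δ * work G k a₁ b₁) *
      (work G f a₂ b₂ + δ * work G k a₂ b₂) := by fun_prop
  have h0 : (work G f a₁ b₁ + 0 * work G k a₁ b₁) * (work G f a₂ b₂ + 0 * work G k a₂ b₂) < 0 := by
    simpa only [zero_mul, add_zero] using h.sign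
  have := hc.continuousAt.eventually (gt_mem_nhds h0)
  filter_upwards [this] with δ hδ
  exact ⟨h.lt_left, h.lt, h.lt_right, h.eq₁, h.eq₂, h.below, h.left, h.right, by
    rw [work_add, work_add, work_C_mul, work_C_mul]; exact hδ⟩

theorem comp_neg (h : SignPair G f a₂ a₁ b₁ b₂) :
    SignPair (G.comp (-X)) (f.comp (-X)) (-b₂) (-b₁) (-a₁) (-a₂) := by
  refine ⟨neg_lt_neg h.lt_right, neg_lt_neg h.lt, neg_lt_neg h.lt_left, by simp [h.eq₁],
    by simp [h.eq₂], fun x hx => ?_, fun x hx => ?_, fun x hx => ?_, ?_⟩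
  · have := h.below (-x) ⟨by linarith [hx.2], by linarith [hx.1]⟩
    simpa [← h.eq₁] using this
  · have := h.right (-x) ⟨by linarith [hx.2], by linarith [hx.1]⟩
    simpa [derivative_comp] using this
  · have := h.left (-x) ⟨by linarith [hx.2], by linarith [hx.1]⟩
    simpa [derivative_comp] using this
  · rw [work_comp_neg _ _ h.eq₁, work_comp_neg _ _ h.eq₂]
    exact h.sign

theorem comp_sq (h : SignPair G f a₂ a₁ b₁ b₂) {A : ℝ} (hA : -A < a₂) :
    SignPair (G.comp (X ^ 2 - C A)) (2 * X * f.comp (X ^ 2 - C A))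
      √(a₂ + A) √(a₁ + A) √(b₁ + A) √(b₂ + A) := by
  have h1 := h.lt_left
  have h2 := h.lt
  have h3 := h.lt_right
  have hsq : ∀ {s : ℝ}, a₂ ≤ s → √(s + A) ^ 2 - A = s := fun hs => by
    rw [Real.sq_sqrt (by linarith)]; ring
  have hlt : ∀ {s r : ℝ}, a₂ ≤ s → s < r → √(s + A) < √(r + A) := fun hs hsr =>
    Real.sqrt_lt_sqrt (by linarith) (by linarith)
  have hpos : ∀ {s x : ℝ}, a₂ ≤ s → √(s + A) ≤ x → 0 < x := fun hs hx =>
    (Real.sqrt_pos.2 (by linarith)).trans_le hx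
  have hlo : ∀ {s x : ℝ}, a₂ ≤ s → √(s + A) ≤ x → s ≤ x ^ 2 - A := fun hs hx => by
    rw [← hsq hs]; gcongr
  have hhi : ∀ {s x : ℝ}, a₂ ≤ s → 0 < x → x ≤ √(s + A) → x ^ 2 - A ≤ s := fun hs h0 hx => by
    conv_rhs => rw [← hsq hs]
    gcongr
  refine ⟨hlt le_rfl h1, hlt h1.le h2, hlt (by linarith) h3, ?_, ?_, fun x hx => ?_,
    fun x hx => ?_, fun x hx => ?_, ?_⟩
  · simp [hsq h1.le, hsq (h1.trans h2).le, h.eq₁]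
  · simp [hsq le_rfl, hsq (h1.trans (h2.trans h3)).le, h.eq₂]
  · have h0 := hpos h1.le hx.1.le
    have := h.below (x ^ 2 - A) ⟨?_, ?_⟩
    · simpa [hsq h1.le] using this
    · rw [← hsq h1.le]
      have := hx.1
      gcongr
    · rw [← hsq (h1.trans h2).le]
      have := hx.2
      gcongr
  · have h0 := hpos le_rfl hx.1
    have := h.left (x ^ 2 - A) ⟨hlo le_rfl hx.1, hhi h1.le h0 hx.2⟩
    rw [eval_derivative_comp_sq]
    exact mul_neg_of_pos_of_neg (by linarith) this
  · have h0 := hpos (by linarith) hx.1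
    have := h.right (x ^ 2 - A) ⟨hlo (by linarith) hx.1, hhi (by linarith) h0 hx.2⟩
    rw [eval_derivative_comp_sq]
    exact mul_pos (by linarith) this
  · rw [work_comp_sq G f A (by linarith) (by linarith), work_comp_sq G f A hA (by linarith)]
    exact h.sign

end SignPair

theorem eval_neg_of_even {G : ℝ[X]} (hG : G.comp (-X) = G) (x : ℝ) : G.eval (-x) = G.eval x := by
  conv_rhs => rw [← hG]
  simp

theorem tendsto_eval_atTop {G : ℝ[X]} (hd : 0 < G.natDegree) (hl : 0 < G.leadingCoeff) :
    Tendsto (fun x => G.eval x) atTop atTop :=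
  G.tendsto_atTop_of_leadingCoeff_nonneg (natDegree_pos_iff_degree_pos.1 hd) hl.le

theorem exists_confining {G : ℝ[X]} (hG : G.comp (-X) = G) (hd : 2 ≤ G.natDegree)
    (hl : 0 < G.leadingCoeff) : ∃ B : ℝ, 0 < B ∧ (∀ x, B ≤ x → 0 < (derivative G).eval x) ∧
      ∀ b, B ≤ b → ∀ x ∈ Set.Ioo (-b) b, G.eval x < G.eval b := by
  have h1 : Tendsto (fun x => (derivative G).eval x) atTop atTop := by
    have hn : (derivative G).natDegree = G.natDegree - 1 := natDegree_derivative G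
    refine tendsto_eval_atTop (by omega) ?_
    rw [leadingCoeff, hn, coeff_derivative, Nat.sub_add_cancel (by omega)]
    exact mul_pos hl (by positivity)
  obtain ⟨B₀, hB₀⟩ := eventually_atTop.1 ((h1.eventually_gt_atTop 0).and (eventually_gt_atTop 0))
  have hmono : StrictMonoOn (fun x => G.eval x) (Set.Ici B₀) := by
    refine strictMonoOn_of_deriv_pos (convex_Ici _) G.continuous.continuousOn fun x hx => ?_
    rw [Polynomial.deriv]
    exact (hB₀ x (interior_subset hx)).1
  obtain ⟨K, hK⟩ := (isCompact_Icc.image (s := Set.Icc (-B₀) B₀) G.continuous).bddAbove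
  obtain ⟨B₁, hB₁⟩ := eventually_atTop.1
    ((tendsto_eval_atTop (by omega) hl).eventually_gt_atTop K)
  have hpos : ∀ b, max B₀ B₁ ≤ b → ∀ x ∈ Set.Ico 0 b, G.eval x < G.eval b := by
    intro b hb x hx
    have hb0 : B₀ ≤ b := (le_max_left _ _).trans hb
    rcases le_total x B₀ with h2 | h2
    · refine lt_of_le_of_lt (hK ⟨x, ⟨?_, h2⟩, rfl⟩) (hB₁ b ((le_max_right _ _).trans hb))
      linarith [hx.1, (hB₀ B₀ le_rfl).2]
    · exact hmono h2 hb0 hx.2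
  refine ⟨max B₀ B₁, (hB₀ B₀ le_rfl).2.trans_le (le_max_left _ _),
    fun x hx => (hB₀ x ((le_max_left _ _).trans hx)).1, fun b hb x hx => ?_⟩
  rcases le_total 0 x with h2 | h2
  · exact hpos b hb x ⟨h2, hx.2⟩
  · rw [← eval_neg_of_even hG]
    exact hpos b hb (-x) ⟨by linarith, by linarith [hx.1]⟩

/-- Along large ovals the work of a damping that is bounded below by `1` far away is positive. -/
theorem exists_work_pos {G p : ℝ[X]} (hG : G.comp (-X) = G) (hd : 0 < G.natDegree)
    (hl : 0 < G.leadingCoeff) {R : ℝ} (hp : ∀ x, R ≤ |x| → 1 ≤ p.eval x) :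
    ∃ B : ℝ, ∀ b, B ≤ b → 0 < work G p (-b) b := by
  wlog hR : 0 < R generalizing R
  · exact this (R := 1) (fun x hx => hp x ((not_lt.1 hR).trans (abs_nonneg x))) one_pos
  set I₀ := ∫ x in (-R)..R, p.eval x with hI₀
  set R' := R + |I₀| + 1 with hR'
  have hInt : ∀ a b, IntervalIntegrable (fun x => p.eval x) MeasureTheory.volume a b :=
    fun a b => p.continuous.intervalIntegrable a b
  have hRR' : R < R' := by have := abs_nonneg I₀; linarith
  have hside : ∀ a b, a ≤ b → (∀ x ∈ Set.Icc a b, R ≤ |x|) → b - a ≤ ∫ x in a..b, p.eval x := by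
    intro a b hab h
    have := intervalIntegral.integral_mono_on hab (intervalIntegrable_const (c := (1 : ℝ)))
      (hInt a b) fun x hx => hp x (h x hx)
    simpa using this
  have hL : ∀ {b x}, x ∈ Set.Icc (-b) (-R) → R ≤ |x| := fun hx => by
    rw [abs_of_nonpos (by linarith [hx.2])]
    linarith [hx.2]
  have hRt : ∀ {b x}, x ∈ Set.Icc R b → R ≤ |x| := fun hx => hx.1.trans (le_abs_self _)
  have hmid : 0 < ∫ x in (-R')..R', p.eval x := by
    rw [← intervalIntegral.integral_add_adjacent_intervals (hInt (-R') (-R)) (hInt (-R) R'),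
      ← intervalIntegral.integral_add_adjacent_intervals (hInt (-R) R) (hInt R R')]
    have h1 := hside (-R') (-R) (by linarith) fun x hx => hL hx
    have h2 := hside R R' hRR'.le fun x hx => hRt hx
    linarith [neg_abs_le I₀]
  have hψ : Continuous fun t : ℝ => ∫ x in (-R')..R', p.eval x * √(1 - t * G.eval x) :=
    intervalIntegral.continuous_parametric_intervalIntegral_of_continuous'
      (by
        have := p.continuous
        have := G.continuous
        fun_prop) _ _
  have hev := hψ.continuousAt.eventually (lt_mem_nhds (a := 0) (b := ∫ x in (-R')..R', p.eval x *
    √(1 - 0 * G.eval x)) (by simpa using hmid))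
  have hGtop := tendsto_eval_atTop hd hl
  obtain ⟨B, hB⟩ := eventually_atTop.1 ((hGtop.inv_tendsto_atTop.eventually hev).and
    ((hGtop.eventually_gt_atTop 0).and (eventually_ge_atTop R')))
  refine ⟨B, fun b hb => ?_⟩
  obtain ⟨h1, h2, h3⟩ := hB b hb
  simp only [Pi.inv_apply] at h1
  rw [work, eval_neg_of_even hG]
  have hc := continuous_work_integrand G p (G.eval b)
  have hi : ∀ a d, IntervalIntegrable (fun x => p.eval x * √(G.eval b - G.eval x))
      MeasureTheory.volume a d := fun a d => hc.intervalIntegrable a d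
  rw [← intervalIntegral.integral_add_adjacent_intervals (hi (-b) (-R')) (hi (-R') b),
    ← intervalIntegral.integral_add_adjacent_intervals (hi (-R') R') (hi R' b)]
  have hnn : ∀ x, R ≤ |x| → 0 ≤ p.eval x * √(G.eval b - G.eval x) := fun x hx =>
    mul_nonneg (zero_le_one.trans (hp x hx)) (Real.sqrt_nonneg _)
  have h4 : 0 ≤ ∫ x in (-b)..(-R'), p.eval x * √(G.eval b - G.eval x) :=
    intervalIntegral.integral_nonneg (by linarith) fun x hx =>
      hnn x (hL (b := b) ⟨hx.1, by linarith [hx.2]⟩)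
  have h5 : 0 ≤ ∫ x in R'..b, p.eval x * √(G.eval b - G.eval x) :=
    intervalIntegral.integral_nonneg h3 fun x hx => hnn x (hRt (b := b) ⟨by linarith [hx.1], hx.2⟩)
  have h6 : ∫ x in (-R')..R', p.eval x * √(G.eval b - G.eval x) =
      √(G.eval b) * ∫ x in (-R')..R', p.eval x * √(1 - (G.eval b)⁻¹ * G.eval x) := by
    rw [← intervalIntegral.integral_const_mul]
    refine intervalIntegral.integral_congr fun x _ => ?_
    have h7 : G.eval b - G.eval x = G.eval b * (1 - (G.eval b)⁻¹ * G.eval x) := by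
      field_simp
    rw [h7, Real.sqrt_mul h2.le]
    ring
  have h8 := mul_pos (Real.sqrt_pos.2 h2) h1
  rw [h6]
  linarith

/-- Alternating signs of the work along `k + 1` large symmetric ovals. -/
theorem exists_alternating {G : ℝ[X]} (hG : G.comp (-X) = G) (hd : 0 < G.natDegree)
    (hl : 0 < G.leadingCoeff) (B : ℝ) (k : ℕ) : ∃ h : ℝ[X], h.natDegree ≤ k ∧ ∃ b : ℕ → ℝ,
      StrictMono b ∧ B < b 0 ∧
      (∀ i ≤ k, work G (h.comp (X ^ 2)) (-b i) (b i) ≠ 0) ∧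
      ∀ i < k, work G (h.comp (X ^ 2)) (-b i) (b i) *
        work G (h.comp (X ^ 2)) (-b (i + 1)) (b (i + 1)) < 0 := by
  induction k with
  | zero =>
    obtain ⟨B₁, hB₁⟩ := exists_work_pos hG hd hl (p := 1) (R := 0) fun x _ => by simp
    refine ⟨1, by simp, fun i => max B₁ B + 1 + i, fun i j hij => ?_, ?_, fun i hi => ?_, by simp⟩
    · have : (i : ℝ) < j := by exact_mod_cast hij
      simp only
      linarith
    · have := le_max_right B₁ B
      simp only [Nat.cast_zero]
      linarith
    · obtain rfl : i = 0 := by omega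
      have := le_max_left B₁ B
      rw [one_comp]
      exact (hB₁ _ (by simp only [Nat.cast_zero]; linarith)).ne'
  | succ k ih =>
    obtain ⟨h, hh, b, hb, hB, hne, halt⟩ := ih
    set W : ℝ[X] → ℝ → ℝ := fun p c => work G p (-c) c with hW
    set w := W (h.comp (X ^ 2)) (b k) with hw
    -- the new coefficient has the sign opposite to the last work integral
    set σ : ℝ := -SignType.sign w with hσ
    have hwne : w ≠ 0 := hne k le_rfl
    have hσw : σ * w < 0 := by
      rcases lt_or_gt_of_ne hwne with h1 | h1
      · simp [hσ, h1]
      · simp [hσ, h1]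
    have hσσ : σ * σ = 1 := by
      rcases lt_or_gt_of_ne hwne with h1 | h1 <;> simp [hσ, h1]
    set H : ℝ → ℝ[X] := fun η => h + C (η * σ) * X ^ (k + 1) with hH
    have hWH : ∀ η c, W ((H η).comp (X ^ 2)) c =
        W (h.comp (X ^ 2)) c + η * (σ * W ((X ^ (k + 1)).comp (X ^ 2)) c) := by
      intro η c
      simp only [hW, hH, add_comp, mul_comp, C_comp]
      rw [work_add, work_C_mul]
      ring
    have hcont : ∀ c, Continuous fun η => W ((H η).comp (X ^ 2)) c := fun c => by
      simp only [hWH]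
      fun_prop
    have hWH0 : ∀ c, W ((H 0).comp (X ^ 2)) c = W (h.comp (X ^ 2)) c := fun c => by
      rw [hWH]; ring
    have hev₁ : ∀ᶠ η in 𝓝 (0 : ℝ), ∀ i ∈ Finset.range (k + 1), W ((H η).comp (X ^ 2)) (b i) ≠ 0 := by
      rw [Filter.eventually_all_finset]
      intro i hi
      refine (hcont (b i)).continuousAt.eventually_ne ?_
      rw [hWH0]
      exact hne i (by simpa [Nat.lt_succ_iff] using hi)
    have hev₂ : ∀ᶠ η in 𝓝 (0 : ℝ), ∀ i ∈ Finset.range k,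
        W ((H η).comp (X ^ 2)) (b i) * W ((H η).comp (X ^ 2)) (b (i + 1)) < 0 := by
      rw [Filter.eventually_all_finset]
      intro i hi
      have := ((hcont (b i)).mul (hcont (b (i + 1)))).continuousAt (x := 0)
      refine this.eventually (gt_mem_nhds ?_)
      simp only [Pi.mul_apply, hWH0]
      exact halt i (by simpa using hi)
    have hev₃ : ∀ᶠ η in 𝓝 (0 : ℝ), σ * W ((H η).comp (X ^ 2)) (b k) < 0 := by
      refine ((hcont (b k)).const_mul σ).continuousAt.eventually (gt_mem_nhds ?_)
      simp only [hWH0]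
      exact hσw
    obtain ⟨η, ⟨h1, h2, h3⟩, hη⟩ := (((hev₁.and (hev₂.and hev₃)).filter_mono
      (nhdsWithin_le_nhds (s := Set.Ioi 0))).and self_mem_nhdsWithin).exists
    have hη : 0 < η := hη
    obtain ⟨R, hR⟩ : ∃ R : ℝ, ∀ x, R ≤ |x| → 1 ≤ ((C σ * H η).comp (X ^ 2)).eval x := by
      have hdeg : (C σ * h).natDegree < k + 1 := (natDegree_C_mul_le _ _).trans_lt (by omega)
      have heq : C σ * H η = C η * X ^ (k + 1) + C σ * h := by
        simp only [hH, mul_add, ← mul_assoc, ← C_mul]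
        rw [show σ * η * σ = η by rw [mul_right_comm, hσσ, one_mul]]
        ring
      have hdegη : (C η * X ^ (k + 1)).natDegree = k + 1 := natDegree_C_mul_X_pow _ _ hη.ne'
      have hn : (C σ * H η).natDegree = k + 1 := by
        rw [heq, natDegree_add_eq_left_of_natDegree_lt (by rw [hdegη]; exact hdeg), hdegη]
      have hlead : 0 < (C σ * H η).leadingCoeff := by
        rw [leadingCoeff, hn, heq, coeff_add, coeff_eq_zero_of_natDegree_lt hdeg]
        simpa using hη
      obtain ⟨R, hR⟩ := eventually_atTop.1
        ((tendsto_eval_atTop (by omega) hlead).eventually_ge_atTop 1)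
      refine ⟨max R 1, fun x hx => ?_⟩
      have hx1 : 1 ≤ |x| := (le_max_right _ _).trans hx
      have hxR : R ≤ |x| := (le_max_left _ _).trans hx
      rw [eval_comp, eval_pow, eval_X]
      refine hR _ ?_
      rw [← sq_abs]
      nlinarith
    obtain ⟨B₁, hB₁⟩ := exists_work_pos hG hd hl hR
    set c := max B₁ (b k) + 1 with hc
    have hcB : B₁ ≤ c := by have := le_max_left B₁ (b k); linarith
    have hcb : b k < c := by have := le_max_right B₁ (b k); linarith
    have hWc : 0 < σ * W ((H η).comp (X ^ 2)) c := by
      have := hB₁ c hcB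
      rw [mul_comp, C_comp, work_C_mul] at this
      exact this
    set b' : ℕ → ℝ := fun i => if i ≤ k then b i else c + ((i : ℝ) - (k + 1)) with hb'
    have hb'le : ∀ i ≤ k, b' i = b i := fun i hi => by simp [hb', hi]
    have hb'k : b' (k + 1) = c := by simp [hb']
    refine ⟨H η, ?_, b', strictMono_nat_of_lt_succ fun i => ?_, ?_, fun i hi => ?_, fun i hi => ?_⟩
    · refine natDegree_add_le_of_degree_le (by omega) ?_
      exact natDegree_C_mul_X_pow_le _ _
    · rcases lt_trichotomy i k with h4 | rfl | h4
      · rw [hb'le i h4.le, hb'le (i + 1) h4]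
        exact hb (Nat.lt_succ_self i)
      · rw [hb'le i le_rfl, hb'k]
        exact hcb
      · simp only [hb', not_le.2 h4, not_le.2 (h4.trans (Nat.lt_succ_self i)), if_false]
        push_cast
        linarith
    · rw [hb'le 0 (Nat.zero_le k)]
      exact hB
    · rcases Nat.lt_or_ge k i with h4 | h4
      · obtain rfl : i = k + 1 := by omega
        rw [hb'k]
        intro h5
        rw [hW] at hWc
        simp [h5] at hWc
      · rw [hb'le i h4]
        exact h1 i (by simpa [Nat.lt_succ_iff] using h4)
    · rcases Nat.lt_or_ge i k with h4 | h4
      · rw [hb'le i h4.le, hb'le (i + 1) h4]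
        exact h2 i (by simpa using h4)
      · obtain rfl : i = k := by omega
        rw [hb'le i le_rfl, hb'k]
        have h5 := mul_neg_of_neg_of_pos h3 hWc
        have h6 : σ * W ((H η).comp (X ^ 2)) (b i) * (σ * W ((H η).comp (X ^ 2)) c) =
            σ * σ * (W ((H η).comp (X ^ 2)) (b i) * W ((H η).comp (X ^ 2)) c) := by ring
        rw [h6, hσσ, one_mul] at h5
        exact h5

/-- There is a potential of degree `m + 1` and a damping of degree at most `m - 1` with `N` disjoint
sign pairs. -/
def HasSignPairs (m N : ℕ) : Prop :=
  ∃ G f : ℝ[X], G.natDegree = m + 1 ∧ 0 < G.leadingCoeff ∧ f.natDegree + 1 ≤ m ∧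
    ∃ (ι : Type) (_ : Fintype ι) (q : ι → Fin 4 → ℝ), Fintype.card ι = N ∧ SignSystem G f q

theorem HasSignPairs.hGe {m N : ℕ} (h : HasSignPairs m N) : HGe (m - 1) m N := by
  obtain ⟨G, f, hG, -, hf, ι, _, q, rfl, hq⟩ := h
  refine hq.hGe (by omega) ((natDegree_derivative_le G).trans (by omega))

/-- The end points of the lifts of a family of sign pairs under `x ↦ x ^ 2 - A`, together with `m`
symmetric outer sign pairs. -/
noncomputable def liftEnds {ι : Type} (q : ι → Fin 4 → ℝ) (A : ℝ) (b : ℕ → ℝ) (m : ℕ) :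
    (ι ⊕ ι) ⊕ Fin m → Fin 4 → ℝ
  | .inl (.inl i) => ![√(q i 0 + A), √(q i 1 + A), √(q i 2 + A), √(q i 3 + A)]
  | .inl (.inr i) => ![-√(q i 3 + A), -√(q i 2 + A), -√(q i 1 + A), -√(q i 0 + A)]
  | .inr i => ![-b (i + 1), -b i, b i, b (i + 1)]

theorem mem_Ioo_of_mem_Ioo_sqrt {u v A x : ℝ} (hx : x ∈ Set.Ioo √(u + A) √(v + A)) : x ^ 2 - A ∈ Set.Ioo u v := by
  have h0 : 0 ≤ x := (Real.sqrt_nonneg _).trans hx.1.le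
  constructor
  · have := (Real.sqrt_lt' ((Real.sqrt_nonneg _).trans_lt hx.1)).1 hx.1
    linarith
  · have := (Real.lt_sqrt h0).1 hx.2
    linarith

theorem disjoint_Ioo_sqrt {u v u' v' A : ℝ} (h : Disjoint (Set.Ioo u v) (Set.Ioo u' v')) :
    Disjoint (Set.Ioo √(u + A) √(v + A)) (Set.Ioo √(u' + A) √(v' + A)) :=
  Set.disjoint_left.2 fun _ hx hx' => Set.disjoint_left.1 h (mem_Ioo_of_mem_Ioo_sqrt hx)
    (mem_Ioo_of_mem_Ioo_sqrt hx')

theorem disjoint_Ioo_neg {u v u' v' : ℝ} (h : Disjoint (Set.Ioo u v) (Set.Ioo u' v')) :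
    Disjoint (Set.Ioo (-v) (-u)) (Set.Ioo (-v') (-u')) :=
  Set.disjoint_left.2 fun x hx hx' => Set.disjoint_left.1 h
    (show -x ∈ Set.Ioo u v from ⟨by linarith [hx.2], by linarith [hx.1]⟩) ⟨by linarith [hx'.2], by linarith [hx'.1]⟩

theorem disjoint_Ioo_of_le {u v u' v' : ℝ} (h : v ≤ u') :
    Disjoint (Set.Ioo u v) (Set.Ioo u' v') :=
  Set.disjoint_left.2 fun _ hx hx' => absurd (hx.2.trans_le h) (not_lt.2 hx'.1.le)

theorem SignSystem.lift {ι : Type} [Finite ι] {G f : ℝ[X]} {q : ι → Fin 4 → ℝ}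
    (h : SignSystem G f q) (hd : 0 < G.natDegree) (hl : 0 < G.leadingCoeff) (m : ℕ) :
    ∃ A : ℝ, ∃ h : ℝ[X], h.natDegree ≤ m ∧ ∃ b : ℕ → ℝ,
      SignSystem (G.comp (X ^ 2 - C A)) (2 * X * f.comp (X ^ 2 - C A) + h.comp (X ^ 2))
        (liftEnds q A b m) := by
  obtain ⟨A, hA⟩ : ∃ A : ℝ, ∀ i, -A < q i 0 := by
    obtain ⟨A, hA⟩ := (Set.finite_range fun i => -q i 0).bddAbove
    exact ⟨A + 1, fun i => by linarith [hA ⟨i, rfl⟩]⟩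
  obtain ⟨M, hM⟩ : ∃ M : ℝ, ∀ i, √(q i 3 + A) ≤ M := by
    obtain ⟨M, hM⟩ := (Set.finite_range fun i => √(q i 3 + A)).bddAbove
    exact ⟨M, fun i => hM ⟨i, rfl⟩⟩
  set G' := G.comp (X ^ 2 - C A) with hG'
  set f' := 2 * X * f.comp (X ^ 2 - C A) with hf'
  have heven : G'.comp (-X) = G' := by simp [hG', comp_assoc]
  have hodd : f'.comp (-X) = -f' := by simp [hf', comp_assoc]
  have hquad : (X ^ 2 - C A : ℝ[X]).natDegree = 2 := natDegree_X_pow_sub_C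
  have hdeg : G'.natDegree = G.natDegree * 2 := by rw [hG', natDegree_comp, hquad]
  have hlead : 0 < G'.leadingCoeff := by
    rw [hG', leadingCoeff_comp (by rw [hquad]; norm_num), leadingCoeff_X_pow_sub_C two_pos]
    simpa using hl
  obtain ⟨B, hB0, hBd, hBb⟩ := exists_confining heven (by omega) hlead
  obtain ⟨k, hk, b, hb, hbB, -, halt⟩ := exists_alternating heven (by omega) hlead (max B M) m
  have hin : ∀ i, SignPair G' f' √(q i 0 + A) √(q i 1 + A) √(q i 2 + A) √(q i 3 + A) :=
    fun i => (h.pair i).comp_sq (hA i)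
  have hneg : ∀ i, SignPair G' f' (-√(q i 3 + A)) (-√(q i 2 + A)) (-√(q i 1 + A))
      (-√(q i 0 + A)) := fun i => by
    have := (hin i).comp_neg.neg
    rwa [heven, hodd, neg_neg] at this
  have hev : ∀ᶠ δ in 𝓝 (0 : ℝ), ∀ i,
      SignPair G' (f' + C δ * k.comp (X ^ 2)) √(q i 0 + A) √(q i 1 + A) √(q i 2 + A) √(q i 3 + A) ∧
      SignPair G' (f' + C δ * k.comp (X ^ 2)) (-√(q i 3 + A)) (-√(q i 2 + A)) (-√(q i 1 + A))
        (-√(q i 0 + A)) :=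
    eventually_all.2 fun i => ((hin i).eventually_add _).and ((hneg i).eventually_add _)
  obtain ⟨δ, hδ, hδ0⟩ := ((hev.filter_mono (nhdsWithin_le_nhds (s := Set.Ioi 0))).and
    self_mem_nhdsWithin).exists
  have hδ0 : 0 < δ := hδ0
  have hBle : ∀ i, B < b i := fun i =>
    ((le_max_left _ _).trans_lt hbB).trans_le (hb.monotone (Nat.zero_le i))
  have hMle : ∀ i, M < b i := fun i =>
    ((le_max_right _ _).trans_lt hbB).trans_le (hb.monotone (Nat.zero_le i))
  refine ⟨A, C δ * k, (natDegree_C_mul_le _ _).trans hk, b, ?_⟩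
  rw [mul_comp, C_comp]
  have hbM : ∀ i j, √(q i 3 + A) ≤ b j := fun i j => (hM i).trans (hMle j).le
  have hdl : ∀ i j, i ≠ j → Disjoint (Set.Ioo √(q i 0 + A) √(q i 1 + A))
      (Set.Ioo √(q j 0 + A) √(q j 1 + A)) := fun i j hij =>
    disjoint_Ioo_sqrt (h.disjoint_left i j hij)
  have hdr : ∀ i j, i ≠ j → Disjoint (Set.Ioo √(q i 2 + A) √(q i 3 + A))
      (Set.Ioo √(q j 2 + A) √(q j 3 + A)) := fun i j hij =>
    disjoint_Ioo_sqrt (h.disjoint_right i j hij)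
  have hdb : ∀ i j : Fin m, i ≠ j → Disjoint (Set.Ioo (b i) (b (i + 1)))
      (Set.Ioo (b j) (b (j + 1))) := fun i j hij => by
    rcases lt_or_gt_of_ne (Fin.val_ne_of_ne hij) with h1 | h1
    · exact disjoint_Ioo_of_le (hb.monotone h1)
    · exact (disjoint_Ioo_of_le (hb.monotone h1)).symm
  have hsq : ∀ i j, 0 ≤ √(q i j + A) := fun i j => Real.sqrt_nonneg _
  refine ⟨?_, ?_, ?_⟩
  · rintro ((i | i) | i)
    · exact (hδ i).1
    · exact (hδ i).2
    · have hi : b i < b (i + 1) := hb (Nat.lt_succ_self i)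
      refine ⟨neg_lt_neg hi, show -b i < b i by linarith [hBle i], hi, eval_neg_of_even heven _,
        eval_neg_of_even heven _, fun x hx => ?_, fun x hx => ?_, fun x hx => ?_, ?_⟩
      · simp only [liftEnds] at hx ⊢
        exact (hBb (b i) (hBle i).le x hx).trans_eq (eval_neg_of_even heven _).symm
      · have h1 := hBd (-x) (by
          have := hx.2
          simp only [liftEnds, Matrix.cons_val] at this
          linarith [hBle i])
        have h2 : (derivative G').eval x = -(derivative G').eval (-x) := by
          conv_lhs => rw [← heven]
          simp [derivative_comp]
        linarith
      · exact hBd x ((hBle i).le.trans hx.1)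
      · have h1 := halt i i.2
        simp only [liftEnds, Matrix.cons_val]
        rw [work_add, work_add, work_C_mul, work_C_mul, work_eq_zero_of_odd heven hodd,
          work_eq_zero_of_odd heven hodd, zero_add, zero_add]
        have := mul_neg_of_pos_of_neg (mul_pos hδ0 hδ0) h1
        linarith
  · rintro ((i | i) | i) ((j | j) | j) hij
    · exact hdl i j (by simpa using hij)
    · refine (disjoint_Ioo_of_le ?_).symm
      exact (neg_nonpos.2 (hsq j 2)).trans (hsq i 0)
    · refine (disjoint_Ioo_of_le ?_).symm
      exact (neg_nonpos.2 (hB0.le.trans (hBle j).le)).trans (hsq i 0)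
    · refine disjoint_Ioo_of_le ?_
      exact (neg_nonpos.2 (hsq i 2)).trans (hsq j 0)
    · exact disjoint_Ioo_neg (hdr i j (by simpa using hij))
    · refine (disjoint_Ioo_of_le ?_).symm
      exact neg_le_neg (hbM i j)
    · refine disjoint_Ioo_of_le ?_
      exact (neg_nonpos.2 (hB0.le.trans (hBle i).le)).trans (hsq j 0)
    · refine disjoint_Ioo_of_le ?_
      exact neg_le_neg (hbM j i)
    · exact disjoint_Ioo_neg (hdb i j (by simpa using hij))
  · rintro ((i | i) | i) ((j | j) | j) hij
    · exact hdr i j (by simpa using hij)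
    · refine (disjoint_Ioo_of_le ?_).symm
      exact (neg_nonpos.2 (hsq j 0)).trans (hsq i 2)
    · exact disjoint_Ioo_of_le (hbM i j)
    · refine disjoint_Ioo_of_le ?_
      exact (neg_nonpos.2 (hsq i 0)).trans (hsq j 2)
    · exact disjoint_Ioo_neg (hdl i j (by simpa using hij))
    · refine disjoint_Ioo_of_le ?_
      exact (neg_nonpos.2 (hsq i 0)).trans (hB0.le.trans (hBle j).le)
    · exact (disjoint_Ioo_of_le (hbM j i)).symm
    · refine (disjoint_Ioo_of_le ?_).symm
      exact (neg_nonpos.2 (hsq j 0)).trans (hB0.le.trans (hBle i).le)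
    · exact hdb i j (by simpa using hij)

theorem HasSignPairs.succ {m N : ℕ} (h : HasSignPairs m N) :
    HasSignPairs (2 * m + 1) (2 * N + m) := by
  obtain ⟨G, f, hG, hl, hf, ι, _, q, rfl, hq⟩ := h
  obtain ⟨A, k, hk, b, hs⟩ := hq.lift (by omega) hl m
  have hquad : (X ^ 2 - C A : ℝ[X]).natDegree = 2 := natDegree_X_pow_sub_C
  refine ⟨_, _, ?_, ?_, ?_, _, inferInstance, _, ?_, hs⟩
  · rw [natDegree_comp, hquad, hG]
    ring
  · rw [leadingCoeff_comp (by rw [hquad]; norm_num), leadingCoeff_X_pow_sub_C two_pos]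
    simpa using hl
  · have h1 : (2 * X * f.comp (X ^ 2 - C A)).natDegree ≤ 2 * m := by
      refine natDegree_mul_le.trans ?_
      have h2 : (2 * X : ℝ[X]).natDegree ≤ 1 := by
        exact (natDegree_C_mul_le (2 : ℝ) _).trans natDegree_X_le
      rw [natDegree_comp, hquad]
      omega
    have h3 : (k.comp (X ^ 2)).natDegree ≤ 2 * m := by
      rw [natDegree_comp, natDegree_X_pow]
      omega
    exact Nat.succ_le_succ (natDegree_add_le_of_degree_le h1 h3)
  · simp
    ring

/-- The quartic hump `x ^ 2 * (1 + 2 * κ * x - x ^ 2)`; minus it is an asymmetric double well. -/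
def hump (κ x : ℝ) : ℝ := x ^ 2 * (1 + 2 * κ * x - x ^ 2)

/-- The negative root of `1 + 2 * κ * x - x ^ 2`. -/
noncomputable def rootL (κ : ℝ) : ℝ := κ - √(1 + κ ^ 2)

/-- The positive root of `1 + 2 * κ * x - x ^ 2`. -/
noncomputable def rootR (κ : ℝ) : ℝ := κ + √(1 + κ ^ 2)

theorem abs_lt_sqrt_one_add_sq (κ : ℝ) : |κ| < √(1 + κ ^ 2) :=
  Real.lt_sqrt_of_sq_lt (by rw [sq_abs]; linarith)

theorem rootL_neg (κ : ℝ) : rootL κ < 0 := by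
  have := (abs_lt.1 (abs_lt_sqrt_one_add_sq κ)).2
  rw [rootL]; linarith

theorem rootR_pos (κ : ℝ) : 0 < rootR κ := by
  have := (abs_lt.1 (abs_lt_sqrt_one_add_sq κ)).1
  rw [rootR]; linarith

theorem rootL_le_rootR (κ : ℝ) : rootL κ ≤ rootR κ := ((rootL_neg κ).trans (rootR_pos κ)).le

theorem rootL_eq (κ : ℝ) : rootL κ = -rootR (-κ) := by
  simp [rootL, rootR]; ring

theorem hump_neg (κ x : ℝ) : hump κ (-x) = hump (-κ) x := by
  simp only [hump]; ring

theorem factor_eq (κ x : ℝ) : 1 + 2 * κ * x - x ^ 2 = (x - rootL κ) * (rootR κ - x) := by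
  have := Real.sq_sqrt (show (0 : ℝ) ≤ 1 + κ ^ 2 by positivity)
  simp only [rootL, rootR]
  linear_combination -this

theorem hump_eq (κ x : ℝ) : hump κ x = x ^ 2 * ((x - rootL κ) * (rootR κ - x)) := by
  rw [hump, factor_eq]

theorem factor_pos {κ x : ℝ} (hx : x ∈ Set.Ioo (rootL κ) (rootR κ)) :
    0 < 1 + 2 * κ * x - x ^ 2 := by
  rw [factor_eq]
  exact mul_pos (sub_pos.2 hx.1) (sub_pos.2 hx.2)

theorem factor_nonneg {κ x : ℝ} (hx : x ∈ Set.Icc (rootL κ) (rootR κ)) :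
    0 ≤ 1 + 2 * κ * x - x ^ 2 := by
  rw [factor_eq]
  exact mul_nonneg (sub_nonneg.2 hx.1) (sub_nonneg.2 hx.2)

theorem hump_nonneg {κ x : ℝ} (hx : x ∈ Set.Icc (rootL κ) (rootR κ)) : 0 ≤ hump κ x :=
  mul_nonneg (sq_nonneg x) (factor_nonneg hx)

theorem hump_nonpos {κ x : ℝ} (hx : x ∉ Set.Ioo (rootL κ) (rootR κ)) : hump κ x ≤ 0 := by
  have h0 := rootL_le_rootR κ
  rw [hump_eq]
  refine mul_nonpos_of_nonneg_of_nonpos (sq_nonneg x) ?_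
  rcases le_or_gt x (rootL κ) with h | h
  · exact mul_nonpos_of_nonpos_of_nonneg (by linarith) (by linarith)
  · have h1 : rootR κ ≤ x := not_lt.1 fun h2 => hx ⟨h, h2⟩
    exact mul_nonpos_of_nonneg_of_nonpos (by linarith) (by linarith)

theorem hump_le_of_rootR_le {κ x : ℝ} (hx : rootR κ ≤ x) :
    hump κ x ≤ -(rootR κ ^ 2 * (rootR κ - rootL κ)) * (x - rootR κ) := by
  have h0 := rootR_pos κ
  have h1 := rootL_neg κ
  rw [hump_eq]
  have h2 : rootR κ ^ 2 * (rootR κ - rootL κ) ≤ x ^ 2 * (x - rootL κ) :=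
    mul_le_mul (pow_le_pow_left₀ h0.le hx 2) (by linarith) (by linarith) (by positivity)
  nlinarith [mul_le_mul_of_nonneg_right h2 (sub_nonneg.2 hx)]

theorem hump_rootR (κ : ℝ) : hump κ (rootR κ) = 0 := by rw [hump_eq]; ring

theorem hump_rootL (κ : ℝ) : hump κ (rootL κ) = 0 := by rw [hump_eq]; ring

theorem hasDerivAt_hump (κ x : ℝ) :
    HasDerivAt (hump κ) (2 * x * (1 + 3 * κ * x - 2 * x ^ 2)) x := by
  have h : HasDerivAt (fun x : ℝ => x ^ 2 * (1 + 2 * κ * x - x ^ 2)) _ x :=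
    (hasDerivAt_pow 2 x).mul
      ((((hasDerivAt_id x).const_mul (2 * κ)).const_add 1).sub (hasDerivAt_pow 2 x))
  refine h.congr_deriv ?_
  simp
  ring

theorem continuous_hump (κ : ℝ) : Continuous (hump κ) := by
  unfold hump; fun_prop

theorem hump_deriv_neg {κ x : ℝ} (hx : rootR κ ≤ x) :
    2 * x * (1 + 3 * κ * x - 2 * x ^ 2) < 0 := by
  have h0 := rootR_pos κ
  have h1 := rootL_neg κ
  have h2 : 1 + 2 * κ * x - x ^ 2 ≤ 0 := by
    rw [factor_eq]
    exact mul_nonpos_of_nonneg_of_nonpos (by linarith) (by linarith)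
  have h3 : κ < x := by
    have : 0 < √(1 + κ ^ 2) := (abs_nonneg κ).trans_lt (abs_lt_sqrt_one_add_sq κ)
    rw [rootR] at hx
    linarith
  nlinarith [mul_pos (h0.trans_le hx) (sub_pos.2 h3)]

theorem hump_deriv_pos {κ x : ℝ} (hx : x ≤ rootL κ) :
    0 < 2 * x * (1 + 3 * κ * x - 2 * x ^ 2) := by
  have := hump_deriv_neg (κ := -κ) (x := -x) (by rw [rootL_eq] at hx; linarith)
  linarith

theorem hump_strictAntiOn (κ : ℝ) : StrictAntiOn (hump κ) (Set.Ici (rootR κ)) := by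
  refine strictAntiOn_of_deriv_neg (convex_Ici _) (continuous_hump κ).continuousOn fun x hx => ?_
  rw [(hasDerivAt_hump κ x).deriv]
  exact hump_deriv_neg (interior_subset hx)

theorem hump_strictMonoOn (κ : ℝ) : StrictMonoOn (hump κ) (Set.Iic (rootL κ)) := by
  refine strictMonoOn_of_deriv_pos (convex_Iic _) (continuous_hump κ).continuousOn fun x hx => ?_
  rw [(hasDerivAt_hump κ x).deriv]
  exact hump_deriv_pos (Set.mem_Iic.1 (interior_subset hx))

theorem hump_lt_of_le_abs {κ S x : ℝ} (hκ : |κ| ≤ 3) (hS : 0 ≤ S) (hx : 7 + S ≤ |x|) :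
    hump κ x < -S := by
  have h1 : κ * x ≤ 3 * |x| := (le_abs_self _).trans (by
    rw [abs_mul]; exact mul_le_mul_of_nonneg_right hκ (abs_nonneg x))
  have h2 : x ^ 2 = |x| ^ 2 := (sq_abs x).symm
  have h3 : 1 + 2 * κ * x - x ^ 2 ≤ 1 - |x| * (1 + S) := by nlinarith
  have h4 : 1 - |x| * (1 + S) ≤ -S - 1 := by nlinarith
  have h5 : (1 : ℝ) ≤ x ^ 2 := by nlinarith
  rw [hump]
  nlinarith

/-- The integral of `f` against the square root of the part of the hump above the level `-s`. -/
noncomputable def mass (κ : ℝ) (f : ℝ → ℝ) (u v s : ℝ) : ℝ :=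
  ∫ x in u..v, f x * √(s + hump κ x)

theorem continuous_mass_integrand (κ : ℝ) {f : ℝ → ℝ} (hf : Continuous f) (s : ℝ) :
    Continuous fun x => f x * √(s + hump κ x) :=
  hf.mul (continuous_const.add (continuous_hump κ)).sqrt

theorem intervalIntegrable_mass (κ : ℝ) {f : ℝ → ℝ} (hf : Continuous f) (s u v : ℝ) :
    IntervalIntegrable (fun x => f x * √(s + hump κ x)) MeasureTheory.volume u v :=
  (continuous_mass_integrand κ hf s).intervalIntegrable u v

theorem mass_add (κ : ℝ) {f g : ℝ → ℝ} (hf : Continuous f) (hg : Continuous g) (u v s : ℝ) :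
    mass κ (fun x => f x + g x) u v s = mass κ f u v s + mass κ g u v s := by
  simp only [mass, add_mul]
  exact intervalIntegral.integral_add (intervalIntegrable_mass κ hf s u v)
    (intervalIntegrable_mass κ hg s u v)

theorem mass_const_mul (κ : ℝ) (f : ℝ → ℝ) (c u v s : ℝ) :
    mass κ (fun x => c * f x) u v s = c * mass κ f u v s := by
  simp only [mass, mul_assoc]
  exact intervalIntegral.integral_const_mul _ _

theorem mass_add_adjacent (κ : ℝ) {f : ℝ → ℝ} (hf : Continuous f) (u v w s : ℝ) :
    mass κ f u v s + mass κ f v w s = mass κ f u w s :=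
  intervalIntegral.integral_add_adjacent_intervals (intervalIntegrable_mass κ hf s u v)
    (intervalIntegrable_mass κ hf s v w)

theorem mass_eq_zero {κ : ℝ} {f : ℝ → ℝ} {u v s : ℝ} (huv : u ≤ v)
    (h : ∀ x ∈ Set.Icc u v, s + hump κ x ≤ 0) : mass κ f u v s = 0 := by
  rw [mass, intervalIntegral.integral_congr (g := fun _ => 0)]
  · simp
  · intro x hx
    rw [Set.uIcc_of_le huv] at hx
    simp [Real.sqrt_eq_zero_of_nonpos (h x hx)]

theorem mass_neg (κ : ℝ) (f : ℝ → ℝ) (u v s : ℝ) :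
    mass κ f (-v) (-u) s = mass (-κ) (fun x => f (-x)) u v s := by
  simp only [mass, ← hump_neg]
  exact (intervalIntegral.integral_comp_neg (fun x => f x * √(s + hump κ x))).symm

/-- The part of the mass beyond the right root is of order `s ^ (3 / 2)` times the size of `f`. -/
theorem abs_mass_right_le {κ : ℝ} {f : ℝ → ℝ} (hf : Continuous f) {s K F : ℝ} (hs : 0 ≤ s)
    (hF : 0 ≤ F) (hK : rootR κ + s / (rootR κ ^ 2 * (rootR κ - rootL κ)) ≤ K)
    (h : ∀ x ∈ Set.Icc (rootR κ) K, 0 ≤ s + hump κ x → |f x| ≤ F) :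
    |mass κ f (rootR κ) K s| ≤ F * √s * (s / (rootR κ ^ 2 * (rootR κ - rootL κ))) := by
  set d := rootR κ ^ 2 * (rootR κ - rootL κ) with hd
  have h0 := rootR_pos κ
  have h1 := rootL_neg κ
  have hd0 : 0 < d := mul_pos (pow_pos h0 2) (by linarith)
  have hsd : 0 ≤ s / d := div_nonneg hs hd0.le
  rw [← mass_add_adjacent κ hf _ (rootR κ + s / d), mass_eq_zero hK, add_zero]
  · have : ∀ x ∈ Set.uIoc (rootR κ) (rootR κ + s / d), ‖f x * √(s + hump κ x)‖ ≤ F * √s := by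
      intro x hx
      rw [Set.uIoc_of_le (by linarith)] at hx
      rw [Real.norm_eq_abs, abs_mul, abs_of_nonneg (Real.sqrt_nonneg _)]
      rcases lt_or_ge (s + hump κ x) 0 with h2 | h2
      · rw [Real.sqrt_eq_zero_of_nonpos h2.le, mul_zero]
        positivity
      · refine mul_le_mul (h x ⟨hx.1.le, hx.2.trans hK⟩ h2) (Real.sqrt_le_sqrt ?_)
          (Real.sqrt_nonneg _) hF
        have := hump_le_of_rootR_le hx.1.le
        nlinarith [mul_nonneg hd0.le (sub_nonneg.2 hx.1.le)]
    have h3 := intervalIntegral.norm_integral_le_of_norm_le_const this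
    rwa [add_sub_cancel_left, abs_of_nonneg hsd, Real.norm_eq_abs] at h3
  · intro x hx
    have h2 := hump_le_of_rootR_le (κ := κ) (x := x) (by linarith [hx.1])
    rw [← hd] at h2
    have h3 : s ≤ d * (x - rootR κ) := by
      have := mul_le_mul_of_nonneg_left (show s / d ≤ x - rootR κ by linarith [hx.1]) hd0.le
      rwa [mul_div_cancel₀ _ hd0.ne'] at this
    linarith

/-- The parts of the mass beyond the roots are of order `s ^ (3 / 2)` times the size of `f`. -/
theorem exists_tail_bound (κ : ℝ) {K : ℝ} (hL : -K < rootL κ) (hR : rootR κ < K) :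
    ∃ C : ℝ, 0 < C ∧ ∀ᶠ s in 𝓝[>] (0 : ℝ), ∀ f : ℝ → ℝ, Continuous f → ∀ F : ℝ, 0 ≤ F →
      (∀ x ∈ Set.Icc (-K) K, x ∉ Set.Ioo (rootL κ) (rootR κ) → 0 ≤ s + hump κ x → |f x| ≤ F) →
      |mass κ f (-K) K s - mass κ f (rootL κ) (rootR κ) s| ≤ C * F * √s * s := by
  have key : ∀ κ, rootR κ < K → ∀ᶠ s in 𝓝[>] (0 : ℝ),
      rootR κ + s / (rootR κ ^ 2 * (rootR κ - rootL κ)) ≤ K := fun κ hκ => by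
    have h1 : Tendsto (fun s => rootR κ + s / (rootR κ ^ 2 * (rootR κ - rootL κ))) (𝓝[>] 0)
        (𝓝 (rootR κ + 0 / (rootR κ ^ 2 * (rootR κ - rootL κ)))) :=
      Tendsto.mono_left (Continuous.tendsto (by fun_prop) 0) nhdsWithin_le_nhds
    rw [zero_div, add_zero] at h1
    filter_upwards [h1.eventually (gt_mem_nhds hκ)] with s hs using hs.le
  have hpos : ∀ κ, 0 < rootR κ ^ 2 * (rootR κ - rootL κ) := fun κ =>
    mul_pos (pow_pos (rootR_pos κ) 2) (by linarith [rootR_pos κ, rootL_neg κ])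
  refine ⟨1 / (rootR κ ^ 2 * (rootR κ - rootL κ)) +
    1 / (rootR (-κ) ^ 2 * (rootR (-κ) - rootL (-κ))), add_pos (one_div_pos.2 (hpos κ))
      (one_div_pos.2 (hpos (-κ))), ?_⟩
  rw [rootL_eq] at hL
  filter_upwards [key κ hR, key (-κ) (by linarith), self_mem_nhdsWithin] with s h1 h2 hs f hf F hF h
  have hs : 0 < s := hs
  have h3 := abs_mass_right_le hf hs.le hF h1 fun x hx hx' =>
    h x ⟨by linarith [hx.1, rootR_pos κ, rootR_pos (-κ)], hx.2⟩ (fun hh => by linarith [hh.2, hx.1]) hx'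
  have h4 := abs_mass_right_le (κ := -κ) (f := fun x => f (-x)) (by fun_prop) hs.le hF h2
    fun x hx hx' => h (-x) ⟨by linarith [hx.2], by linarith [hx.1, rootR_pos κ, rootR_pos (-κ)]⟩
      (fun hh => by have := hh.1; rw [rootL_eq] at this; linarith [hx.1]) (by rwa [hump_neg])
  have h5 : mass κ f (-K) K s - mass κ f (rootL κ) (rootR κ) s =
      mass κ f (rootR κ) K s + mass (-κ) (fun x => f (-x)) (rootR (-κ)) K s := by
    rw [← mass_neg, ← mass_add_adjacent κ hf (-K) (rootL κ) K,
      ← mass_add_adjacent κ hf (rootL κ) (rootR κ) K, rootL_eq]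
    ring
  rw [h5]
  refine (abs_add_le _ _).trans ((add_le_add h3 h4).trans_eq ?_)
  ring

theorem sqrt_hump (κ x : ℝ) : √(hump κ x) = |x| * √(1 + 2 * κ * x - x ^ 2) := by
  rw [hump, Real.sqrt_mul (sq_nonneg x), Real.sqrt_sq_eq_abs]

/-- The sum of the square roots of the heights above the levels `-s` and `0`. -/
noncomputable def gap (κ s x : ℝ) : ℝ := √(s + hump κ x) + √(hump κ x)

theorem continuous_gap (κ s : ℝ) : Continuous (gap κ s) :=
  (continuous_const.add (continuous_hump κ)).sqrt.add (continuous_hump κ).sqrt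

theorem sqrt_le_gap {κ s x : ℝ} (hx : x ∈ Set.Icc (rootL κ) (rootR κ)) : √s ≤ gap κ s x :=
  (Real.sqrt_le_sqrt (by linarith [hump_nonneg hx])).trans
    (le_add_of_nonneg_right (Real.sqrt_nonneg _))

theorem gap_pos {κ s x : ℝ} (hs : 0 < s) (hx : x ∈ Set.Icc (rootL κ) (rootR κ)) :
    0 < gap κ s x := (Real.sqrt_pos.2 hs).trans_le (sqrt_le_gap hx)

theorem sqrt_sub_sqrt_eq {κ s x : ℝ} (hs : 0 < s) (hx : x ∈ Set.Icc (rootL κ) (rootR κ)) :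
    √(s + hump κ x) - √(hump κ x) = s / gap κ s x := by
  rw [eq_div_iff (gap_pos hs hx).ne', gap]
  have h1 := Real.sq_sqrt (hump_nonneg hx)
  have h2 := Real.sq_sqrt (show 0 ≤ s + hump κ x by linarith [hump_nonneg hx])
  linear_combination h2 - h1

theorem intervalIntegrable_div_gap {κ s : ℝ} (hs : 0 < s) {f : ℝ → ℝ} (hf : Continuous f) (n : ℕ) :
    IntervalIntegrable (fun x => f x / gap κ s x ^ n) MeasureTheory.volume (rootL κ) (rootR κ) := by
  refine ContinuousOn.intervalIntegrable ?_
  rw [Set.uIcc_of_le (rootL_le_rootR κ)]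
  exact hf.continuousOn.div ((continuous_gap κ s).pow n).continuousOn fun x hx =>
    (pow_pos (gap_pos hs hx) n).ne'

theorem mass_inner_sub {κ s : ℝ} (hs : 0 < s) {f : ℝ → ℝ} (hf : Continuous f) :
    mass κ f (rootL κ) (rootR κ) s - mass κ f (rootL κ) (rootR κ) 0 =
      s * ∫ x in (rootL κ)..(rootR κ), f x / gap κ s x := by
  rw [mass, mass, ← intervalIntegral.integral_sub (intervalIntegrable_mass κ hf _ _ _)
    (intervalIntegrable_mass κ hf _ _ _), ← intervalIntegral.integral_const_mul]
  refine intervalIntegral.integral_congr fun x hx => ?_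
  rw [Set.uIcc_of_le (rootL_le_rootR κ)] at hx
  have := sqrt_sub_sqrt_eq hs hx
  simp only [zero_add]
  rw [← mul_sub, this]
  ring

theorem mass_zero_eq {κ : ℝ} {f : ℝ → ℝ} (hf : Continuous f) {K : ℝ} (hL : -K < rootL κ)
    (hR : rootR κ < K) : mass κ f (-K) K 0 = mass κ f (rootL κ) (rootR κ) 0 := by
  rw [← mass_add_adjacent κ hf (-K) (rootL κ) K, ← mass_add_adjacent κ hf (rootL κ) (rootR κ) K,
    mass_eq_zero hL.le, mass_eq_zero hR.le, zero_add, add_zero]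
  · intro x hx
    have := (hump_strictAntiOn κ).antitoneOn (Set.mem_Ici.2 le_rfl) (Set.mem_Ici.2 hx.1) hx.1
    rw [hump_rootR] at this
    linarith
  · intro x hx
    have := (hump_strictMonoOn κ).monotoneOn (Set.mem_Iic.2 hx.2) (Set.mem_Iic.2 le_rfl) hx.2
    rw [hump_rootL] at this
    linarith

/-- The angle variable on the hump. -/
noncomputable def angle (κ x : ℝ) : ℝ := Real.arcsin ((x - κ) / √(1 + κ ^ 2))

theorem continuous_angle (κ : ℝ) : Continuous (angle κ) :=
  Real.continuous_arcsin.comp (by fun_prop)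

theorem hasDerivAt_angle {κ x : ℝ} (hx : x ∈ Set.Ioo (rootL κ) (rootR κ)) :
    HasDerivAt (angle κ) (1 / √(1 + 2 * κ * x - x ^ 2)) x := by
  set ρ := √(1 + κ ^ 2) with hρ
  have hρ0 : 0 < ρ := Real.sqrt_pos.2 (by positivity)
  have hρ2 : ρ ^ 2 = 1 + κ ^ 2 := Real.sq_sqrt (by positivity)
  have h1 : (x - κ) / ρ ≠ -1 := fun h => by
    rw [div_eq_iff hρ0.ne'] at h
    have := hx.1
    rw [rootL] at this
    linarith
  have h2 : (x - κ) / ρ ≠ 1 := fun h => by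
    rw [div_eq_iff hρ0.ne'] at h
    have := hx.2
    rw [rootR] at this
    linarith
  have h3 := (Real.hasDerivAt_arcsin h1 h2).comp x (((hasDerivAt_id x).sub_const κ).div_const ρ)
  refine h3.congr_deriv ?_
  have h4 : 1 + 2 * κ * x - x ^ 2 = ρ ^ 2 * (1 - ((x - κ) / ρ) ^ 2) := by
    field_simp
    linear_combination -hρ2
  rw [h4, Real.sqrt_mul (sq_nonneg ρ), Real.sqrt_sq hρ0.le, div_mul_div_comm, one_mul, mul_comm]

theorem angle_rootL (κ : ℝ) : angle κ (rootL κ) = -(Real.pi / 2) := by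
  have : 0 < √(1 + κ ^ 2) := Real.sqrt_pos.2 (by positivity)
  rw [angle, rootL, sub_sub_cancel_left, neg_div, div_self this.ne', Real.arcsin_neg_one]

theorem angle_rootR (κ : ℝ) : angle κ (rootR κ) = Real.pi / 2 := by
  have : 0 < √(1 + κ ^ 2) := Real.sqrt_pos.2 (by positivity)
  rw [angle, rootR, add_sub_cancel_left, div_self this.ne', Real.arcsin_one]

theorem angle_zero (κ : ℝ) : angle κ 0 = -Real.arctan κ := by
  rw [angle, Real.arctan_eq_arcsin, zero_sub, neg_div, Real.arcsin_neg]

theorem intervalIntegrable_rsqrt (κ : ℝ) : IntervalIntegrable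
    (fun x => 1 / √(1 + 2 * κ * x - x ^ 2)) MeasureTheory.volume (rootL κ) (rootR κ) := by
  rw [intervalIntegrable_iff_integrableOn_Ioc_of_le (rootL_le_rootR κ)]
  exact intervalIntegral.integrableOn_deriv_of_nonneg (continuous_angle κ).continuousOn
    (fun x hx => hasDerivAt_angle hx) fun x _ => by positivity

theorem abs_div_gap_le {κ s x : ℝ} (hx : x ∈ Set.Ioo (rootL κ) (rootR κ)) :
    |x| / gap κ s x ≤ 1 / √(1 + 2 * κ * x - x ^ 2) := by
  have hq : 0 < √(1 + 2 * κ * x - x ^ 2) := Real.sqrt_pos.2 (factor_pos hx)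
  rcases eq_or_ne x 0 with rfl | h0
  · simp
  · have h1 : |x| * √(1 + 2 * κ * x - x ^ 2) ≤ gap κ s x := by
      rw [← sqrt_hump]
      exact le_add_of_nonneg_left (Real.sqrt_nonneg _)
    have h2 : 0 < |x| := abs_pos.2 h0
    rw [div_le_div_iff₀ ((mul_pos h2 hq).trans_le h1) hq, one_mul]
    exact h1

/-- Integrals against the reciprocal gap of functions that vanish at `0` are bounded. -/
theorem exists_integral_div_gap_le (κ : ℝ) : ∃ C : ℝ, 0 < C ∧ ∀ s : ℝ, ∀ (g : ℝ → ℝ) (A : ℝ),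
    0 ≤ A → (∀ x ∈ Set.Ioo (rootL κ) (rootR κ), |g x| ≤ A * |x|) →
    |∫ x in (rootL κ)..(rootR κ), g x / gap κ s x| ≤ A * C := by
  refine ⟨|∫ x in (rootL κ)..(rootR κ), 1 / √(1 + 2 * κ * x - x ^ 2)| + 1, by positivity,
    fun s g A hA hg => ?_⟩
  have h := intervalIntegral.norm_integral_le_of_norm_le (rootL_le_rootR κ)
    (f := fun x => g x / gap κ s x) (g := fun x => A * (1 / √(1 + 2 * κ * x - x ^ 2)))
    (μ := MeasureTheory.volume) ?_ ((intervalIntegrable_rsqrt κ).const_mul A)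
  · rw [intervalIntegral.integral_const_mul] at h
    rw [← Real.norm_eq_abs]
    refine h.trans (mul_le_mul_of_nonneg_left ?_ hA)
    linarith [le_abs_self (∫ x in (rootL κ)..(rootR κ), 1 / √(1 + 2 * κ * x - x ^ 2))]
  · have hae : ∀ᵐ x ∂MeasureTheory.volume, x ≠ rootR κ := by
      simp [MeasureTheory.ae_iff]
    filter_upwards [hae] with x hne hx
    have hx' : x ∈ Set.Ioo (rootL κ) (rootR κ) := ⟨hx.1, lt_of_le_of_ne hx.2 hne⟩
    have h0 : 0 ≤ gap κ s x := add_nonneg (Real.sqrt_nonneg _) (Real.sqrt_nonneg _)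
    rw [Real.norm_eq_abs, abs_div, abs_of_nonneg h0]
    calc |g x| / gap κ s x ≤ A * |x| / gap κ s x := div_le_div_of_nonneg_right (hg x hx') h0
      _ = A * (|x| / gap κ s x) := by ring
      _ ≤ _ := mul_le_mul_of_nonneg_left (abs_div_gap_le hx') hA

/-- The integral that carries the logarithmic divergence at the saddle. -/
noncomputable def logInt (κ s : ℝ) : ℝ :=
  ∫ x in (rootL κ)..(rootR κ), √(hump κ x) / gap κ s x ^ 2

theorem sqrt_mul_logInt_le {κ s : ℝ} (hs : 0 < s) :
    √s * logInt κ s ≤ rootR κ - rootL κ := by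
  rw [logInt, ← intervalIntegral.integral_const_mul]
  have := intervalIntegral.integral_mono_on (rootL_le_rootR κ)
    ((intervalIntegrable_div_gap hs (continuous_hump κ).sqrt 2).const_mul √s)
    (intervalIntegrable_const (c := (1 : ℝ))) fun x hx => ?_
  · simpa using this
  · have h1 := gap_pos hs hx
    have h2 := sqrt_le_gap (s := s) hx
    have h3 : √(hump κ x) ≤ gap κ s x := le_add_of_nonneg_left (Real.sqrt_nonneg _)
    rw [← mul_div_assoc, div_le_one (by positivity), sq]
    exact mul_le_mul h2 h3 (Real.sqrt_nonneg _) h1.le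

theorem logInt_nonneg (κ s : ℝ) : 0 ≤ logInt κ s :=
  intervalIntegral.integral_nonneg (rootL_le_rootR κ) fun x _ => by positivity

theorem tendsto_logInt {κ : ℝ} (h1 : 1 ≤ κ) (h3 : κ ≤ 3) :
    Tendsto (logInt κ) (𝓝[>] 0) atTop := by
  have hlog : Tendsto (fun s : ℝ => 1 / 36 * (-Real.log s / 2)) (𝓝[>] 0) atTop := by
    refine Tendsto.const_mul_atTop (by norm_num) (Tendsto.atTop_div_const two_pos ?_)
    exact tendsto_neg_atBot_atTop.comp Real.tendsto_log_nhdsGT_zero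
  refine tendsto_atTop_mono' _ ?_ hlog
  filter_upwards [Ioo_mem_nhdsGT (show (0 : ℝ) < 1 by norm_num)] with s hs
  have hs0 := Real.sqrt_pos.2 hs.1
  have hs1 : √s < 1 := (Real.sqrt_lt' one_pos).2 (by simpa using hs.2)
  have hR : 1 ≤ rootR κ := h1.trans (le_add_of_nonneg_right (Real.sqrt_nonneg _))
  have hL := rootL_neg κ
  have hInt : IntervalIntegrable (fun x => √(hump κ x) / gap κ s x ^ 2) MeasureTheory.volume
      (rootL κ) (rootR κ) := intervalIntegrable_div_gap hs.1 (continuous_hump κ).sqrt 2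
  have hmono : ∫ x in (√s)..1, √(hump κ x) / gap κ s x ^ 2 ≤ logInt κ s :=
    intervalIntegral.integral_mono_interval (hL.le.trans hs0.le) hs1.le hR
      (Eventually.of_forall fun x => by positivity) hInt
  refine le_trans ?_ hmono
  have hval : ∫ x in (√s)..1, 1 / 36 * x⁻¹ = 1 / 36 * (-Real.log s / 2) := by
    rw [intervalIntegral.integral_const_mul, integral_inv_of_pos hs0 one_pos, one_div (√s),
      Real.log_inv, Real.log_sqrt hs.1.le]
    ring
  rw [← hval]
  refine intervalIntegral.integral_mono_on hs1.le ?_ (hInt.mono_set ?_) fun x hx => ?_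
  · refine ContinuousOn.intervalIntegrable (continuousOn_const.mul (continuousOn_inv₀.mono ?_))
    intro x hx
    rw [Set.uIcc_of_le hs1.le] at hx
    exact (hs0.trans_le hx.1).ne'
  · rw [Set.uIcc_of_le hs1.le, Set.uIcc_of_le (rootL_le_rootR κ)]
    exact Set.Icc_subset_Icc (hL.le.trans hs0.le) hR
  · have hx0 : 0 < x := hs0.trans_le hx.1
    have hsx : s ≤ x ^ 2 := (Real.sqrt_le_left hx0.le).1 hx.1
    have hP₁ : x ^ 2 ≤ hump κ x := by
      rw [hump]
      nlinarith [mul_nonneg (sq_nonneg x) (mul_nonneg hx0.le (show 0 ≤ 2 * κ - x by linarith [hx.2]))]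
    have hP₂ : hump κ x ≤ 7 * x ^ 2 := by
      rw [hump]
      have : κ * x ≤ 3 := by nlinarith [hx.2]
      nlinarith [mul_nonneg (sq_nonneg x) (show 0 ≤ 3 - κ * x by linarith), sq_nonneg (x * x)]
    have hy₀ : x ≤ √(hump κ x) := Real.le_sqrt_of_sq_le hP₁
    have hy₁ : √(hump κ x) ≤ 3 * x := by
      rw [Real.sqrt_le_left (by linarith)]
      nlinarith
    have hy₂ : √(s + hump κ x) ≤ 3 * x := by
      rw [Real.sqrt_le_left (by linarith)]
      nlinarith
    have hg : gap κ s x ≤ 6 * x := by rw [gap]; linarith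
    have hg0 : 0 < gap κ s x := by
      have := Real.sqrt_nonneg (s + hump κ x)
      rw [gap]; linarith
    rw [le_div_iff₀ (by positivity)]
    calc 1 / 36 * x⁻¹ * gap κ s x ^ 2 ≤ 1 / 36 * x⁻¹ * (6 * x) ^ 2 := by gcongr
      _ = x := by field_simp; norm_num
      _ ≤ _ := hy₀

theorem exists_mass_sub_le (κ : ℝ) {f : ℝ → ℝ} (hf : Continuous f) {K : ℝ} (hL : -K < rootL κ)
    (hR : rootR κ < K) : ∃ C : ℝ, 0 < C ∧ ∀ᶠ s in 𝓝[>] (0 : ℝ),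
      |mass κ f (-K) K s - mass κ f (-K) K 0 - s * ∫ x in (rootL κ)..(rootR κ), f x / gap κ s x| ≤
        C * √s * s := by
  obtain ⟨C, hC, hev⟩ := exists_tail_bound κ hL hR
  obtain ⟨F, hF⟩ := (isCompact_Icc.image (s := Set.Icc (-K) K) hf.abs).bddAbove
  refine ⟨C * (|F| + 1), by positivity, ?_⟩
  filter_upwards [hev, self_mem_nhdsWithin] with s h1 hs
  rw [mass_zero_eq hf hL hR, ← mass_inner_sub hs hf, sub_sub, add_sub_cancel]
  exact h1 f hf (|F| + 1) (by positivity) fun x hx _ _ =>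
    (hF ⟨x, hx, rfl⟩).trans (by linarith [le_abs_self F])

theorem tendsto_gap (κ x : ℝ) : Tendsto (fun s => gap κ s x) (𝓝[>] 0) (𝓝 (gap κ 0 x)) := by
  have : Continuous fun s => gap κ s x := by
    unfold gap; fun_prop
  exact (this.tendsto 0).mono_left nhdsWithin_le_nhds

theorem gap_zero (κ x : ℝ) : gap κ 0 x = 2 * (|x| * √(1 + 2 * κ * x - x ^ 2)) := by
  rw [gap, zero_add, sqrt_hump]; ring

theorem ae_ne (c : ℝ) : ∀ᵐ x ∂(MeasureTheory.volume : MeasureTheory.Measure ℝ), x ≠ c := by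
  simp [MeasureTheory.ae_iff]

theorem exists_abs_sub_le (κ c : ℝ) : ∃ A : ℝ, 0 < A ∧ ∀ x ∈ Set.Ioo (rootL κ) (rootR κ),
    |x * (c - x)| ≤ A * |x| := by
  refine ⟨|c| + |rootL κ| + |rootR κ| + 1, by positivity, fun x hx => ?_⟩
  rw [abs_mul, mul_comm]
  refine mul_le_mul_of_nonneg_right ?_ (abs_nonneg x)
  rw [abs_le]
  constructor <;> linarith [hx.1, hx.2, neg_abs_le c, le_abs_self c, neg_abs_le (rootL κ),
    le_abs_self (rootR κ), abs_nonneg (rootL κ), abs_nonneg (rootR κ)]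

theorem norm_div_gap_le {κ s x A : ℝ} {g : ℝ → ℝ} (hx : x ∈ Set.Ioo (rootL κ) (rootR κ))
    (hA : 0 ≤ A) (hg : |g x| ≤ A * |x|) :
    ‖g x / gap κ s x‖ ≤ A * (1 / √(1 + 2 * κ * x - x ^ 2)) := by
  have h0 : 0 ≤ gap κ s x := add_nonneg (Real.sqrt_nonneg _) (Real.sqrt_nonneg _)
  rw [Real.norm_eq_abs, abs_div, abs_of_nonneg h0]
  calc |g x| / gap κ s x ≤ A * |x| / gap κ s x := div_le_div_of_nonneg_right hg h0
    _ = A * (|x| / gap κ s x) := by ring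
    _ ≤ _ := mul_le_mul_of_nonneg_left (abs_div_gap_le hx) hA

theorem integral_div_gap_zero (κ c : ℝ) :
    ∫ x in (rootL κ)..(rootR κ), x * (c - x) / gap κ 0 x = (c - κ) * Real.arctan κ - 1 := by
  obtain ⟨A, hA, hbd⟩ := exists_abs_sub_le κ c
  have hInt : IntervalIntegrable (fun x => x * (c - x) / gap κ 0 x) MeasureTheory.volume
      (rootL κ) (rootR κ) := by
    refine ((intervalIntegrable_rsqrt κ).const_mul A).mono_fun ?_ ?_
    · have := (continuous_gap κ 0).measurable
      exact (Measurable.aestronglyMeasurable (by fun_prop))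
    · rw [Set.uIoc_of_le (rootL_le_rootR κ), Filter.EventuallyLE,
        MeasureTheory.ae_restrict_iff' measurableSet_Ioc]
      filter_upwards [ae_ne (rootR κ)] with x hne hx
      have hx' : x ∈ Set.Ioo (rootL κ) (rootR κ) := ⟨hx.1, lt_of_le_of_ne hx.2 hne⟩
      exact (norm_div_gap_le (g := fun x => x * (c - x)) hx' hA.le (hbd x hx')).trans
        (le_abs_self _)
  have hL := rootL_neg κ
  have hR := rootR_pos κ
  have hInt₁ : IntervalIntegrable (fun x => x * (c - x) / gap κ 0 x) MeasureTheory.volume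
      (rootL κ) 0 := hInt.mono_set (by
    rw [Set.uIcc_of_le hL.le, Set.uIcc_of_le (rootL_le_rootR κ)]
    exact Set.Icc_subset_Icc le_rfl hR.le)
  have hInt₂ : IntervalIntegrable (fun x => x * (c - x) / gap κ 0 x) MeasureTheory.volume
      0 (rootR κ) := hInt.mono_set (by
    rw [Set.uIcc_of_le hR.le, Set.uIcc_of_le (rootL_le_rootR κ)]
    exact Set.Icc_subset_Icc hL.le le_rfl)
  set Φ : ℝ → ℝ := fun x => ((c - κ) * angle κ x + √(1 + 2 * κ * x - x ^ 2)) / 2 with hΦ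
  have hΦc : Continuous Φ := by
    have := continuous_angle κ
    simp only [hΦ]
    fun_prop
  have hΦd : ∀ x ∈ Set.Ioo (rootL κ) (rootR κ),
      HasDerivAt Φ ((c - x) / (2 * √(1 + 2 * κ * x - x ^ 2))) x := by
    intro x hx
    have hq := factor_pos hx
    have hw := Real.sqrt_pos.2 hq
    have h1 : HasDerivAt (fun x : ℝ => 1 + 2 * κ * x - x ^ 2) (2 * κ - 2 * x) x := by
      have := (((hasDerivAt_id x).const_mul (2 * κ)).const_add 1).sub (hasDerivAt_pow 2 x)
      refine this.congr_deriv ?_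
      simp
    refine ((((hasDerivAt_angle hx).const_mul (c - κ)).add (h1.sqrt hq.ne')).div_const 2).congr_deriv
      ?_
    field_simp
    ring
  have e₂ : ∫ x in (0 : ℝ)..(rootR κ), x * (c - x) / gap κ 0 x = Φ (rootR κ) - Φ 0 := by
    refine intervalIntegral.integral_eq_sub_of_hasDerivAt_of_le hR.le hΦc.continuousOn
      (fun x hx => ?_) hInt₂
    refine (hΦd x ⟨hL.trans hx.1, hx.2⟩).congr_deriv ?_
    rw [gap_zero, abs_of_pos hx.1]
    have := hx.1.ne'
    field_simp
  have e₁ : ∫ x in (rootL κ)..0, x * (c - x) / gap κ 0 x = (-Φ) 0 - (-Φ) (rootL κ) := by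
    refine intervalIntegral.integral_eq_sub_of_hasDerivAt_of_le hL.le hΦc.neg.continuousOn
      (fun x hx => ?_) hInt₁
    refine (hΦd x ⟨hx.1, hx.2.trans hR⟩).neg.congr_deriv ?_
    rw [gap_zero, abs_of_neg hx.2]
    have := hx.2.ne
    field_simp
  rw [← intervalIntegral.integral_add_adjacent_intervals hInt₁ hInt₂, e₁, e₂]
  have q₁ : 1 + 2 * κ * rootL κ - rootL κ ^ 2 = 0 := by rw [factor_eq]; ring
  have q₂ : 1 + 2 * κ * rootR κ - rootR κ ^ 2 = 0 := by rw [factor_eq]; ring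
  simp only [hΦ, Pi.neg_apply, angle_rootL, angle_rootR, angle_zero, q₁, q₂]
  simp
  ring

theorem tendsto_mass_div (κ c : ℝ) {K : ℝ} (hL : -K < rootL κ) (hR : rootR κ < K)
    (h0 : mass κ (fun x => x * (c - x)) (-K) K 0 = 0) :
    Tendsto (fun s => mass κ (fun x => x * (c - x)) (-K) K s / s) (𝓝[>] 0)
      (𝓝 ((c - κ) * Real.arctan κ - 1)) := by
  have hf : Continuous fun x : ℝ => x * (c - x) := by fun_prop
  obtain ⟨A, hA, hbd⟩ := exists_abs_sub_le κ c
  obtain ⟨C, hC, hev⟩ := exists_mass_sub_le κ hf hL hR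
  have hlim : Tendsto (fun s => ∫ x in (rootL κ)..(rootR κ), x * (c - x) / gap κ s x) (𝓝[>] 0)
      (𝓝 ((c - κ) * Real.arctan κ - 1)) := by
    rw [← integral_div_gap_zero]
    refine intervalIntegral.tendsto_integral_filter_of_dominated_convergence
      (fun x => A * (1 / √(1 + 2 * κ * x - x ^ 2))) (Eventually.of_forall fun s => ?_)
      (Eventually.of_forall fun s => ?_) ((intervalIntegrable_rsqrt κ).const_mul A) ?_
    · have := (continuous_gap κ s).measurable
      exact (Measurable.aestronglyMeasurable (by fun_prop))
    · filter_upwards [ae_ne (rootR κ)] with x hne hx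
      rw [Set.uIoc_of_le (rootL_le_rootR κ)] at hx
      have hx' : x ∈ Set.Ioo (rootL κ) (rootR κ) := ⟨hx.1, lt_of_le_of_ne hx.2 hne⟩
      exact norm_div_gap_le (g := fun x => x * (c - x)) hx' hA.le (hbd x hx')
    · filter_upwards [ae_ne (rootR κ), ae_ne 0] with x hne hne0 hx
      rw [Set.uIoc_of_le (rootL_le_rootR κ)] at hx
      have hx' : x ∈ Set.Ioo (rootL κ) (rootR κ) := ⟨hx.1, lt_of_le_of_ne hx.2 hne⟩
      refine tendsto_const_nhds.div (tendsto_gap κ x) ?_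
      have := Real.sqrt_pos.2 (factor_pos hx')
      rw [gap_zero]
      exact (mul_pos two_pos (mul_pos (abs_pos.2 hne0) this)).ne'
  have hsqrt : Tendsto (fun s => C * √s) (𝓝[>] 0) (𝓝 0) := by
    have : Continuous fun s => C * √s := by fun_prop
    simpa using (this.tendsto 0).mono_left nhdsWithin_le_nhds
  have hdiff : Tendsto (fun s => mass κ (fun x => x * (c - x)) (-K) K s / s -
      ∫ x in (rootL κ)..(rootR κ), x * (c - x) / gap κ s x) (𝓝[>] 0) (𝓝 0) := by
    refine squeeze_zero_norm' ?_ hsqrt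
    filter_upwards [hev, self_mem_nhdsWithin] with s h1 hs
    have hs : 0 < s := hs
    rw [h0, sub_zero] at h1
    rw [Real.norm_eq_abs]
    have h2 : mass κ (fun x => x * (c - x)) (-K) K s / s -
        ∫ x in (rootL κ)..(rootR κ), x * (c - x) / gap κ s x =
        (mass κ (fun x => x * (c - x)) (-K) K s -
          s * ∫ x in (rootL κ)..(rootR κ), x * (c - x) / gap κ s x) / s := by
      field_simp
    rw [h2, abs_div, abs_of_pos hs, div_le_iff₀ hs]
    exact h1
  simpa using hdiff.add hlim

theorem tendsto_mass_div_atTop {κ : ℝ} (h1 : 1 ≤ κ) (h3 : κ ≤ 3) (d : ℝ) {K : ℝ}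
    (hL : -K < rootL κ) (hR : rootR κ < K)
    (h0 : mass κ (fun x => 1 - d * x ^ 2) (-K) K 0 = 0) :
    Tendsto (fun s => mass κ (fun x => 1 - d * x ^ 2) (-K) K s / s) (𝓝[>] 0) atTop := by
  have hf : Continuous fun x : ℝ => 1 - d * x ^ 2 := by fun_prop
  obtain ⟨C, hC, hev⟩ := exists_mass_sub_le κ hf hL hR
  obtain ⟨C₁, hC₁, hbd⟩ := exists_integral_div_gap_le κ
  set A := |d| * (|rootL κ| + |rootR κ|) with hA
  refine tendsto_atTop_mono' _ ?_ (tendsto_atTop_add_const_right _ (-(A * C₁) - C)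
    (tendsto_logInt h1 h3))
  filter_upwards [hev, Ioo_mem_nhdsGT (show (0 : ℝ) < 1 by norm_num)] with s h2 hs
  have h4 : logInt κ s ≤ ∫ x in (rootL κ)..(rootR κ), 1 / gap κ s x := by
    refine intervalIntegral.integral_mono_on (rootL_le_rootR κ)
      (intervalIntegrable_div_gap hs.1 (continuous_hump κ).sqrt 2)
      (by simpa using intervalIntegrable_div_gap hs.1 (continuous_const (y := (1 : ℝ))) 1) ?_
    intro x hx
    have hg := gap_pos hs.1 hx
    have h5 : √(hump κ x) ≤ gap κ s x := le_add_of_nonneg_left (Real.sqrt_nonneg _)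
    rw [div_le_div_iff₀ (by positivity) hg, one_mul, sq]
    exact mul_le_mul_of_nonneg_right h5 hg.le
  have h5 := hbd s (fun x => d * x ^ 2) A (by positivity) fun x hx => by
    have hx1 : |x| ≤ |rootL κ| + |rootR κ| := by
      rw [abs_le]
      constructor <;> linarith [hx.1, hx.2, neg_abs_le (rootL κ), le_abs_self (rootR κ),
        abs_nonneg (rootL κ), abs_nonneg (rootR κ)]
    rw [abs_mul, abs_pow, hA, sq, ← mul_assoc]
    exact mul_le_mul_of_nonneg_right (mul_le_mul_of_nonneg_left hx1 (abs_nonneg d)) (abs_nonneg x)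
  have h6 : ∫ x in (rootL κ)..(rootR κ), (1 - d * x ^ 2) / gap κ s x =
      (∫ x in (rootL κ)..(rootR κ), 1 / gap κ s x) -
        ∫ x in (rootL κ)..(rootR κ), d * x ^ 2 / gap κ s x := by
    simp only [sub_div]
    exact intervalIntegral.integral_sub
      (by simpa using intervalIntegrable_div_gap hs.1 (continuous_const (y := (1 : ℝ))) 1)
      (by simpa using intervalIntegrable_div_gap hs.1 (f := fun x => d * x ^ 2) (by fun_prop) 1)
  rw [h0, sub_zero] at h2
  have h7 := (abs_le.1 h2).1
  have h8 := (abs_le.1 h5).2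
  have hs1 : √s ≤ 1 := Real.sqrt_le_one.2 hs.2.le
  have h9 : C * √s * s ≤ C * s := by nlinarith [mul_pos hC hs.1]
  rw [le_div_iff₀ hs.1]
  rw [h6] at h7
  nlinarith [mul_le_mul_of_nonneg_right h4 hs.1.le, mul_le_mul_of_nonneg_right h8 hs.1.le]

theorem hasDerivAt_sqrt_pow_three (u : ℝ) : HasDerivAt (fun u : ℝ => √u ^ 3) (3 / 2 * √u) u := by
  rcases lt_trichotomy u 0 with h | rfl | h
  · have : (fun u : ℝ => √u ^ 3) =ᶠ[𝓝 u] fun _ => 0 := by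
      filter_upwards [gt_mem_nhds h] with v hv
      rw [Real.sqrt_eq_zero_of_nonpos hv.le]
      norm_num
    rw [Real.sqrt_eq_zero_of_nonpos h.le, mul_zero]
    exact (hasDerivAt_const u 0).congr_of_eventuallyEq this
  · rw [Real.sqrt_zero, mul_zero, hasDerivAt_iff_isLittleO]
    simp only [Real.sqrt_zero, sub_zero, smul_zero]
    have h0 : Tendsto (fun u : ℝ => √u) (𝓝 0) (𝓝 0) := by
      simpa using Real.continuous_sqrt.tendsto 0
    have h1 : (fun u : ℝ => √u ^ 3) =O[𝓝 0] fun u => √u * u := by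
      refine Asymptotics.isBigO_of_le _ fun u => ?_
      rcases le_total 0 u with hu | hu
      · have : √u ^ 3 = √u * u := by
          rw [pow_succ', Real.sq_sqrt hu]
        rw [this]
      · simp [Real.sqrt_eq_zero_of_nonpos hu]
    have h2 : (fun u : ℝ => √u * u) =o[𝓝 0] fun u : ℝ => 1 * u :=
      ((Asymptotics.isLittleO_one_iff ℝ).2 h0).mul_isBigO (Asymptotics.isBigO_refl _ _)
    simpa using h1.trans_isLittleO h2
  · refine ((Real.hasDerivAt_sqrt h.ne').pow 3).congr_deriv ?_
    have := Real.sqrt_pos.2 h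
    field_simp
    ring

/-- Integration by parts reduces the mass of a damping that vanishes at the saddle. -/
theorem mass_eq_of_identity {κ K s : ℝ} (hK : s + hump κ K ≤ 0) (hK' : s + hump κ (-K) ≤ 0)
    {f k dk r : ℝ → ℝ} (hk : ∀ x, HasDerivAt k (dk x) x) (hdk : Continuous dk) (hr : Continuous r)
    (h : ∀ x, f x = 3 / 2 * k x * (2 * x * (1 + 3 * κ * x - 2 * x ^ 2)) + dk x * hump κ x +
      r x * hump κ x) :
    mass κ f (-K) K s = mass κ (fun x => r x * hump κ x) (-K) K s - s * mass κ dk (-K) K s := by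
  have hkc : Continuous k := continuous_iff_continuousAt.2 fun x => (hk x).continuousAt
  have hP := continuous_hump κ
  set D : ℝ → ℝ := fun x => dk x * √(s + hump κ x) ^ 3 +
    k x * (3 / 2 * √(s + hump κ x) * (2 * x * (1 + 3 * κ * x - 2 * x ^ 2))) with hD
  have hDc : Continuous D := by
    simp only [hD]; fun_prop
  have hd : ∀ x, HasDerivAt (fun x => k x * √(s + hump κ x) ^ 3) (D x) x := fun x =>
    (hk x).mul ((hasDerivAt_sqrt_pow_three _).comp x ((hasDerivAt_hump κ x).const_add s))
  have h0 : ∫ x in (-K)..K, D x = 0 := by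
    rw [intervalIntegral.integral_eq_sub_of_hasDerivAt (fun x _ => hd x)
      (hDc.intervalIntegrable _ _), Real.sqrt_eq_zero_of_nonpos hK, Real.sqrt_eq_zero_of_nonpos hK']
    norm_num
  have h1 : mass κ f (-K) K s = ∫ x in (-K)..K, (D x + r x * hump κ x * √(s + hump κ x) -
      s * (dk x * √(s + hump κ x))) := by
    refine intervalIntegral.integral_congr fun x _ => ?_
    have h2 : √(s + hump κ x) ^ 3 = (s + hump κ x) * √(s + hump κ x) := by
      rcases le_total 0 (s + hump κ x) with h3 | h3
      · rw [pow_succ, Real.sq_sqrt h3]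
      · rw [Real.sqrt_eq_zero_of_nonpos h3]; ring
    simp only [hD, h x, h2]
    ring
  rw [h1, intervalIntegral.integral_sub, intervalIntegral.integral_add, h0, zero_add,
    intervalIntegral.integral_const_mul]
  · rfl
  all_goals exact Continuous.intervalIntegrable (by fun_prop) _ _

theorem exists_reduction (κ c : ℝ) : ∃ k dk r : ℝ → ℝ, (∀ x, HasDerivAt k (dk x) x) ∧
    Continuous dk ∧ Continuous r ∧ r 0 = -1 - 3 * κ * c ∧ dk 0 = 0 ∧
    (∃ A : ℝ, 0 < A ∧ ∀ x ∈ Set.Icc (rootL κ) (rootR κ), |dk x| ≤ A * |x| ∧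
      |r x - r 0| ≤ A * |x|) ∧
    ∀ x, x * (c - x) = 3 / 2 * k x * (2 * x * (1 + 3 * κ * x - 2 * x ^ 2)) + dk x * hump κ x +
      r x * hump κ x := by
  set r₀ := -1 - 3 * κ * c with hr₀
  set k₀ := c / 3 with hk₀
  set k₃ := (6 * κ * k₀ - (2 * κ ^ 2 + 1) * r₀) / (3 * (1 + κ ^ 2)) with hk₃
  set k₂ := -κ * k₃ - 2 * k₀ + 2 / 3 * κ * r₀ with hk₂
  set r₁ := 6 * k₀ - 5 * k₂ - 2 * κ * r₀ with hr₁
  set r₂ := -9 * k₃ with hr₂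
  have hk : 3 * (1 + κ ^ 2) * k₃ = 6 * κ * k₀ - (2 * κ ^ 2 + 1) * r₀ := by
    rw [hk₃]
    field_simp
  clear_value r₂ r₁ k₂ k₃ k₀ r₀
  refine ⟨fun x => k₀ + k₂ * x ^ 2 + k₃ * x ^ 3, fun x => 2 * k₂ * x + 3 * k₃ * x ^ 2,
    fun x => r₀ + r₁ * x + r₂ * x ^ 2, fun x => ?_, by fun_prop, by fun_prop, by simp, by simp, ?_,
    fun x => ?_⟩
  · refine ((((hasDerivAt_pow 2 x).const_mul k₂).const_add k₀).add
      ((hasDerivAt_pow 3 x).const_mul k₃)).congr_deriv ?_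
    simp
    ring
  · obtain ⟨B, hB⟩ := (isCompact_Icc.image (s := Set.Icc (rootL κ) (rootR κ))
      (f := fun x => |2 * k₂ + 3 * k₃ * x| + |r₁ + r₂ * x|) (by fun_prop)).bddAbove
    refine ⟨|B| + 1, by positivity, fun x hx => ?_⟩
    have h1 : |2 * k₂ + 3 * k₃ * x| + |r₁ + r₂ * x| ≤ B := hB ⟨x, hx, rfl⟩
    have h2 := le_abs_self B
    simp only
    constructor
    · rw [show 2 * k₂ * x + 3 * k₃ * x ^ 2 = (2 * k₂ + 3 * k₃ * x) * x by ring, abs_mul]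
      refine mul_le_mul_of_nonneg_right ?_ (abs_nonneg x)
      linarith [abs_nonneg (r₁ + r₂ * x)]
    · rw [show r₀ + r₁ * x + r₂ * x ^ 2 - (r₀ + r₁ * 0 + r₂ * 0 ^ 2) = (r₁ + r₂ * x) * x by ring,
        abs_mul]
      refine mul_le_mul_of_nonneg_right ?_ (abs_nonneg x)
      linarith [abs_nonneg (2 * k₂ + 3 * k₃ * x)]
  · simp only [hump, hr₂, hr₁]
    have hc : c = 3 * k₀ := by rw [hk₀]; ring
    have hr : r₀ = -1 - 9 * κ * k₀ := by rw [hr₀, hc]; ring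
    rw [hk₂, hc]
    linear_combination x ^ 4 * hk + (-x ^ 2) * hr

set_option maxHeartbeats 1000000 in
/-- At a doubly degenerate parameter the mass is positive for small positive levels. -/
theorem eventually_mass_pos {κ c : ℝ} (h1 : 1 ≤ κ) (h3 : κ ≤ 3) (hc : 0 ≤ c) {K : ℝ}
    (hL : -K < rootL κ) (hR : rootR κ < K)
    (h0 : mass κ (fun x => x * (c - x)) (-K) K 0 = 0) (hdeg : (c - κ) * Real.arctan κ - 1 = 0) :
    ∀ᶠ s in 𝓝[>] (0 : ℝ), 0 < mass κ (fun x => x * (c - x)) (-K) K s := by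
  obtain ⟨k, dk, r, hk, hdk, hr, hr0, hdk0, ⟨A, hA, hbd⟩, hid⟩ := exists_reduction κ c
  have hP := continuous_hump κ
  obtain ⟨C₁, hC₁, hgap⟩ := exists_integral_div_gap_le κ
  obtain ⟨C₂, hC₂, htail⟩ := exists_tail_bound κ hL hR
  obtain ⟨C₃, hC₃, hdkm⟩ := exists_mass_sub_le κ hdk hL hR
  obtain ⟨R, hRb⟩ := (isCompact_Icc.image (s := Set.Icc (-K) K) hr.abs).bddAbove
  have hKneg : ∀ x, x = K ∨ x = -K → ∀ᶠ s in 𝓝[>] (0 : ℝ), s + hump κ x ≤ 0 := by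
    rintro x (rfl | rfl)
    · have h2 := hump_strictAntiOn κ (Set.mem_Ici.2 le_rfl) (Set.mem_Ici.2 hR.le) hR
      rw [hump_rootR] at h2
      filter_upwards [Ioo_mem_nhdsGT (neg_pos.2 h2)] with s hs
      linarith [hs.2]
    · have h2 := hump_strictMonoOn κ (Set.mem_Iic.2 hL.le) (Set.mem_Iic.2 le_rfl) hL
      rw [hump_rootL] at h2
      filter_upwards [Ioo_mem_nhdsGT (neg_pos.2 h2)] with s hs
      linarith [hs.2]
  have hslope := tendsto_mass_div κ c hL hR h0
  rw [hdeg] at hslope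
  set m₀ := mass κ dk (-K) K 0 with hm₀
  set M := fun s => mass κ (fun x => x * (c - x)) (-K) K s with hM
  set J := ∫ x in (rootL κ)..(rootR κ), r x * √(hump κ x) with hJ
  -- second order expansion
  obtain ⟨B, hB, hexp⟩ : ∃ B : ℝ, 0 < B ∧ ∀ᶠ s in 𝓝[>] (0 : ℝ),
      |M s - s * (J / 2 - m₀) - s ^ 2 * (-r 0 / 2 * logInt κ s)| ≤ B * s ^ 2 := by
    refine ⟨C₂ * (|R| + 1) + A * C₁ + A * C₁ + C₃, by positivity, ?_⟩
    have hrP : mass κ (fun x => r x * hump κ x) (rootL κ) (rootR κ) 0 = 0 := by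
      have hneg : ∀ x, x = K ∨ x = -K → 0 + hump κ x ≤ 0 := fun x hx => by
        obtain ⟨s, hs, hs0⟩ := ((hKneg x hx).and self_mem_nhdsWithin).exists
        have : 0 < s := hs0
        linarith
      have h2 := mass_eq_of_identity (hneg K (.inl rfl)) (hneg (-K) (.inr rfl)) hk hdk hr hid
      rw [h0, mass_zero_eq (by fun_prop) hL hR] at h2
      linarith
    filter_upwards [hKneg K (.inl rfl), hKneg (-K) (.inr rfl), htail, hdkm,
      Ioo_mem_nhdsGT (show (0 : ℝ) < 1 by norm_num)] with s hs₁ hs₂ hs₃ hs₄ hs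
    have hs0 := hs.1
    have hsq : √s ≤ 1 := Real.sqrt_le_one.2 hs.2.le
    have e₁ := mass_eq_of_identity hs₁ hs₂ hk hdk hr hid
    have e₂ := hs₃ (fun x => r x * hump κ x) (by fun_prop) ((|R| + 1) * s) (by positivity)
      fun x hx hx' hsx => by
        have h2 : hump κ x ≤ 0 := hump_nonpos hx'
        rw [abs_mul, abs_of_nonpos h2]
        refine mul_le_mul ?_ (by linarith) (by linarith) (by positivity)
        exact (hRb ⟨x, hx, rfl⟩).trans (by linarith [le_abs_self R])
    have e₃ := mass_inner_sub hs0 (κ := κ) (f := fun x => r x * hump κ x) (by fun_prop)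
    rw [hrP, sub_zero] at e₃
    have hi₀ : IntervalIntegrable (fun x => r x * √(hump κ x)) MeasureTheory.volume (rootL κ)
        (rootR κ) := Continuous.intervalIntegrable (by fun_prop) _ _
    have hi₁ := intervalIntegrable_div_gap hs0 (κ := κ) (f := fun x => r x * √(hump κ x))
      (by fun_prop) 2
    have hi₂ := intervalIntegrable_div_gap hs0 (κ := κ) (f := fun x => √(hump κ x))
      (by fun_prop) 2
    have e₄ : ∫ x in (rootL κ)..(rootR κ), r x * hump κ x / gap κ s x =
        J / 2 - s / 2 * ∫ x in (rootL κ)..(rootR κ), r x * √(hump κ x) / gap κ s x ^ 2 := by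
      rw [hJ, ← intervalIntegral.integral_const_mul, div_eq_inv_mul,
        ← intervalIntegral.integral_const_mul,
        ← intervalIntegral.integral_sub (hi₀.const_mul _) (hi₁.const_mul _)]
      refine intervalIntegral.integral_congr fun x hx => ?_
      rw [Set.uIcc_of_le (rootL_le_rootR κ)] at hx
      have hg := gap_pos hs0 hx
      have h2 := sqrt_sub_sqrt_eq hs0 hx
      rw [eq_div_iff hg.ne'] at h2
      have h4 := Real.sq_sqrt (hump_nonneg hx)
      have h5 : gap κ s x = √(s + hump κ x) + √(hump κ x) := rfl
      rw [show r x * √(hump κ x) / gap κ s x ^ 2 = r x * √(hump κ x) / (gap κ s x * gap κ s x) by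
        rw [sq], div_eq_iff hg.ne']
      have h6 : s / 2 * (r x * √(hump κ x) / (gap κ s x * gap κ s x)) * gap κ s x =
          (√(s + hump κ x) - √(hump κ x)) / 2 * (r x * √(hump κ x)) := by
        nth_rewrite 1 [← h2]
        field_simp
      rw [sub_mul, h6, h5]
      linear_combination -r x * h4
    have e₅ : ∫ x in (rootL κ)..(rootR κ), r x * √(hump κ x) / gap κ s x ^ 2 =
        r 0 * logInt κ s + ∫ x in (rootL κ)..(rootR κ),
          (r x - r 0) * √(hump κ x) / gap κ s x / gap κ s x := by
      rw [logInt, ← intervalIntegral.integral_const_mul, ← sub_eq_iff_eq_add',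
        ← intervalIntegral.integral_sub hi₁ (hi₂.const_mul _)]
      refine intervalIntegral.integral_congr fun x hx => ?_
      rw [div_div, ← sq]
      ring
    have e₆ := hgap s (fun x => (r x - r 0) * √(hump κ x) / gap κ s x) A hA.le fun x hx => by
      have hx' := Set.Ioo_subset_Icc_self hx
      have hg := gap_pos hs0 hx'
      have h5 : √(hump κ x) ≤ gap κ s x := le_add_of_nonneg_left (Real.sqrt_nonneg _)
      rw [abs_div, abs_mul, abs_of_nonneg (Real.sqrt_nonneg _), abs_of_pos hg,
        div_le_iff₀ hg]
      exact mul_le_mul (hbd x hx').2 h5 (Real.sqrt_nonneg _) (by positivity)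
    have e₇ := hgap s dk A hA.le fun x hx => (hbd x (Set.Ioo_subset_Icc_self hx)).1
    set E₁ := ∫ x in (rootL κ)..(rootR κ), (r x - r 0) * √(hump κ x) / gap κ s x / gap κ s x
    set E₂ := ∫ x in (rootL κ)..(rootR κ), dk x / gap κ s x
    set T₁ := mass κ (fun x => r x * hump κ x) (-K) K s -
      mass κ (fun x => r x * hump κ x) (rootL κ) (rootR κ) s with hT₁
    set T₂ := mass κ dk (-K) K s - m₀ - s * E₂ with hT₂
    have e₈ : M s - s * (J / 2 - m₀) - s ^ 2 * (-r 0 / 2 * logInt κ s) =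
        T₁ - s ^ 2 / 2 * E₁ - s ^ 2 * E₂ - s * T₂ := by
      have h2 : M s = _ := e₁
      rw [h2, hT₁, hT₂, e₃, e₄, e₅]
      ring
    have hs2 : 0 < s ^ 2 := by positivity
    have b₁ : |T₁| ≤ C₂ * (|R| + 1) * s ^ 2 := e₂.trans (by
      have : 0 ≤ C₂ * (|R| + 1) * s ^ 2 := by positivity
      nlinarith)
    have b₂ : |s ^ 2 / 2 * E₁| ≤ A * C₁ * s ^ 2 := by
      rw [abs_mul, abs_of_pos (by positivity)]
      nlinarith [abs_nonneg E₁]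
    have b₃ : |s ^ 2 * E₂| ≤ A * C₁ * s ^ 2 := by
      rw [abs_mul, abs_of_pos hs2]
      nlinarith [abs_nonneg E₂]
    have b₄ : |s * T₂| ≤ C₃ * s ^ 2 := by
      rw [abs_mul, abs_of_pos hs0]
      have : C₃ * √s * s ≤ C₃ * s := by nlinarith [mul_pos hC₃ hs0]
      nlinarith
    rw [e₈, abs_le]
    obtain ⟨l₁, u₁⟩ := abs_le.1 b₁
    obtain ⟨l₂, u₂⟩ := abs_le.1 b₂
    obtain ⟨l₃, u₃⟩ := abs_le.1 b₃
    obtain ⟨l₄, u₄⟩ := abs_le.1 b₄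
    constructor
    · linarith only [l₁, u₂, u₃, u₄]
    · linarith only [u₁, l₂, l₃, l₄]
  have hzero : J / 2 - m₀ = 0 := by
    have hlim : Tendsto (fun s => M s / s) (𝓝[>] 0) (𝓝 (J / 2 - m₀)) := by
      rw [tendsto_iff_norm_sub_tendsto_zero]
      have hbound : Tendsto (fun s => |r 0| * (rootR κ - rootL κ) * √s + B * s) (𝓝[>] 0) (𝓝 0) := by
        have : Continuous fun s => |r 0| * (rootR κ - rootL κ) * √s + B * s := by fun_prop
        simpa using (this.tendsto 0).mono_left nhdsWithin_le_nhds
      refine squeeze_zero' (Eventually.of_forall fun s => norm_nonneg _) ?_ hbound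
      filter_upwards [hexp, self_mem_nhdsWithin] with s hs hs0
      have hs0 : 0 < s := hs0
      have h2 := sqrt_mul_logInt_le (κ := κ) hs0
      have h4 := logInt_nonneg κ s
      have h5 : M s / s - (J / 2 - m₀) = (M s - s * (J / 2 - m₀)) / s := by
        field_simp
      rw [Real.norm_eq_abs, h5, abs_div, abs_of_pos hs0, div_le_iff₀ hs0]
      have h6 : |s ^ 2 * (-r 0 / 2 * logInt κ s)| ≤ |r 0| * (rootR κ - rootL κ) * √s * s := by
        rw [abs_mul, abs_mul, abs_of_nonneg h4, abs_of_pos (by positivity : 0 < s ^ 2), abs_div,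
          abs_neg, abs_two]
        have h7 : s * logInt κ s ≤ √s * (rootR κ - rootL κ) := by
          have := mul_le_mul_of_nonneg_left h2 (Real.sqrt_nonneg s)
          rwa [← mul_assoc, Real.mul_self_sqrt hs0.le] at this
        have h8 := mul_le_mul_of_nonneg_left h7 (mul_nonneg (abs_nonneg (r 0)) hs0.le)
        have h9 : 0 ≤ |r 0| * s * (s * logInt κ s) := by positivity
        nlinarith
      have h7 := abs_add_le (M s - s * (J / 2 - m₀) - s ^ 2 * (-r 0 / 2 * logInt κ s))
        (s ^ 2 * (-r 0 / 2 * logInt κ s))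
      rw [sub_add_cancel] at h7
      nlinarith
    exact tendsto_nhds_unique hlim hslope
  have hr0' : r 0 < 0 := by
    rw [hr0]; nlinarith
  filter_upwards [hexp, (tendsto_logInt h1 h3).eventually_gt_atTop (2 * B / -r 0),
    self_mem_nhdsWithin] with s hs hlog hs0
  have hs0 : 0 < s := hs0
  rw [hzero, mul_zero, sub_zero] at hs
  rw [div_lt_iff₀ (by linarith)] at hlog
  have := (abs_le.1 hs).1
  nlinarith [mul_pos hs0 hs0]

/-- The signed second moment of the hump. -/
noncomputable def moment₂ (κ : ℝ) : ℝ :=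
  ((1 + 5 * κ ^ 2) * (1 + κ ^ 2) * Real.arctan κ + 5 * κ ^ 3 + 13 / 3 * κ) / 4

/-- The signed third moment of the hump. -/
noncomputable def moment₃ (κ : ℝ) : ℝ :=
  (2 * (κ * (1 + κ ^ 2) * Real.arctan κ + κ ^ 2 + 2 / 3) + 7 * κ * moment₂ κ) / 5

/-- Polynomials times the root of the factor, plus a multiple of the angle, integrate the root. -/
theorem hasDerivAt_mul_sqrt_factor {κ x : ℝ} (hx : x ∈ Set.Ioo (rootL κ) (rootR κ))
    {p : ℝ → ℝ} {dp g C : ℝ} (hp : HasDerivAt p dp x)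
    (h : dp * (1 + 2 * κ * x - x ^ 2) + p x * (κ - x) + C = g * (1 + 2 * κ * x - x ^ 2)) :
    HasDerivAt (fun x => p x * √(1 + 2 * κ * x - x ^ 2) + C * angle κ x)
      (g * √(1 + 2 * κ * x - x ^ 2)) x := by
  have hq := factor_pos hx
  have h1 : HasDerivAt (fun x : ℝ => 1 + 2 * κ * x - x ^ 2) (2 * (κ - x)) x := by
    refine ((((hasDerivAt_id x).const_mul (2 * κ)).const_add 1).sub
      (hasDerivAt_pow 2 x)).congr_deriv ?_
    simp
    ring
  refine ((hp.mul (h1.sqrt hq.ne')).add ((hasDerivAt_angle hx).const_mul C)).congr_deriv ?_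
  have h2 := Real.sqrt_pos.2 hq
  have h3 := Real.sq_sqrt hq.le
  field_simp
  rw [h3]
  linear_combination h

theorem continuous_mul_sqrt_factor {κ : ℝ} {p : ℝ → ℝ} (hp : Continuous p) (C : ℝ) :
    Continuous fun x => p x * √(1 + 2 * κ * x - x ^ 2) + C * angle κ x := by
  have := continuous_angle κ
  fun_prop

theorem mass_zero_level {κ c K : ℝ} (hL : -K < rootL κ) (hR : rootR κ < K) :
    mass κ (fun x => x * (c - x)) (-K) K 0 = c * moment₂ κ - moment₃ κ := by
  have hf : Continuous fun x : ℝ => x * (c - x) := by fun_prop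
  rw [mass_zero_eq hf hL hR, ← mass_add_adjacent κ hf _ 0]
  set C₀ := (1 + κ ^ 2) / 2 with hC₀
  set C₂ := (1 + 5 * κ ^ 2) * C₀ / 4 with hC₂
  set C₃ := (2 * κ * C₀ + 7 * κ * C₂) / 5 with hC₃
  set p₀ : ℝ → ℝ := fun x => (x - κ) / 2 with hp₀
  set q : ℝ → ℝ := fun x => 1 + 2 * κ * x - x ^ 2 with hq
  set p₁ : ℝ → ℝ := fun x => κ * p₀ x - q x / 3 with hp₁
  set p₂ : ℝ → ℝ := fun x => (p₀ x + 5 * κ * p₁ x - x * q x) / 4 with hp₂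
  set p₃ : ℝ → ℝ := fun x => (2 * p₁ x + 7 * κ * p₂ x - x ^ 2 * q x) / 5 with hp₃
  set p : ℝ → ℝ := fun x => c * p₂ x - p₃ x with hp
  set C := c * C₂ - C₃ with hC
  have hpd : ∀ x, HasDerivAt p (deriv p x) x := fun x => by
    have : Differentiable ℝ p := by
      simp only [hp, hp₃, hp₂, hp₁, hq, hp₀]; fun_prop
    exact (this x).hasDerivAt
  have hpc : Continuous p := continuous_iff_continuousAt.2 fun x => (hpd x).continuousAt
  have hdp₀ : ∀ x, HasDerivAt p₀ (1 / 2) x := fun x => by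
    simpa using ((hasDerivAt_id x).sub_const κ).div_const 2
  have hdq : ∀ x, HasDerivAt q (2 * (κ - x)) x := fun x => by
    refine ((((hasDerivAt_id x).const_mul (2 * κ)).const_add 1).sub
      (hasDerivAt_pow 2 x)).congr_deriv ?_
    simp
    ring
  have hdp₁ := fun x => ((hdp₀ x).const_mul κ).sub ((hdq x).div_const 3)
  have hdp₂ := fun x => (((hdp₀ x).add ((hdp₁ x).const_mul (5 * κ))).sub
    ((hasDerivAt_id x).mul (hdq x))).div_const 4
  have hdp₃ := fun x => ((((hdp₁ x).const_mul 2).add ((hdp₂ x).const_mul (7 * κ))).sub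
    ((hasDerivAt_pow 2 x).mul (hdq x))).div_const 5
  have hdp := fun x => ((hdp₂ x).const_mul c).sub (hdp₃ x)
  have hderiv : ∀ x ∈ Set.Ioo (rootL κ) (rootR κ),
      HasDerivAt (fun x => p x * √(1 + 2 * κ * x - x ^ 2) + C * angle κ x)
        (x * (x * (c - x)) * √(1 + 2 * κ * x - x ^ 2)) x := fun x hx => by
    refine hasDerivAt_mul_sqrt_factor hx (p := p) (hdp x) ?_
    simp only [hp, hp₃, hp₂, hp₁, hq, hp₀, hC, hC₃, hC₂, hC₀, id]
    push_cast
    ring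
  have hcont := continuous_mul_sqrt_factor (κ := κ) hpc C
  have hInt : ∀ u v, IntervalIntegrable (fun x => x * (x * (c - x)) * √(1 + 2 * κ * x - x ^ 2))
      MeasureTheory.volume u v := fun u v => Continuous.intervalIntegrable (by fun_prop) _ _
  have e₁ : mass κ (fun x => x * (c - x)) 0 (rootR κ) 0 =
      ∫ x in (0 : ℝ)..(rootR κ), x * (x * (c - x)) * √(1 + 2 * κ * x - x ^ 2) := by
    refine intervalIntegral.integral_congr fun x hx => ?_
    rw [Set.uIcc_of_le (rootR_pos κ).le] at hx
    simp only [zero_add, sqrt_hump, abs_of_nonneg hx.1]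
    ring
  have e₂ : mass κ (fun x => x * (c - x)) (rootL κ) 0 0 =
      -∫ x in (rootL κ)..0, x * (x * (c - x)) * √(1 + 2 * κ * x - x ^ 2) := by
    rw [← intervalIntegral.integral_neg]
    refine intervalIntegral.integral_congr fun x hx => ?_
    rw [Set.uIcc_of_le (rootL_neg κ).le] at hx
    simp only [zero_add, sqrt_hump, abs_of_nonpos hx.2]
    ring
  have e₃ := intervalIntegral.integral_eq_sub_of_hasDerivAt_of_le (rootR_pos κ).le
    hcont.continuousOn (fun x hx => hderiv x ⟨(rootL_neg κ).trans hx.1, hx.2⟩) (hInt _ _)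
  have e₄ := intervalIntegral.integral_eq_sub_of_hasDerivAt_of_le (rootL_neg κ).le
    hcont.continuousOn (fun x hx => hderiv x ⟨hx.1, hx.2.trans (rootR_pos κ)⟩) (hInt _ _)
  have r₁ : 1 + 2 * κ * rootR κ - rootR κ ^ 2 = 0 := by rw [factor_eq]; ring
  have r₂ : 1 + 2 * κ * rootL κ - rootL κ ^ 2 = 0 := by rw [factor_eq]; ring
  rw [e₁, e₂, e₃, e₄]
  simp only [r₁, r₂, angle_rootL, angle_rootR, angle_zero, Real.sqrt_zero]
  simp only [hp, hp₃, hp₂, hp₁, hq, hp₀, hC, hC₃, hC₂, hC₀, moment₂, moment₃]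
  norm_num
  ring

theorem arctan_sqrt_three : Real.arctan √3 = Real.pi / 3 := by
  rw [← Real.tan_pi_div_three]
  exact Real.arctan_tan (by linarith [Real.pi_pos]) (by linarith [Real.pi_pos])

theorem pi_div_three_le_arctan {κ : ℝ} (h : √3 ≤ κ) : Real.pi / 3 ≤ Real.arctan κ := by
  rw [← arctan_sqrt_three]
  exact Real.arctan_mono h

theorem moment₂_pos {κ : ℝ} (h : 0 < κ) : 0 < moment₂ κ := by
  have := Real.arctan_pos.2 h
  rw [moment₂]
  positivity

/-- The zero of `x * (c - x)` for which the mass vanishes at the level of the saddle. -/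
noncomputable def balance (κ : ℝ) : ℝ := moment₃ κ / moment₂ κ

theorem mass_balance {κ K : ℝ} (h : 0 < κ) (hL : -K < rootL κ) (hR : rootR κ < K) :
    mass κ (fun x => x * (balance κ - x)) (-K) K 0 = 0 := by
  rw [mass_zero_level hL hR, balance, div_mul_cancel₀ _ (moment₂_pos h).ne', sub_self]

theorem continuous_moment₂ : Continuous moment₂ := by
  have := Real.continuous_arctan
  unfold moment₂
  fun_prop

theorem continuous_moment₃ : Continuous moment₃ := by
  have := Real.continuous_arctan
  have := continuous_moment₂
  unfold moment₃
  fun_prop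

theorem continuousAt_balance {κ : ℝ} (h : 0 < κ) : ContinuousAt balance κ :=
  continuous_moment₃.continuousAt.div continuous_moment₂.continuousAt (moment₂_pos h).ne'

/-- There is a degenerate parameter that is a limit of parameters with negative slope. -/
theorem exists_degenerate : ∃ κ : ℝ, √3 ≤ κ ∧ κ ≤ 3 ∧
    (balance κ - κ) * Real.arctan κ - 1 = 0 ∧
    ∃ᶠ κ' in 𝓝 κ, √3 ≤ κ' ∧ κ' ≤ 3 ∧ (balance κ' - κ') * Real.arctan κ' - 1 < 0 := by
  have hs : √3 < 3 := by
    rw [Real.sqrt_lt' (by norm_num)]; norm_num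
  have hs0 : 0 < √3 := by positivity
  have hs2 : √3 ^ 2 = 3 := Real.sq_sqrt (by norm_num)
  set φ : ℝ → ℝ := fun κ => (balance κ - κ) * Real.arctan κ - 1 with hφ
  have hcont : ContinuousOn φ (Set.Icc (√3) 3) := fun κ hκ =>
    (((continuousAt_balance (hs0.trans_le hκ.1)).sub continuousAt_id).mul
      Real.continuous_arctan.continuousAt |>.sub continuousAt_const).continuousWithinAt
  have hφe : ∀ κ, 0 < κ → φ κ * moment₂ κ =
      moment₃ κ * Real.arctan κ - moment₂ κ * (κ * Real.arctan κ + 1) := fun κ h => by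
    have := moment₂_pos h
    simp only [hφ, balance]
    field_simp
    ring
  have hl : φ (√3) < 0 := by
    have h1 := hφe _ hs0
    have h2 := moment₂_pos hs0
    have h3 : moment₃ √3 * Real.arctan √3 - moment₂ √3 * (√3 * Real.arctan √3 + 1) < 0 := by
      rw [moment₃, moment₂, arctan_sqrt_three]
      have h4 := Real.pi_lt_d4
      have h5 := Real.pi_gt_d4
      have h6 : √3 < 1.7321 := by rw [Real.sqrt_lt' (by norm_num)]; norm_num
      have h7 : 1.732 < √3 := by rw [Real.lt_sqrt (by norm_num)]; norm_num
      have h8 : √3 ^ 3 = 3 * √3 := by rw [pow_succ, hs2]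
      rw [h8, hs2]
      have h9 : Real.pi ^ 2 < 9.8697 := by nlinarith
      have h10 : √3 * Real.pi ^ 2 < 1.7321 * 9.8697 := by
        have := sq_nonneg Real.pi
        nlinarith
      nlinarith
    rw [← h1] at h3
    by_contra h
    exact absurd h3 (not_lt.2 (mul_nonneg (not_lt.1 h) h2.le))
  have hr : 0 < φ 3 := by
    have h1 := hφe 3 (by norm_num)
    have h2 := moment₂_pos (κ := 3) (by norm_num)
    have h3 : 0 < moment₃ 3 * Real.arctan 3 - moment₂ 3 * (3 * Real.arctan 3 + 1) := by
      have h4 := pi_div_three_le_arctan hs.le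
      have h5 := Real.pi_gt_d4
      rw [moment₃, moment₂]
      nlinarith
    rw [← h1] at h3
    exact (pos_iff_pos_of_mul_pos h3).2 h2
  set Z := Set.Icc (√3) 3 ∩ φ ⁻¹' Set.Ici 0 with hZ
  have hZc : IsClosed Z := hcont.preimage_isClosed_of_isClosed isClosed_Icc isClosed_Ici
  have hZ3 : (3 : ℝ) ∈ Z := ⟨⟨hs.le, le_rfl⟩, hr.le⟩
  have hZb : BddBelow Z := ⟨√3, fun x hx => hx.1.1⟩
  have hmem : sInf Z ∈ Z := hZc.csInf_mem ⟨3, hZ3⟩ hZb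
  have hlt : √3 < sInf Z := lt_of_le_of_ne hmem.1.1 fun h => by
    have := hmem.2
    rw [← h] at this
    exact absurd hl (not_lt.2 this)
  have hbelow : ∀ κ ∈ Set.Ico (√3) (sInf Z), φ κ < 0 := fun κ hκ => by
    by_contra h
    exact absurd (csInf_le hZb ⟨⟨hκ.1, hκ.2.le.trans hmem.1.2⟩, not_lt.1 h⟩) (not_le.2 hκ.2)
  have hfreq : ∃ᶠ κ in 𝓝[<] (sInf Z), √3 ≤ κ ∧ κ ≤ 3 ∧ φ κ < 0 := by
    refine Eventually.frequently ?_
    filter_upwards [Ioo_mem_nhdsLT hlt] with κ hκ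
    exact ⟨hκ.1.le, hκ.2.le.trans hmem.1.2, hbelow κ ⟨hκ.1.le, hκ.2⟩⟩
  refine ⟨sInf Z, hmem.1.1, hmem.1.2, le_antisymm ?_ hmem.2, hfreq.filter_mono nhdsWithin_le_nhds⟩
  have hca : ContinuousAt φ (sInf Z) :=
    ((continuousAt_balance (hs0.trans hlt)).sub continuousAt_id).mul
      Real.continuous_arctan.continuousAt |>.sub continuousAt_const
  refine le_of_tendsto (hca.tendsto.mono_left (nhdsWithin_le_nhds (s := Set.Iio (sInf Z)))) ?_
  filter_upwards [Ioo_mem_nhdsLT hlt] with κ hκ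
  exact (hbelow κ ⟨hκ.1.le, hκ.2⟩).le

/-- The positive critical point of the hump. -/
noncomputable def crest (κ : ℝ) : ℝ := (3 * κ + √(9 * κ ^ 2 + 8)) / 4

theorem abs_lt_sqrt_crest (κ : ℝ) : |3 * κ| < √(9 * κ ^ 2 + 8) :=
  Real.lt_sqrt_of_sq_lt (by rw [sq_abs]; linarith)

theorem crest_pos (κ : ℝ) : 0 < crest κ := by
  have := (abs_lt.1 (abs_lt_sqrt_crest κ)).1
  rw [crest]; linarith

theorem slope_factor_eq (κ x : ℝ) :
    1 + 3 * κ * x - 2 * x ^ 2 = 2 * (x + crest (-κ)) * (crest κ - x) := by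
  have := Real.sq_sqrt (show (0 : ℝ) ≤ 9 * κ ^ 2 + 8 by positivity)
  simp only [crest, neg_sq]
  linear_combination -this / 8

theorem slope_factor_pos {κ x : ℝ} (h0 : 0 ≤ x) (hx : x < crest κ) :
    0 < 1 + 3 * κ * x - 2 * x ^ 2 := by
  rw [slope_factor_eq]
  have := crest_pos (-κ)
  exact mul_pos (by linarith) (sub_pos.2 hx)

theorem lt_crest {κ x : ℝ} (h0 : 0 ≤ x) (h : 0 < 1 + 3 * κ * x - 2 * x ^ 2) : x < crest κ := by
  rw [slope_factor_eq] at h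
  have := crest_pos (-κ)
  exact sub_pos.1 ((pos_iff_pos_of_mul_pos h).1 (by linarith))

theorem slope_factor_neg {κ x : ℝ} (hx : crest κ < x) : 1 + 3 * κ * x - 2 * x ^ 2 < 0 := by
  rw [slope_factor_eq]
  have := crest_pos (-κ)
  have := crest_pos κ
  exact mul_neg_of_pos_of_neg (by linarith) (sub_neg.2 hx)

theorem hump_strictMonoOn_crest (κ : ℝ) : StrictMonoOn (hump κ) (Set.Icc 0 (crest κ)) := by
  refine strictMonoOn_of_deriv_pos (convex_Icc _ _) (continuous_hump κ).continuousOn fun x hx => ?_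
  rw [interior_Icc] at hx
  rw [(hasDerivAt_hump κ x).deriv]
  exact mul_pos (by linarith [hx.1]) (slope_factor_pos hx.1.le hx.2)

theorem hump_strictAntiOn_crest (κ : ℝ) : StrictAntiOn (hump κ) (Set.Ici (crest κ)) := by
  refine strictAntiOn_of_deriv_neg (convex_Ici _) (continuous_hump κ).continuousOn fun x hx => ?_
  rw [interior_Ici] at hx
  rw [(hasDerivAt_hump κ x).deriv]
  have := (crest_pos κ).trans hx
  exact mul_neg_of_pos_of_neg (by linarith) (slope_factor_neg hx)

theorem crest_lt_rootR (κ : ℝ) : crest κ < rootR κ := by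
  by_contra h
  have h1 := hump_deriv_neg (not_lt.1 h)
  rw [slope_factor_eq, sub_self] at h1
  simp at h1

theorem hump_le_crest {κ x : ℝ} (hx : 0 ≤ x) : hump κ x ≤ hump κ (crest κ) := by
  rcases le_total x (crest κ) with h | h
  · exact (hump_strictMonoOn_crest κ).monotoneOn ⟨hx, h⟩ ⟨(crest_pos κ).le, le_rfl⟩ h
  · exact (hump_strictAntiOn_crest κ).antitoneOn (Set.mem_Ici.2 le_rfl) h h

theorem continuous_mass {X : Type*} [TopologicalSpace X] [FirstCountableTopology X]
    {κ s a₀ a₁ a₂ : X → ℝ}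
    (hκ : Continuous κ) (hs : Continuous s) (h₀ : Continuous a₀) (h₁ : Continuous a₁)
    (h₂ : Continuous a₂) (u v : ℝ) :
    Continuous fun p => mass (κ p) (fun x => a₀ p + a₁ p * x + a₂ p * x ^ 2) u v (s p) := by
  unfold mass hump
  exact intervalIntegral.continuous_parametric_intervalIntegral_of_continuous' (by fun_prop) u v

theorem mass_congr {κ u v s : ℝ} {f g : ℝ → ℝ} (h : ∀ x, f x = g x) :
    mass κ f u v s = mass κ g u v s := by
  rw [funext h]

theorem mass_pos {κ u v s : ℝ} {f : ℝ → ℝ} (hf : Continuous f) (huv : u < v)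
    (h0 : ∀ x ∈ Set.Icc u v, 0 ≤ s + hump κ x → 0 ≤ f x)
    (h1 : ∃ x ∈ Set.Icc u v, 0 < s + hump κ x ∧ 0 < f x) : 0 < mass κ f u v s := by
  obtain ⟨y, hy, hy1, hy2⟩ := h1
  refine intervalIntegral.integral_pos huv (continuous_mass_integrand κ hf s).continuousOn
    (fun x hx => ?_) ⟨y, hy, mul_pos hy2 (Real.sqrt_pos.2 hy1)⟩
  rcases le_total 0 (s + hump κ x) with h | h
  · exact mul_nonneg (h0 x (Set.Ioc_subset_Icc_self hx) h) (Real.sqrt_nonneg _)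
  · rw [Real.sqrt_eq_zero_of_nonpos h, mul_zero]

theorem mass_neg_of_neg {κ u v s : ℝ} {f : ℝ → ℝ} (hf : Continuous f) (huv : u < v)
    (h0 : ∀ x ∈ Set.Icc u v, 0 ≤ s + hump κ x → f x ≤ 0)
    (h1 : ∃ x ∈ Set.Icc u v, 0 < s + hump κ x ∧ f x < 0) : mass κ f u v s < 0 := by
  have h := mass_pos (f := fun x => -1 * f x) (by fun_prop) huv
    (fun x hx hs => by linarith [h0 x hx hs])
    (by obtain ⟨y, hy, hy1, hy2⟩ := h1; exact ⟨y, hy, hy1, by linarith⟩)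
  rw [mass_const_mul] at h
  linarith

theorem rootR_lt {κ : ℝ} (h : κ ≤ 3) (h0 : 0 ≤ κ) : rootR κ < 7 := by
  have : √(1 + κ ^ 2) < 4 := by
    rw [Real.sqrt_lt' (by norm_num)]; nlinarith
  rw [rootR]; linarith

theorem lt_rootL {κ : ℝ} (h0 : 0 ≤ κ) : -1 ≤ rootL κ := by
  have : √(1 + κ ^ 2) ≤ 1 + κ := by
    rw [Real.sqrt_le_left (by linarith)]; nlinarith
  rw [rootL]; linarith

/-- For large levels the damping `x * (c - x)` is dominated by its negative part. -/
theorem mass_large_neg {κ c : ℝ} (h0 : 0 ≤ κ) (h3 : κ ≤ 3) (hc : 0 < c) (hc4 : c ≤ 4) :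
    mass κ (fun x => x * (c - x)) (-1319) 1319 1312 < 0 := by
  have hf : Continuous fun x : ℝ => x * (c - x) := by fun_prop
  have hP : ∀ x, |x| ≤ c → |hump κ x| ≤ 656 := fun x hx => by
    have hx4 := hx.trans hc4
    have hx0 := abs_nonneg x
    rw [hump, abs_mul, abs_of_nonneg (sq_nonneg x), ← sq_abs]
    have h1 : |1 + 2 * κ * x - |x| ^ 2| ≤ 41 := by
      obtain ⟨h4, h5⟩ := abs_le.1 hx4
      rw [sq_abs, abs_le]
      constructor <;> nlinarith
    calc |x| ^ 2 * |1 + 2 * κ * x - |x| ^ 2| ≤ 4 ^ 2 * 41 :=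
          mul_le_mul (pow_le_pow_left₀ hx0 hx4 2) h1 (abs_nonneg _) (by norm_num)
      _ = 656 := by norm_num
  have houter : ∀ u v, u ≤ v → (∀ x ∈ Set.Icc u v, x * (c - x) ≤ 0) →
      mass κ (fun x => x * (c - x)) u v 1312 ≤ 0 := fun u v huv h => by
    rw [← neg_nonneg, mass, ← intervalIntegral.integral_neg]
    exact intervalIntegral.integral_nonneg huv fun x hx => neg_nonneg.2
      (mul_nonpos_of_nonpos_of_nonneg (h x hx) (Real.sqrt_nonneg _))
  have e₁ : mass κ (fun x => x * (c - x)) (-1319) (-c) 1312 ≤ 0 :=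
    houter _ _ (by linarith) fun x hx => mul_nonpos_of_nonpos_of_nonneg (by linarith [hx.2])
      (by linarith [hx.2])
  have e₂ : mass κ (fun x => x * (c - x)) c 1319 1312 ≤ 0 :=
    houter _ _ (by linarith) fun x hx => mul_nonpos_of_nonneg_of_nonpos (by linarith [hx.1])
      (by linarith [hx.1])
  have e₃ : mass κ (fun x => x * (c - x)) (-c) 0 1312 ≤ ∫ x in (-c)..0, x * (c - x) * 24 := by
    refine intervalIntegral.integral_mono_on (by linarith) (intervalIntegrable_mass κ hf _ _ _)
      (Continuous.intervalIntegrable (by fun_prop) _ _) fun x hx => ?_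
    refine mul_le_mul_of_nonpos_left ?_ (mul_nonpos_of_nonpos_of_nonneg hx.2 (by linarith [hx.2]))
    have := (abs_le.1 (hP x (by rw [abs_of_nonpos hx.2]; linarith [hx.1]))).1
    exact Real.le_sqrt_of_sq_le (by linarith)
  have e₄ : mass κ (fun x => x * (c - x)) 0 c 1312 ≤ ∫ x in (0 : ℝ)..c, x * (c - x) * 48 := by
    refine intervalIntegral.integral_mono_on hc.le (intervalIntegrable_mass κ hf _ _ _)
      (Continuous.intervalIntegrable (by fun_prop) _ _) fun x hx => ?_
    refine mul_le_mul_of_nonneg_left ?_ (mul_nonneg hx.1 (by linarith [hx.2]))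
    have := (abs_le.1 (hP x (by rw [abs_of_nonneg hx.1]; linarith [hx.2]))).2
    exact Real.sqrt_le_iff.2 ⟨by norm_num, by linarith⟩
  have hd : ∀ (A x : ℝ), HasDerivAt (fun x : ℝ => A * (c * x ^ 2 / 2 - x ^ 3 / 3))
      (x * (c - x) * A) x := fun A x => by
    refine (((((hasDerivAt_pow 2 x).const_mul c).div_const 2).sub
      ((hasDerivAt_pow 3 x).div_const 3)).const_mul A).congr_deriv ?_
    push_cast
    ring
  rw [intervalIntegral.integral_eq_sub_of_hasDerivAt (fun x _ => hd 24 x)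
    (Continuous.intervalIntegrable (by fun_prop) _ _)] at e₃
  rw [intervalIntegral.integral_eq_sub_of_hasDerivAt (fun x _ => hd 48 x)
    (Continuous.intervalIntegrable (by fun_prop) _ _)] at e₄
  rw [← mass_add_adjacent κ hf _ (-c), ← mass_add_adjacent κ hf (-c) 0,
    ← mass_add_adjacent κ hf 0 c]
  have := pow_pos hc 3
  nlinarith

/-- Sign conditions on the masses of a quadratic damping at two levels in the right well and at two
outer levels. -/
structure WellSigns (x₀ t₁ t₂ s₃ κ a₀ a₁ a₂ : ℝ) : Prop where
  deep : 0 < t₁ + hump κ x₀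
  inner_neg : mass κ (fun x => a₀ + a₁ * x + a₂ * x ^ 2) 0 1319 t₁ < 0
  inner_pos : 0 < mass κ (fun x => a₀ + a₁ * x + a₂ * x ^ 2) 0 1319 t₂
  outer_pos : 0 < mass κ (fun x => a₀ + a₁ * x + a₂ * x ^ 2) (-1319) 1319 s₃
  outer_neg : mass κ (fun x => a₀ + a₁ * x + a₂ * x ^ 2) (-1319) 1319 1312 < 0

theorem isOpen_wellSigns (x₀ t₁ t₂ s₃ : ℝ) : IsOpen
    {p : ℝ × ℝ × ℝ × ℝ | WellSigns x₀ t₁ t₂ s₃ p.1 p.2.1 p.2.2.1 p.2.2.2} := by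
  have h : ∀ u v s : ℝ, Continuous fun p : ℝ × ℝ × ℝ × ℝ =>
      mass p.1 (fun x => p.2.1 + p.2.2.1 * x + p.2.2.2 * x ^ 2) u v s := fun u v s =>
    continuous_mass (s := fun _ => s) (by fun_prop) (by fun_prop) (by fun_prop) (by fun_prop)
      (by fun_prop) u v
  have hd : Continuous fun p : ℝ × ℝ × ℝ × ℝ => t₁ + hump p.1 x₀ := by
    unfold hump; fun_prop
  have h0 : Continuous fun _ : ℝ × ℝ × ℝ × ℝ => (0 : ℝ) := continuous_const
  have := (isOpen_lt h0 hd).inter ((isOpen_lt (h 0 1319 t₁) h0).inter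
    ((isOpen_lt h0 (h 0 1319 t₂)).inter ((isOpen_lt h0 (h (-1319) 1319 s₃)).inter
    (isOpen_lt (h (-1319) 1319 1312) h0))))
  convert this using 1
  ext p
  exact ⟨fun h => ⟨h.1, h.2, h.3, h.4, h.5⟩, fun h => ⟨h.1, h.2.1, h.2.2.1, h.2.2.2.1, h.2.2.2.2⟩⟩

theorem WellSigns.eventually {X : Type*} {l : Filter X} {x₀ t₁ t₂ s₃ κ a₀ a₁ a₂ : ℝ}
    (h : WellSigns x₀ t₁ t₂ s₃ κ a₀ a₁ a₂) {k b₀ b₁ b₂ : X → ℝ} (hk : Tendsto k l (𝓝 κ))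
    (h₀ : Tendsto b₀ l (𝓝 a₀)) (h₁ : Tendsto b₁ l (𝓝 a₁)) (h₂ : Tendsto b₂ l (𝓝 a₂)) :
    ∀ᶠ x in l, WellSigns x₀ t₁ t₂ s₃ (k x) (b₀ x) (b₁ x) (b₂ x) :=
  (hk.prodMk_nhds (h₀.prodMk_nhds (h₁.prodMk_nhds h₂))).eventually
    ((isOpen_wellSigns x₀ t₁ t₂ s₃).mem_nhds h)

theorem continuous_mass_level (κ : ℝ) {f : ℝ → ℝ} (hf : Continuous f) (u v : ℝ) :
    Continuous fun s => mass κ f u v s := by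
  have := continuous_hump κ
  unfold mass
  exact intervalIntegral.continuous_parametric_intervalIntegral_of_continuous' (by fun_prop) u v

theorem exists_wellSigns_of_degenerate {κ : ℝ} (h1 : √3 ≤ κ) (h3 : κ ≤ 3)
    (hdeg : (balance κ - κ) * Real.arctan κ - 1 = 0) : ∃ x₀ t₁ t₂ s₃ : ℝ, 0 < x₀ ∧ t₁ < t₂ ∧
      t₂ < 0 ∧ 0 < s₃ ∧ s₃ < 1312 ∧ WellSigns x₀ t₁ t₂ s₃ κ 0 (balance κ) (-1) := by
  have hs2 : √3 ^ 2 = 3 := Real.sq_sqrt (by norm_num)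
  have hs0 : 0 < √3 := by positivity
  have hκ0 : 0 < κ := hs0.trans_le h1
  have hκ2 : 3 ≤ κ ^ 2 := by nlinarith
  have hκ1 : 1 ≤ κ := by nlinarith
  have hL : (-1319 : ℝ) < rootL κ := by linarith [lt_rootL hκ0.le]
  have hR : rootR κ < 1319 := by linarith [rootR_lt h3 hκ0.le]
  set c := balance κ with hc
  have hθ : 1.04 ≤ Real.arctan κ := by
    linarith [pi_div_three_le_arctan h1, Real.pi_gt_d4]
  obtain ⟨e, he⟩ : ∃ e, e = c - κ := ⟨_, rfl⟩
  have hee : e * Real.arctan κ = 1 := by rw [he]; linarith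
  have he0 : 0 < e := by
    by_contra h
    nlinarith
  have he1 : e ≤ 0.97 := by nlinarith
  have hc0 : 0 < c := by linarith
  have hc4 : c ≤ 4 := by linarith
  have hf : Continuous fun x : ℝ => x * (c - x) := by fun_prop
  have hfeq : ∀ x : ℝ, 0 + c * x + -1 * x ^ 2 = x * (c - x) := fun x => by ring
  have hm0 : mass κ (fun x => x * (c - x)) (-1319) 1319 0 = 0 := mass_balance hκ0 hL hR
  have hcc : c < crest κ := by
    refine lt_crest hc0.le ?_
    have : c = κ + e := by linarith
    rw [this]
    nlinarith
  have hmono := hump_strictMonoOn_crest κ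
  have hc_mem : c ∈ Set.Icc 0 (crest κ) := ⟨hc0.le, hcc.le⟩
  have hcr_mem : crest κ ∈ Set.Icc 0 (crest κ) := ⟨(crest_pos κ).le, le_rfl⟩
  have hPc : 0 < hump κ c := by
    have := hmono ⟨le_rfl, (crest_pos κ).le⟩ hc_mem hc0
    simpa [hump] using this
  have hPcr := hmono hc_mem hcr_mem hcc
  have hcr := crest_lt_rootR κ
  have hdeep : mass κ (fun x => x * (c - x)) 0 1319 (-hump κ c) < 0 := by
    rw [← mass_add_adjacent κ hf 0 c, mass_eq_zero hc0.le fun x hx => by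
      have := hmono.monotoneOn ⟨hx.1, hx.2.trans hcc.le⟩ hc_mem hx.2
      linarith, zero_add]
    exact mass_neg_of_neg hf (by linarith)
      (fun x hx _ => mul_nonpos_of_nonneg_of_nonpos (by linarith [hx.1]) (by linarith [hx.1]))
      ⟨crest κ, ⟨hcc.le, by linarith⟩, by linarith,
        mul_neg_of_pos_of_neg (crest_pos κ) (by linarith)⟩
  have hwell : 0 < mass κ (fun x => x * (c - x)) 0 1319 0 := by
    have hL0 := rootL_neg κ
    have h4 : mass κ (fun x => x * (c - x)) (-1319) 0 0 < 0 := by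
      refine mass_neg_of_neg hf (by norm_num)
        (fun x hx _ => mul_nonpos_of_nonpos_of_nonneg hx.2 (by linarith [hx.2]))
        ⟨rootL κ / 2, ⟨by linarith, by linarith⟩, ?_,
          mul_neg_of_neg_of_pos (by linarith) (by linarith)⟩
      have h5 := factor_pos (κ := κ) (x := rootL κ / 2) ⟨by linarith, by linarith [rootR_pos κ]⟩
      rw [zero_add, hump]
      exact mul_pos (sq_pos_of_neg (by linarith)) h5
    have h5 := mass_add_adjacent κ hf (-1319) 0 1319 0
    linarith
  obtain ⟨t₂, ht₂, ht₂m⟩ : ∃ t ∈ Set.Ioo (-hump κ c) 0,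
      0 < mass κ (fun x => x * (c - x)) 0 1319 t := by
    have h4 : ∀ᶠ t in 𝓝[<] (0 : ℝ), 0 < mass κ (fun x => x * (c - x)) 0 1319 t :=
      ((continuous_mass_level κ hf 0 1319).tendsto 0).mono_left nhdsWithin_le_nhds
        |>.eventually (lt_mem_nhds hwell)
    obtain ⟨t, ht, ht'⟩ := (h4.and (Ioo_mem_nhdsLT (neg_lt_zero.2 hPc))).exists
    exact ⟨t, ht', ht⟩
  obtain ⟨s₃, hs₃, hs₃m⟩ := ((eventually_mass_pos hκ1 h3 hc0.le hL hR hm0 hdeg).and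
    (Ioo_mem_nhdsGT (show (0 : ℝ) < 1312 by norm_num))).exists
  refine ⟨crest κ, -hump κ c, t₂, s₃, crest_pos κ, ht₂.1, ht₂.2, hs₃m.1, hs₃m.2, ?_⟩
  constructor
  · linarith
  all_goals simp only [hfeq]
  · exact hdeep
  · exact ht₂m
  · exact hs₃
  · exact mass_large_neg hκ0.le h3 hc0 hc4

/-- A double well and a quadratic damping whose mass changes sign four times outside and once in the
right well. -/
theorem exists_alternating_masses : ∃ κ a₀ a₁ a₂ x₀ t₁ t₂ s₀ s₁ s₂ s₃ : ℝ, 0 ≤ κ ∧ κ ≤ 3 ∧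
    0 < x₀ ∧ t₁ < t₂ ∧ t₂ < 0 ∧ 0 < s₀ ∧ s₀ < s₁ ∧ s₁ < s₂ ∧ s₂ < s₃ ∧ s₃ < 1312 ∧
    WellSigns x₀ t₁ t₂ s₃ κ a₀ a₁ a₂ ∧
    mass κ (fun x => a₀ + a₁ * x + a₂ * x ^ 2) (-1319) 1319 s₀ < 0 ∧
    0 < mass κ (fun x => a₀ + a₁ * x + a₂ * x ^ 2) (-1319) 1319 s₁ ∧
    mass κ (fun x => a₀ + a₁ * x + a₂ * x ^ 2) (-1319) 1319 s₂ < 0 := by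
  obtain ⟨κ₀, hκ₀, hκ₀', hdeg, hfreq⟩ := exists_degenerate
  obtain ⟨x₀, t₁, t₂, s₃, hx₀, ht, ht₂, hs₃, hs₃', hw⟩ :=
    exists_wellSigns_of_degenerate hκ₀ hκ₀' hdeg
  have hs0 : 0 < √3 := by positivity
  -- move the parameter to make the slope at the saddle negative
  obtain ⟨κ, ⟨hκ, hκ', hslope⟩, hw⟩ := (hfreq.and_eventually (hw.eventually
    (continuousAt_id (x := κ₀)) tendsto_const_nhds (continuousAt_balance (hs0.trans_le hκ₀))
    tendsto_const_nhds)).exists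
  have hκ0 : 0 < κ := hs0.trans_le hκ
  have hκ1 : 1 ≤ κ := by
    have : √3 ^ 2 = 3 := Real.sq_sqrt (by norm_num)
    nlinarith
  have hL : (-1319 : ℝ) < rootL κ := by linarith [lt_rootL hκ0.le]
  have hR : rootR κ < 1319 := by linarith [rootR_lt hκ' hκ0.le]
  set c := balance κ with hc
  have hf : Continuous fun x : ℝ => x * (c - x) := by fun_prop
  have hm0 : mass κ (fun x => x * (c - x)) (-1319) 1319 0 = 0 := mass_balance hκ0 hL hR
  have hlim := tendsto_mass_div κ c hL hR hm0
  obtain ⟨s₂, ⟨hs₂, hs₂'⟩, hs₂m⟩ := ((hlim.eventually (gt_mem_nhds hslope)).and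
    (Ioo_mem_nhdsGT hs₃)).exists.imp fun s hs => (⟨⟨hs.2.1, hs.2.2⟩, hs.1⟩ :
      (0 < s ∧ s < s₃) ∧ mass κ (fun x => x * (c - x)) (-1319) 1319 s / s < 0)
  have hs₂m : mass κ (fun x => x * (c - x)) (-1319) 1319 s₂ < 0 := by
    rwa [div_lt_iff₀ hs₂, zero_mul] at hs₂m
  have hpos : ∀ f : ℝ → ℝ, Continuous f → (∀ x, 0 ≤ f x) → 0 < f (rootR κ / 2) →
      0 < mass κ f (-1319) 1319 0 := fun f hf h0 h4 => by
    refine mass_pos hf (by norm_num) (fun x _ _ => h0 x) ⟨rootR κ / 2,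
      ⟨by linarith [rootR_pos κ], by linarith [rootR_pos κ]⟩, ?_, h4⟩
    have := factor_pos (κ := κ) (x := rootR κ / 2)
      ⟨by linarith [rootR_pos κ, rootL_neg κ], by linarith [rootR_pos κ]⟩
    have h5 := rootR_pos κ
    rw [zero_add, hump]
    positivity
  have hone : 0 < mass κ (fun _ => 1) (-1319) 1319 0 :=
    hpos _ continuous_const (fun _ => zero_le_one) one_pos
  have hsq : 0 < mass κ (fun x => x ^ 2) (-1319) 1319 0 :=
    hpos _ (by fun_prop) (fun x => sq_nonneg x) (by have := rootR_pos κ; positivity)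
  set d := mass κ (fun _ => 1) (-1319) 1319 0 / mass κ (fun x => x ^ 2) (-1319) 1319 0 with hd
  have hk : Continuous fun x : ℝ => 1 - d * x ^ 2 := by fun_prop
  have hk0 : mass κ (fun x => 1 - d * x ^ 2) (-1319) 1319 0 = 0 := by
    rw [mass_congr (g := fun x => 1 + -d * x ^ 2) fun x => by ring,
      mass_add κ continuous_const (by fun_prop), mass_const_mul, hd, neg_mul,
      div_mul_cancel₀ _ hsq.ne', add_neg_cancel]
  have hkdiv := tendsto_mass_div_atTop hκ1 hκ' d hL hR hk0
  -- the masses of the perturbed dampings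
  have hsplit : ∀ τ η s, mass κ (fun x => (τ - η) + c * x + (-1 - τ * d) * x ^ 2) (-1319) 1319 s =
      mass κ (fun x => x * (c - x)) (-1319) 1319 s +
        τ * mass κ (fun x => 1 - d * x ^ 2) (-1319) 1319 s +
        -η * mass κ (fun _ => 1) (-1319) 1319 s := fun τ η s => by
    rw [← mass_const_mul, ← mass_const_mul, ← mass_add κ hf (by fun_prop),
      ← mass_add κ (by fun_prop) (by fun_prop)]
    exact mass_congr fun x => by ring
  have hτ : ∀ᶠ τ in 𝓝[>] (0 : ℝ), WellSigns x₀ t₁ t₂ s₃ κ (τ - 0) c (-1 - τ * d) := by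
    refine hw.eventually tendsto_const_nhds ?_ tendsto_const_nhds ?_
    · exact ((show Continuous fun τ : ℝ => τ - 0 by fun_prop).tendsto' 0 0 (by simp)).mono_left
        nhdsWithin_le_nhds
    · exact ((show Continuous fun τ : ℝ => -1 - τ * d by fun_prop).tendsto' 0 (-1)
        (by simp)).mono_left nhdsWithin_le_nhds
  have hτ₂ : ∀ᶠ τ in 𝓝[>] (0 : ℝ),
      mass κ (fun x => (τ - 0) + c * x + (-1 - τ * d) * x ^ 2) (-1319) 1319 s₂ < 0 := by
    refine (((show Continuous fun τ : ℝ => _ from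
      continuous_mass (κ := fun _ => κ) (s := fun _ => s₂) (a₀ := fun τ => τ - 0)
      (a₁ := fun _ => c) (a₂ := fun τ => -1 - τ * d) (by fun_prop) (by fun_prop) (by fun_prop)
      (by fun_prop) (by fun_prop) (-1319) 1319).tendsto 0).mono_left
      nhdsWithin_le_nhds).eventually (gt_mem_nhds ?_)
    simp only [hsplit]
    linarith
  obtain ⟨τ, ⟨hτw, hτm⟩, hτ0⟩ := ((hτ.and hτ₂).and self_mem_nhdsWithin).exists
  have hτ0 : 0 < τ := hτ0
  have hs₁ : ∀ᶠ s in 𝓝[>] (0 : ℝ),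
      0 < mass κ (fun x => (τ - 0) + c * x + (-1 - τ * d) * x ^ 2) (-1319) 1319 s := by
    filter_upwards [(hlim.add_atTop (hkdiv.const_mul_atTop hτ0)).eventually_gt_atTop 0,
      self_mem_nhdsWithin] with s hs hs0
    have hs0 : 0 < s := hs0
    rw [hsplit]
    rw [← mul_div_assoc, ← add_div] at hs
    have := (div_pos_iff_of_pos_right hs0).1 hs
    linarith
  obtain ⟨s₁, hs₁m, hs₁0, hs₁s⟩ := (hs₁.and (Ioo_mem_nhdsGT hs₂)).exists
  have hcη : ∀ s, Continuous fun η => mass κ (fun x => (τ - η) + c * x + (-1 - τ * d) * x ^ 2)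
      (-1319) 1319 s := fun s =>
    continuous_mass (κ := fun _ => κ) (s := fun _ => s) (a₀ := fun η => τ - η)
      (a₁ := fun _ => c) (a₂ := fun _ => -1 - τ * d) (by fun_prop) (by fun_prop) (by fun_prop)
      (by fun_prop) (by fun_prop) (-1319) 1319
  have hη : ∀ᶠ η in 𝓝[>] (0 : ℝ), WellSigns x₀ t₁ t₂ s₃ κ (τ - η) c (-1 - τ * d) :=
    hτw.eventually tendsto_const_nhds
      (((show Continuous fun η : ℝ => τ - η by fun_prop).tendsto 0).mono_left nhdsWithin_le_nhds)
      tendsto_const_nhds tendsto_const_nhds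
  obtain ⟨η, ⟨⟨hηw, hηm₁⟩, hηm₂⟩, hη0⟩ := (((hη.and
    ((((hcη s₁).tendsto 0).mono_left nhdsWithin_le_nhds).eventually (lt_mem_nhds hs₁m))).and
    ((((hcη s₂).tendsto 0).mono_left nhdsWithin_le_nhds).eventually (gt_mem_nhds hτm))).and
    self_mem_nhdsWithin).exists
  have hη0 : 0 < η := hη0
  have hm₀ : mass κ (fun x => (τ - η) + c * x + (-1 - τ * d) * x ^ 2) (-1319) 1319 0 < 0 := by
    rw [hsplit, hm0, hk0]
    nlinarith
  obtain ⟨s₀, hs₀m, hs₀0, hs₀s⟩ := ((((continuous_mass_level κ (by fun_prop) (-1319)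
    1319).tendsto 0).mono_left nhdsWithin_le_nhds |>.eventually (gt_mem_nhds hm₀)).and
    (Ioo_mem_nhdsGT hs₁0)).exists
  exact ⟨κ, τ - η, c, -1 - τ * d, x₀, t₁, t₂, s₀, s₁, s₂, s₃, hκ0.le, hκ', hx₀, ht, ht₂, hs₀0,
    hs₀s, hs₁s, hs₂', hs₃', hηw, hs₀m, hηm₁, hηm₂⟩

/-- The double well potential below the quartic hump. -/
noncomputable def quarticWell (κ : ℝ) : ℝ[X] := X ^ 4 - C (2 * κ) * X ^ 3 - X ^ 2

theorem eval_quarticWell (κ x : ℝ) : (quarticWell κ).eval x = -hump κ x := by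
  simp only [quarticWell, hump, eval_sub, eval_mul, eval_pow, eval_X, eval_C]
  ring

theorem eval_derivative_quarticWell (κ x : ℝ) :
    (derivative (quarticWell κ)).eval x = -(2 * x * (1 + 3 * κ * x - 2 * x ^ 2)) := by
  simp [quarticWell, derivative_pow]
  ring

theorem natDegree_quarticWell (κ : ℝ) : (quarticWell κ).natDegree = 4 := by
  unfold quarticWell
  compute_degree!

theorem leadingCoeff_quarticWell (κ : ℝ) : (quarticWell κ).leadingCoeff = 1 := by
  rw [leadingCoeff, natDegree_quarticWell, quarticWell, coeff_sub, coeff_sub, coeff_C_mul]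
  simp [coeff_X_pow]

theorem work_quarticWell {κ a b u v : ℝ} (f : ℝ[X]) (hua : u ≤ a) (hbv : b ≤ v)
    (ha : ∀ x ∈ Set.Icc u a, hump κ x ≤ hump κ a) (hb : ∀ x ∈ Set.Icc b v, hump κ x ≤ hump κ a) :
    work (quarticWell κ) f a b = mass κ (fun x => f.eval x) u v (-hump κ a) := by
  rw [← mass_add_adjacent κ f.continuous u a, ← mass_add_adjacent κ f.continuous a b,
    mass_eq_zero hua fun x hx => by linarith [ha x hx],
    mass_eq_zero hbv fun x hx => by linarith [hb x hx], zero_add, add_zero]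
  refine intervalIntegral.integral_congr fun x _ => ?_
  simp only [eval_quarticWell]
  congr 2
  ring

/-- Opposite masses at two outer levels give a pair of ovals around the whole hump. -/
theorem signPair_outer {κ K a a' b b' s s' : ℝ} (f : ℝ[X]) (hs : 0 < s) (hss : s < s')
    (hKa : -K ≤ a') (hKb : b' ≤ K) (ha : a < rootL κ) (hb : rootR κ < b) (ha' : a' < rootL κ)
    (hb' : rootR κ < b')
    (ea : hump κ a = -s) (eb : hump κ b = -s) (ea' : hump κ a' = -s') (eb' : hump κ b' = -s')
    (hsign : mass κ (fun x => f.eval x) (-K) K s * mass κ (fun x => f.eval x) (-K) K s' < 0) :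
    SignPair (quarticWell κ) f a' a b b' := by
  have hmono := hump_strictMonoOn κ
  have hanti := hump_strictAntiOn κ
  have haa : a' < a := (hmono.lt_iff_lt ha'.le ha.le).1 (by linarith)
  have hbb : b < b' := (hanti.lt_iff_gt hb'.le hb.le).1 (by linarith)
  have hw : ∀ {a b s}, a < rootL κ → rootR κ < b → hump κ a = -s → hump κ b = -s → -K ≤ a →
      b ≤ K → work (quarticWell κ) f a b = mass κ (fun x => f.eval x) (-K) K s := by
    intro a b s ha hb ea eb hKa hKb
    rw [work_quarticWell f hKa hKb, ea, neg_neg]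
    · exact fun x hx => hmono.monotoneOn (Set.mem_Iic.2 (hx.2.trans ha.le)) ha.le hx.2
    · intro x hx
      rw [ea, ← eb]
      exact hanti.antitoneOn hb.le (Set.mem_Ici.2 (hb.le.trans hx.1)) hx.1
  refine ⟨haa, ?_, hbb, ?_, ?_, fun x hx => ?_, fun x hx => ?_, fun x hx => ?_, ?_⟩
  · linarith [rootL_le_rootR κ]
  · rw [eval_quarticWell, eval_quarticWell, ea, eb]
  · rw [eval_quarticWell, eval_quarticWell, ea', eb']
  · rw [eval_quarticWell, eval_quarticWell, neg_lt_neg_iff]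
    rcases lt_or_ge x (rootL κ) with h | h
    · exact hmono ha.le h.le hx.1
    rcases lt_or_ge (rootR κ) x with h2 | h2
    · rw [ea, ← eb]
      exact hanti h2.le hb.le hx.2
    · linarith [hump_nonneg ⟨h, h2⟩]
  · rw [eval_derivative_quarticWell]
    linarith [hump_deriv_pos (hx.2.trans ha.le)]
  · rw [eval_derivative_quarticWell]
    linarith [hump_deriv_neg (hb.le.trans hx.1)]
  · rwa [hw ha hb ea eb (by linarith) (by linarith), hw ha' hb' ea' eb' hKa hKb]

/-- Opposite masses at two levels in the right well give a pair of ovals in this well. -/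
theorem signPair_inner {κ K u u' v v' t t' : ℝ} (f : ℝ[X]) (htt : t < t')
    (hu : u ∈ Set.Ioo 0 (crest κ)) (hu' : u' ∈ Set.Ioo 0 (crest κ)) (hv : crest κ < v)
    (hv' : crest κ < v') (hKv : v' ≤ K)
    (eu : hump κ u = -t) (ev : hump κ v = -t) (eu' : hump κ u' = -t') (ev' : hump κ v' = -t')
    (hsign : mass κ (fun x => f.eval x) 0 K t * mass κ (fun x => f.eval x) 0 K t' < 0) :
    SignPair (quarticWell κ) f u' u v v' := by
  have hmono := hump_strictMonoOn_crest κ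
  have hanti := hump_strictAntiOn_crest κ
  have huu : u' < u := (hmono.lt_iff_lt (Set.Ioo_subset_Icc_self hu')
    (Set.Ioo_subset_Icc_self hu)).1 (by linarith)
  have hvv : v < v' := (hanti.lt_iff_gt hv'.le hv.le).1 (by linarith)
  have hw : ∀ {u v t}, u ∈ Set.Ioo 0 (crest κ) → crest κ < v → hump κ u = -t → hump κ v = -t →
      v ≤ K → work (quarticWell κ) f u v = mass κ (fun x => f.eval x) 0 K t := by
    intro u v t hu hv eu ev hKv
    rw [work_quarticWell f hu.1.le hKv, eu, neg_neg]
    · exact fun x hx => hmono.monotoneOn ⟨hx.1, hx.2.trans hu.2.le⟩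
        (Set.Ioo_subset_Icc_self hu) hx.2
    · intro x hx
      rw [eu, ← ev]
      exact hanti.antitoneOn hv.le (Set.mem_Ici.2 (hv.le.trans hx.1)) hx.1
  refine ⟨huu, hu.2.trans hv, hvv, ?_, ?_, fun x hx => ?_, fun x hx => ?_, fun x hx => ?_, ?_⟩
  · rw [eval_quarticWell, eval_quarticWell, eu, ev]
  · rw [eval_quarticWell, eval_quarticWell, eu', ev']
  · rw [eval_quarticWell, eval_quarticWell, neg_lt_neg_iff]
    rcases le_or_gt x (crest κ) with h | h
    · exact hmono (Set.Ioo_subset_Icc_self hu) ⟨hu.1.le.trans hx.1.le, h⟩ hx.1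
    · rw [eu, ← ev]
      exact hanti h.le hv.le hx.2
  · rw [eval_derivative_quarticWell]
    have h0 := hu'.1.trans_le hx.1
    have := mul_pos h0 (slope_factor_pos h0.le (hx.2.trans_lt hu.2))
    linarith
  · rw [eval_derivative_quarticWell]
    have h0 := hv.trans_le hx.1
    have := mul_neg_of_pos_of_neg ((crest_pos κ).trans h0) (slope_factor_neg h0)
    linarith
  · rwa [hw hu hv eu ev (by linarith), hw hu' hv' eu' ev' hKv]

theorem exists_outer_points {κ s : ℝ} (h0 : 0 ≤ κ) (h3 : κ ≤ 3) (hs : 0 < s) (hs' : s ≤ 1312) :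
    ∃ a b : ℝ, -1319 ≤ a ∧ a < rootL κ ∧ rootR κ < b ∧ b ≤ 1319 ∧ hump κ a = -s ∧
      hump κ b = -s := by
  have hκ : |κ| ≤ 3 := by rwa [abs_of_nonneg h0]
  have hL := lt_rootL h0
  have hR := rootR_lt h3 h0
  have h1 := hump_lt_of_le_abs (S := 1312) (x := 1319) hκ (by norm_num) (by norm_num)
  have h2 := hump_lt_of_le_abs (S := 1312) (x := -1319) hκ (by norm_num) (by norm_num)
  obtain ⟨a, ha, ea⟩ := intermediate_value_Icc (show (-1319 : ℝ) ≤ rootL κ by linarith)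
    (continuous_hump κ).continuousOn
    (show -s ∈ Set.Icc (hump κ (-1319)) (hump κ (rootL κ)) from
      ⟨by linarith, by rw [hump_rootL]; linarith⟩)
  obtain ⟨b, hb, eb⟩ := intermediate_value_Icc' (show rootR κ ≤ (1319 : ℝ) by linarith)
    (continuous_hump κ).continuousOn
    (show -s ∈ Set.Icc (hump κ 1319) (hump κ (rootR κ)) from
      ⟨by linarith, by rw [hump_rootR]; linarith⟩)
  refine ⟨a, b, ha.1, lt_of_le_of_ne ha.2 ?_, lt_of_le_of_ne hb.1 ?_, hb.2, ea, eb⟩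
  · rintro rfl
    rw [hump_rootL] at ea
    linarith
  · rintro rfl
    rw [hump_rootR] at eb
    linarith

theorem exists_inner_points {κ t : ℝ} (ht : t < 0) (h : 0 < t + hump κ (crest κ)) :
    ∃ u v : ℝ, u ∈ Set.Ioo 0 (crest κ) ∧ crest κ < v ∧ v < rootR κ ∧ hump κ u = -t ∧
      hump κ v = -t := by
  have hz : hump κ 0 = 0 := by simp [hump]
  obtain ⟨u, hu, eu⟩ := intermediate_value_Ioo (crest_pos κ).le (continuous_hump κ).continuousOn
    (show -t ∈ Set.Ioo (hump κ 0) (hump κ (crest κ)) from ⟨by linarith, by linarith⟩)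
  obtain ⟨v, hv, ev⟩ := intermediate_value_Ioo' (crest_lt_rootR κ).le
    (continuous_hump κ).continuousOn
    (show -t ∈ Set.Ioo (hump κ (rootR κ)) (hump κ (crest κ)) from
      ⟨by rw [hump_rootR]; linarith, by linarith⟩)
  exact ⟨u, v, hu, hv.1, hv.2, eu, ev⟩

theorem hasSignPairs_three : HasSignPairs 3 5 := by
  obtain ⟨κ, a₀, a₁, a₂, x₀, t₁, t₂, s₀, s₁, s₂, s₃, hκ, hκ3, hx₀, ht, ht₂, hs₀, hs₀₁, hs₁₂, hs₂₃,
    hs₃, hw, hm₀, hm₁, hm₂⟩ := exists_alternating_masses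
  set f : ℝ[X] := C a₀ + C a₁ * X + C a₂ * X ^ 2 with hf
  have hfe : (fun x => f.eval x) = fun x => a₀ + a₁ * x + a₂ * x ^ 2 := by
    funext x
    simp [hf]
  have hdeg : f.natDegree ≤ 2 := by
    rw [hf]; compute_degree
  obtain ⟨u₁, v₁, hu₁, hv₁, hv₁', eu₁, ev₁⟩ := exists_inner_points (κ := κ) (ht.trans ht₂)
    (by linarith [hw.deep, hump_le_crest (κ := κ) hx₀.le])
  obtain ⟨u₂, v₂, hu₂, hv₂, hv₂', eu₂, ev₂⟩ := exists_inner_points (κ := κ) ht₂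
    (by linarith [hw.deep, hump_le_crest (κ := κ) hx₀.le])
  set S : Fin 5 → ℝ := ![s₀, s₁, s₂, s₃, 1312] with hS
  have hSm : StrictMono S := by
    rw [Fin.strictMono_iff_lt_succ]
    intro i
    fin_cases i <;> simpa [hS]
  have hS0 : ∀ i, 0 < S i := fun i => hs₀.trans_le (hSm.monotone (Fin.zero_le i))
  have hS1 : ∀ i, S i ≤ 1312 := fun i => hSm.monotone (Fin.le_last i)
  have hsign : ∀ i : Fin 4, mass κ (fun x => f.eval x) (-1319) 1319 (S i.castSucc) *
      mass κ (fun x => f.eval x) (-1319) 1319 (S i.succ) < 0 := by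
    rw [hfe]
    intro i
    fin_cases i
    · exact mul_neg_of_neg_of_pos hm₀ hm₁
    · exact mul_neg_of_pos_of_neg hm₁ hm₂
    · exact mul_neg_of_neg_of_pos hm₂ hw.outer_pos
    · exact mul_neg_of_pos_of_neg hw.outer_pos hw.outer_neg
  choose a b ha hal hbr hb ea eb using fun i => exists_outer_points hκ hκ3 (hS0 i) (hS1 i)
  have haa : ∀ {i j : Fin 5}, i ≤ j → a j ≤ a i := fun {i j} hij =>
    ((hump_strictMonoOn κ).le_iff_le (hal j).le (hal i).le).1 (by
      rw [ea, ea]; exact neg_le_neg (hSm.monotone hij))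
  have hbb : ∀ {i j : Fin 5}, i ≤ j → b i ≤ b j := fun {i j} hij =>
    ((hump_strictAntiOn κ).le_iff_ge (hbr j).le (hbr i).le).1 (by
      rw [eb, eb]; exact neg_le_neg (hSm.monotone hij))
  set q : Option (Fin 4) → Fin 4 → ℝ := fun o => o.elim ![u₂, u₁, v₁, v₂]
    fun i => ![a i.succ, a i.castSucc, b i.castSucc, b i.succ] with hq
  have hL := rootL_neg κ
  have hleft : ∀ i j : Fin 4, i < j →
      Disjoint (Set.Ioo (a i.succ) (a i.castSucc)) (Set.Ioo (a j.succ) (a j.castSucc)) :=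
    fun i j hij => Set.Ioo_disjoint_Ioo.2 ((min_le_right _ _).trans
      ((haa (Fin.succ_le_castSucc_iff.2 hij)).trans (le_max_left _ _)))
  have hright : ∀ i j : Fin 4, i < j →
      Disjoint (Set.Ioo (b i.castSucc) (b i.succ)) (Set.Ioo (b j.castSucc) (b j.succ)) :=
    fun i j hij => Set.Ioo_disjoint_Ioo.2 ((min_le_left _ _).trans
      ((hbb (Fin.succ_le_castSucc_iff.2 hij)).trans (le_max_right _ _)))
  have hleft' : ∀ i : Fin 4, Disjoint (Set.Ioo (a i.succ) (a i.castSucc)) (Set.Ioo u₂ u₁) :=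
    fun i => Set.Ioo_disjoint_Ioo.2 ((min_le_left _ _).trans
      (((hal _).trans (hL.trans hu₂.1)).le.trans (le_max_right _ _)))
  have hright' : ∀ i : Fin 4, Disjoint (Set.Ioo (b i.castSucc) (b i.succ)) (Set.Ioo v₁ v₂) :=
    fun i => Set.Ioo_disjoint_Ioo.2 ((min_le_right _ _).trans
      ((hv₂'.trans (hbr _)).le.trans (le_max_left _ _)))
  refine ⟨quarticWell κ, f, natDegree_quarticWell κ, by simp [leadingCoeff_quarticWell], by omega,
    Option (Fin 4), inferInstance, q, by simp, fun o => ?_, fun o o' h => ?_, fun o o' h => ?_⟩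
  · rcases o with _ | i
    · refine signPair_inner (K := 1319) f ht hu₁ hu₂ hv₁ hv₂ (show v₂ ≤ 1319 by linarith [rootR_lt hκ3 hκ])
        eu₁ ev₁ eu₂ ev₂ ?_
      rw [hfe]
      exact mul_neg_of_neg_of_pos hw.inner_neg hw.inner_pos
    · exact signPair_outer f (hS0 _) (hSm (Fin.castSucc_lt_succ)) (ha _) (hb _) (hal _)
        (hbr _) (hal _) (hbr _) (ea _) (eb _) (ea _) (eb _) (hsign i)
  · rcases o with _ | i <;> rcases o' with _ | j
    · exact absurd rfl h
    · exact (hleft' j).symm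
    · exact hleft' i
    · rcases lt_or_gt_of_ne (fun hij : i = j => h (congrArg some hij)) with hij | hij
      · exact hleft i j hij
      · exact (hleft j i hij).symm
  · rcases o with _ | i <;> rcases o' with _ | j
    · exact absurd rfl h
    · exact (hright' j).symm
    · exact hright' i
    · rcases lt_or_gt_of_ne (fun hij : i = j => h (congrArg some hij)) with hij | hij
      · exact hright i j hij
      · exact (hright j i hij).symm

/-- Iterating the composition with quadratic maps, starting from the quartic double well. -/
theorem hasSignPairs_two_pow (p : ℕ) :
    HasSignPairs (2 ^ (p + 2) - 1) ((p + 2) * 2 ^ (p + 1) + 1) := by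
  induction p with
  | zero => exact hasSignPairs_three
  | succ p ih =>
    have h := ih.succ
    have h1 := Nat.one_le_two_pow (n := p + 2)
    convert h using 1
    · rw [pow_succ]
      omega
    · rw [show (p + 1 + 2) * 2 ^ (p + 1 + 1) = 2 * ((p + 2) * 2 ^ (p + 1)) + 2 ^ (p + 2) by ring]
      omega

/-- The bound in the logarithmic form, for `m + 1 = 2 ^ (p + 1)`. -/
theorem two_pow_mul_log_div (p : ℕ) : ((2 : ℝ) ^ (p + 1)) * Real.log (2 ^ (p + 1)) / (2 * Real.log 2) + 1 =
    (p + 1) * 2 ^ p + 1 := by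
  have : Real.log 2 ≠ 0 := (Real.log_pos (by norm_num)).ne'
  rw [Real.log_pow]
  push_cast
  field_simp
  ring

theorem stmt15 (p : ℕ) (hp : 1 ≤ p) (m : ℕ) (hm : m = 2 ^ (p + 1) - 1) :
    HGe (m - 1) m (((m : ℝ) + 1) * Real.log ((m : ℝ) + 1) / (2 * Real.log 2) + 1) := by
  obtain ⟨p, rfl⟩ := Nat.exists_eq_add_of_le' hp
  have h : (m : ℝ) + 1 = 2 ^ (p + 1 + 1) := by
    rw [hm, Nat.cast_sub Nat.one_le_two_pow]
    push_cast
    ring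
  rw [h, two_pow_mul_log_div, hm]
  convert (hasSignPairs_two_pow p).hGe using 1
  push_cast
  ring
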